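/- arXiv:1904.07330 — 10 statements merged into one kernel-verified Lean document; each statement's English description precedes it below -/
import Mathlib

section
/- Let b, c ∈ F, k₁ = b² + c + 1 and k₂ = b² + b + c + √c (where √c denotes the unique square root of c in F). If k₁k₂ ≠ 0, then K(k₁k₂) = K(k₁k₂ + k₂). -/
/-- The Kloosterman sum over `GF(2^m)`: `K(a) = ∑_{x ≠ 0} (-1)^{Tr(a·x + 1/x)}`. -/
noncomputable def Kl (m : ℕ) (a : GaloisField 2 m) : ℤ :=
  letI := Fintype.ofFinite (GaloisField 2 m)
  letI := Classical.decEq (GaloisField 2 m)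
  ∑ x ∈ Finset.univ.erase (0 : GaloisField 2 m),
    (-1 : ℤ) ^ ((Algebra.trace (ZMod 2) (GaloisField 2 m) (a * x + x⁻¹)).val)

section helpers

variable {F : Type} [Field F] [CharP F 2]

theorem kk_two : (2 : F) = 0 := CharTwo.two_eq_zero

theorem kk_tr_uniq (tr : F →+ ZMod 2) (htr : ∀ x, tr (x ^ 2) = tr x)
    (al be r s : F) (hbe : be ≠ 0) (hrs : r ≠ s)
    (hr : r ^ 3 + al ^ 2 * r + be = 0) (hs : s ^ 3 + al ^ 2 * s + be = 0) :
    tr (al ^ 3 / be) = tr 1 := by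
  have h2 : (2 : F) = 0 := kk_two
  have hd : r - s ≠ 0 := sub_ne_zero.mpr hrs
  have hal : al ^ 2 = r ^ 2 + r * s + s ^ 2 := by
    have : (r - s) * (al ^ 2 - (r ^ 2 + r * s + s ^ 2)) = 0 := by
      linear_combination hr - hs - (r ^ 3 - s ^ 3) * h2
    rcases mul_eq_zero.mp this with h | h
    · exact absurd h hd
    · exact sub_eq_zero.mp h
  have hb : be = r * s * (r + s) := by
    linear_combination hr - r * hal - (r ^ 3 + r ^ 2 * s + r * s ^ 2) * h2
  have hs0 : s ≠ 0 := by rintro rfl; simp at hb; exact hbe hb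
  have hr0 : r ≠ 0 := by rintro rfl; simp at hb; exact hbe hb
  have hrs0 : r + s ≠ 0 := by intro h; rw [h] at hb; simp at hb; exact hbe hb
  obtain ⟨v, hv⟩ : ∃ v, r = s * v := ⟨r / s, by field_simp⟩
  have hv0 : v ≠ 0 := by rintro rfl; simp at hv; exact hr0 hv
  have hv1 : v + 1 ≠ 0 := by
    intro h; apply hrs0; rw [hv]; linear_combination s * h
  have key : (al ^ 3 / be) ^ 2 = 1 + ((v + v ^ 2) + (1 / (v * (v + 1)) + (1 / (v * (v + 1))) ^ 2)) := by
    have : (al ^ 3 / be) ^ 2 = (al ^ 2) ^ 3 / be ^ 2 := by ring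
    rw [this, hal, hb, hv]
    have : s * v + s = s * (v + 1) := by ring
    rw [this]
    field_simp
    linear_combination (v * (v + 1) + (v * (v+1))^2) * h2
  have z2 : ∀ a : ZMod 2, a + a = 0 := by decide
  rw [← htr, key]
  simp only [map_add, htr, z2, add_zero]

theorem kk_cubic_exists [Fintype F] (tr : F →+ ZMod 2) (htr : ∀ x, tr (x ^ 2) = tr x)
    (h90 : ∀ a, tr a = 0 → ∃ v, v ^ 2 + v = a) (hcube : ∀ a : F, ∃ z, z ^ 3 = a)
    (h1 : tr 1 = 1) (al be : F) (hbe : be ≠ 0) (h : tr (al ^ 3 / be) ≠ tr 1) :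
    ∃ r, r ^ 3 + al ^ 2 * r + be = 0 := by
  have h2 : (2 : F) = 0 := kk_two
  by_cases hal : al = 0
  · obtain ⟨z, hz⟩ := hcube be
    exact ⟨z, by rw [hal, hz]; linear_combination be * h2⟩
  have z2 : ∀ a : ZMod 2, a ≠ 1 → a = 0 := by decide
  obtain ⟨v, hv⟩ := h90 ((al ^ 3 / be) ^ 2) (by rw [htr]; exact z2 _ (h1 ▸ h))
  have hy0 : be / al ^ 3 ≠ 0 := div_ne_zero hbe (pow_ne_zero _ hal)
  have hw : (v * (be / al ^ 3)) ^ 2 + (be / al ^ 3) * (v * (be / al ^ 3)) + 1 = 0 := by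
    have : (be / al ^ 3) ^ 2 * (al ^ 3 / be) ^ 2 = 1 := by field_simp
    linear_combination (be / al ^ 3) ^ 2 * hv + this + h2
  obtain ⟨z, hz⟩ := hcube (v * (be / al ^ 3))
  rw [← hz] at hw
  have hz0 : z ≠ 0 := by
    rintro rfl
    simp at hw
  refine ⟨al * (z + 1 / z), ?_⟩
  have hw' : (z ^ 3) ^ 2 * al ^ 3 + be * z ^ 3 + al ^ 3 = 0 := by
    field_simp at hw
    linear_combination hw
  field_simp
  linear_combination hw' + 2 * (al ^ 3 * z ^ 4 + al ^ 3 * z ^ 2) * h2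

theorem kk_key (tr : F →+ ZMod 2) (htr : ∀ x, tr (x ^ 2) = tr x) (u y : F) (hu : u ≠ 0)
    (hy : y ≠ 0) :
    tr ((y + (u ^ 2 + u)) ^ 3 / (y * u ^ 2)) = tr (y + u * (u + 1) ^ 3 / y) + (tr u + tr 1) := by
  have h2 : (2 : F) = 0 := kk_two
  have key : (y + (u ^ 2 + u)) ^ 3 / (y * u ^ 2)
      = ((y / u) ^ 2 + y / u) + ((y + u * (u + 1) ^ 3 / y) + (u + 1) ^ 2) := by
    field_simp
    linear_combination (y ^ 2 * (u + u ^ 2) + y * (u + u ^ 2) ^ 2) * h2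
  have z2 : ∀ a b : ZMod 2, (a + a) + b = b := by decide
  rw [key]
  simp only [map_add, htr, z2]

variable [Fintype F] [DecidableEq F]

/-- the set where the trace differs -/
def kkP (tr : F →+ ZMod 2) (e : ZMod 2) (A : F) : Finset F :=
  (Finset.univ.erase 0).filter fun x => tr (x + A / x) ≠ e

/-- the isogeny -/
def kkR (u x : F) : F := x * (x + (u ^ 2 + u)) ^ 2 / (x + u ^ 2) ^ 2

theorem kk_root (u x : F) (hx : x + u ^ 2 ≠ 0) :
    (x + kkR u x) ^ 3 + (kkR u x + (u ^ 2 + u)) ^ 2 * (x + kkR u x) + kkR u x * u ^ 2 = 0 := by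
  have h2 : (2 : F) = 0 := kk_two
  have h : kkR u x * (x + u ^ 2) ^ 2 = x * (x + (u ^ 2 + u)) ^ 2 := by
    unfold kkR; field_simp
  generalize kkR u x = y at *
  grind

theorem kk_trR (tr : F →+ ZMod 2) (htr : ∀ x, tr (x ^ 2) = tr x) (u x : F)
    (hx : x + u ^ 2 ≠ 0) (hx0 : x ≠ 0) (hxp : x + (u ^ 2 + u) ≠ 0) (hu : u ≠ 0) (hu1 : u + 1 ≠ 0) :
    tr (kkR u x + u * (u + 1) ^ 3 / kkR u x) = tr (x + u ^ 3 * (u + 1) / x) := by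
  have h2 : (2 : F) = 0 := kk_two
  have e1 : kkR u x = x + (u ^ 2 / (x + u ^ 2) + (u ^ 2 / (x + u ^ 2)) ^ 2) := by
    unfold kkR; field_simp
    grind
  have hxp' : x + u * (u + 1) ≠ 0 := by
    intro h; apply hxp; linear_combination h
  have e2 : u * (u + 1) ^ 3 / kkR u x = u ^ 3 * (u + 1) / x +
      ((u ^ 2 + u) / (x + (u ^ 2 + u)) + ((u ^ 2 + u) / (x + (u ^ 2 + u))) ^ 2) := by
    unfold kkR; field_simp
    clear e1 htr
    grind
  have z2 : ∀ a b : ZMod 2, b + (a + a) = b := by decide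
  rw [map_add, e2, e1]
  simp only [map_add, htr, z2]

theorem kk_memP (tr : F →+ ZMod 2) (htr : ∀ x, tr (x ^ 2) = tr x) (u x : F)
    (hu : u ≠ 0) (hu1 : u + 1 ≠ 0) (h : x ∈ kkP tr (tr u) (u ^ 3 * (u + 1))) :
    x ≠ 0 ∧ x + u ^ 2 ≠ 0 ∧ x + (u ^ 2 + u) ≠ 0 := by
  have h2 : (2 : F) = 0 := kk_two
  have z2 : ∀ a b : ZMod 2, (a + a) + b = b := by decide
  simp only [kkP, Finset.mem_filter, Finset.mem_erase, Finset.mem_univ, and_true] at h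
  refine ⟨h.1, fun hx => h.2 ?_, fun hx => h.2 ?_⟩
  · have : x = u ^ 2 := by linear_combination hx - u ^ 2 * h2
    have : x + u ^ 3 * (u + 1) / x = (u ^ 2 + u ^ 2) + u := by
      rw [this]; field_simp; ring
    rw [this]; simp only [map_add, z2]
  · have : x = u * (u + 1) := by linear_combination hx - (u ^ 2 + u) * h2
    have : x + u ^ 3 * (u + 1) / x = (u ^ 2 + u ^ 2) + u := by
      rw [this]; field_simp; ring
    rw [this]; simp only [map_add, z2]

theorem kk_R0 (u x : F)
    (hx : x + u ^ 2 ≠ 0) (hx0 : x ≠ 0) (hxp : x + (u ^ 2 + u) ≠ 0) : kkR u x ≠ 0 := by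
  exact div_ne_zero (mul_ne_zero hx0 (pow_ne_zero 2 hxp)) (pow_ne_zero 2 hx)

theorem kk_z2 : ∀ a b c : ZMod 2, a ≠ b → a + (b + c) ≠ c := by decide

theorem kk_le (tr : F →+ ZMod 2) (htr : ∀ x, tr (x ^ 2) = tr x) (u : F)
    (hu : u ≠ 0) (hu1 : u + 1 ≠ 0) :
    (kkP tr (tr u) (u ^ 3 * (u + 1))).card ≤ (kkP tr (tr u) (u * (u + 1) ^ 3)).card := by
  apply Finset.card_le_card_of_injOn (kkR u)
  · intro x hx
    obtain ⟨h0, h1, h3⟩ := kk_memP tr htr u x hu hu1 hx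
    simp only [kkP, Finset.coe_filter, Finset.mem_filter, Finset.mem_erase, Finset.mem_univ,
      and_true, Set.mem_setOf_eq] at hx ⊢
    rw [kk_trR tr htr u x h1 h0 h3 hu hu1]
    exact ⟨kk_R0 u x h1 h0 h3, hx.2⟩
  · intro x hx x' hx' hxx
    obtain ⟨h0, h1, h3⟩ := kk_memP tr htr u x hu hu1 hx
    obtain ⟨h0', h1', h3'⟩ := kk_memP tr htr u x' hu hu1 hx'
    by_contra hne
    have r1 := kk_root u x h1
    have r2 := kk_root u x' h1'
    rw [← hxx] at r2
    have hR := kk_R0 u x h1 h0 h3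
    have := kk_tr_uniq tr htr _ _ _ _ (mul_ne_zero hR (pow_ne_zero 2 hu))
      (fun h => hne (add_right_cancel h)) r1 r2
    rw [kk_key tr htr u _ hu hR, kk_trR tr htr u x h1 h0 h3 hu hu1] at this
    simp only [kkP, Finset.coe_filter, Finset.mem_erase, Finset.mem_univ,
      and_true, Set.mem_setOf_eq] at hx
    exact kk_z2 _ _ _ hx.2 this

theorem kk_ge (tr : F →+ ZMod 2) (htr : ∀ x, tr (x ^ 2) = tr x)
    (h90 : ∀ a, tr a = 0 → ∃ v, v ^ 2 + v = a) (hcube : ∀ a : F, ∃ z, z ^ 3 = a)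
    (h1 : tr 1 = 1) (u : F) (hu : u ≠ 0) (hu1 : u + 1 ≠ 0) :
    (kkP tr (tr u) (u * (u + 1) ^ 3)).card ≤ (kkP tr (tr u) (u ^ 3 * (u + 1))).card := by
  have h2 : (2 : F) = 0 := kk_two
  apply Finset.card_le_card_of_surjOn (kkR u)
  intro y hy
  simp only [kkP, Finset.coe_filter, Finset.mem_erase, Finset.mem_univ,
      and_true, Set.mem_setOf_eq] at hy
  obtain ⟨hy0, hy⟩ := hy
  have hb : y * u ^ 2 ≠ 0 := mul_ne_zero hy0 (pow_ne_zero 2 hu)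
  obtain ⟨r, hr⟩ := kk_cubic_exists tr htr h90 hcube h1 (y + (u ^ 2 + u)) (y * u ^ 2) hb
    (by rw [kk_key tr htr u y hu hy0]; exact kk_z2 _ _ _ hy)
  obtain ⟨x, rfl⟩ : ∃ x, r = x + y := ⟨r - y, by ring⟩
  have hxy : y * (x + u ^ 2) ^ 2 = x * (x + (u ^ 2 + u)) ^ 2 := by
    grind
  have hxt : x + u ^ 2 ≠ 0 := by
    intro h
    have hx : x = u ^ 2 := by linear_combination h - u ^ 2 * h2
    rw [h, hx] at hxy
    have : u ^ 4 = 0 := by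
      grind
    exact hu (by simpa using this)
  have hx0 : x ≠ 0 := by
    rintro rfl
    simp [hy0, hu] at hxy
  have hxp : x + (u ^ 2 + u) ≠ 0 := by
    intro h
    rw [h] at hxy
    simp [hy0, hxt] at hxy
  have hR : kkR u x = y := by
    unfold kkR; rw [← hxy]; field_simp
  refine ⟨x, ?_, hR⟩
  simp only [kkP, Finset.coe_filter, Finset.mem_erase, Finset.mem_univ,
      and_true, Set.mem_setOf_eq]
  refine ⟨hx0, ?_⟩
  rw [← kk_trR tr htr u x hxt hx0 hxp hu hu1, hR]
  exact hy

theorem kk_card_eq (tr : F →+ ZMod 2) (htr : ∀ x, tr (x ^ 2) = tr x)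
    (h90 : tr 1 = 1 → ∀ a, tr a = 0 → ∃ v, v ^ 2 + v = a)
    (hcube : tr 1 = 1 → ∀ a : F, ∃ z, z ^ 3 = a)
    (u : F) (hu : u ≠ 0) (hu1 : u + 1 ≠ 0) :
    (kkP tr (tr u) (u * (u + 1) ^ 3)).card = (kkP tr (tr u) (u ^ 3 * (u + 1))).card := by
  have h2 : (2 : F) = 0 := kk_two
  refine le_antisymm ?_ (kk_le tr htr u hu hu1)
  by_cases h1 : tr 1 = 1
  · exact kk_ge tr htr (h90 h1) (hcube h1) h1 u hu hu1
  · have z2 : ∀ a : ZMod 2, a ≠ 1 → a = 0 := by decide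
    have e : u + 1 + 1 = u := by linear_combination h2
    have := kk_le tr htr (u + 1) hu1 (by rwa [e])
    rw [e, map_add, z2 _ h1, add_zero] at this
    rwa [mul_comm ((u + 1) ^ 3), mul_comm (u + 1)] at this

theorem kk_sum (tr : F →+ ZMod 2) (e : ZMod 2) (A : F) :
    ∑ x ∈ Finset.univ.erase (0 : F), (-1 : ℤ) ^ (tr (A * x + x⁻¹)).val
      = (-1) ^ e.val * (((Finset.univ.erase (0 : F)).card : ℤ) - 2 * (kkP tr e A).card) := by
  have s1 : ∑ x ∈ Finset.univ.erase (0 : F), (-1 : ℤ) ^ (tr (A * x + x⁻¹)).val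
      = ∑ x ∈ Finset.univ.erase (0 : F), (-1 : ℤ) ^ (tr (x + A / x)).val := by
    refine Finset.sum_nbij' (fun x => x⁻¹) (fun x => x⁻¹) ?_ ?_ ?_ ?_ ?_
    · simp
    · simp
    · simp
    · simp
    · intro x _
      rw [div_inv_eq_mul, add_comm]
  have z2 : ∀ a b : ZMod 2, (-1 : ℤ) ^ a.val = (-1) ^ b.val * (1 - 2 * if a ≠ b then 1 else 0) := by
    decide
  rw [s1, Finset.sum_congr rfl fun x _ => z2 _ e, ← Finset.mul_sum, Finset.sum_sub_distrib,
    ← Finset.mul_sum, Finset.sum_boole]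
  simp [kkP]

theorem kk_main (tr : F →+ ZMod 2) (htr : ∀ x, tr (x ^ 2) = tr x)
    (h90 : tr 1 = 1 → ∀ a, tr a = 0 → ∃ v, v ^ 2 + v = a)
    (hcube : tr 1 = 1 → ∀ a : F, ∃ z, z ^ 3 = a)
    (u : F) (hu : u ≠ 0) (hu1 : u + 1 ≠ 0) :
    ∑ x ∈ Finset.univ.erase (0 : F), (-1 : ℤ) ^ (tr (u * (u + 1) ^ 3 * x + x⁻¹)).val
    = ∑ x ∈ Finset.univ.erase (0 : F), (-1 : ℤ) ^ (tr (u ^ 3 * (u + 1) * x + x⁻¹)).val := by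
  rw [kk_sum tr (tr u), kk_sum tr (tr u), kk_card_eq tr htr h90 hcube u hu hu1]

end helpers

theorem kk_half {F : Type} [Field F] [CharP F 2] (a : F) (n : ℕ) :
    (∑ i ∈ Finset.range n, a ^ 4 ^ i) ^ 2 + (∑ i ∈ Finset.range n, a ^ 4 ^ i)
      = ∑ i ∈ Finset.range (2 * n), a ^ 2 ^ i := by
  induction n with
  | zero => simp
  | succ n ih =>
    have e : 2 * (n + 1) = 2 * n + 1 + 1 := by ring
    rw [e, Finset.sum_range_succ, Finset.sum_range_succ _ (2 * n + 1),
      Finset.sum_range_succ _ (2 * n), ← ih, CharTwo.add_sq]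
    have e1 : a ^ 2 ^ (2 * n) = a ^ 4 ^ n := by rw [pow_mul]; norm_num
    have e2 : a ^ 2 ^ (2 * n + 1) = (a ^ 4 ^ n) ^ 2 := by rw [pow_succ, pow_mul, e1]
    rw [e1, e2]; ring

theorem kloosterman_k1k2 (m : ℕ) (hm : 0 < m) (b c : GaloisField 2 m)
    (k1 k2 : GaloisField 2 m)
    (hk1 : k1 = b ^ 2 + c + 1)
    (hk2 : k2 = b ^ 2 + b + c + c ^ (2 ^ (m - 1)))
    (h : k1 * k2 ≠ 0) :
    Kl m (k1 * k2) = Kl m (k1 * k2 + k2) := by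
  have h2 : (2 : GaloisField 2 m) = 0 := kk_two
  letI := Fintype.ofFinite (GaloisField 2 m)
  letI := Classical.decEq (GaloisField 2 m)
  have hq : ∀ a : GaloisField 2 m, a ^ 2 ^ m = a := by
    intro a
    have := FiniteField.pow_card a
    rwa [← Nat.card_eq_fintype_card, GaloisField.card 2 m hm.ne'] at this
  obtain ⟨s, hs⟩ : ∃ s, s = c ^ 2 ^ (m - 1) := ⟨_, rfl⟩
  have hs2 : s ^ 2 = c := by
    rw [hs, ← pow_mul, ← pow_succ, Nat.sub_add_cancel hm, hq]
  rw [← hs] at hk2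
  have e1 : k1 * k2 = (b + s) * (b + s + 1) ^ 3 := by
    rw [hk1, hk2, ← hs2]; grind
  have e2 : k1 * k2 + k2 = (b + s) ^ 3 * (b + s + 1) := by
    rw [hk1, hk2, ← hs2]; grind
  have hu : b + s ≠ 0 := by
    intro h0; apply h; rw [e1, h0]; simp
  have hu1 : b + s + 1 ≠ 0 := by
    intro h0; apply h; rw [e1, h0]; simp
  rw [e2, e1]
  have hfr : Module.finrank (ZMod 2) (GaloisField 2 m) = m := GaloisField.finrank 2 hm.ne'
  have htr1 : Algebra.trace (ZMod 2) (GaloisField 2 m) 1 = (m : ZMod 2) := by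
    have := Algebra.trace_algebraMap (S := GaloisField 2 m) (1 : ZMod 2)
    rw [map_one, hfr] at this
    rw [this]; simp
  have hodd : Algebra.trace (ZMod 2) (GaloisField 2 m) 1 = 1 → Odd m := by
    intro h1
    rw [htr1] at h1
    exact (ZMod.natCast_eq_one_iff_odd).mp h1
  refine kk_main (Algebra.trace (ZMod 2) (GaloisField 2 m)).toAddMonoidHom ?_ ?_ ?_ (b + s) hu hu1
  · intro x
    have := Algebra.trace_eq_of_algEquiv
      (FiniteField.frobeniusAlgEquivOfAlgebraic (ZMod 2) (GaloisField 2 m)) x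
    simpa [FiniteField.coe_frobeniusAlgEquivOfAlgebraic] using this
  · intro h1 a ha
    obtain ⟨k, hk⟩ := hodd h1
    refine ⟨∑ i ∈ Finset.range (k + 1), a ^ 4 ^ i, ?_⟩
    have ht := FiniteField.algebraMap_trace_eq_sum_pow (ZMod 2) (GaloisField 2 m) a
    have ha' : Algebra.trace (ZMod 2) (GaloisField 2 m) a = 0 := ha
    rw [ha', hfr, map_zero, Nat.card_zmod] at ht
    have e : 2 * (k + 1) = m + 1 := by omega
    rw [kk_half, e, Finset.sum_range_succ, ← ht, hq, zero_add]
  · intro h1 a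
    obtain ⟨k, hk⟩ := hodd h1
    by_cases ha : a = 0
    · exact ⟨0, by simp [ha]⟩
    have hdiv : ∃ j, 3 * j + 1 = 2 * 2 ^ m := by
      have : 2 * 2 ^ m = 4 ^ (k + 1) := by
        rw [hk, show (4 : ℕ) = 2 ^ 2 by norm_num, ← pow_mul]; ring
      rw [this]
      have h4 : 4 ^ (k + 1) % 3 = 1 := by simp [Nat.pow_mod]
      exact ⟨4 ^ (k + 1) / 3, by omega⟩
    obtain ⟨j, hj⟩ := hdiv
    refine ⟨a ^ j, mul_right_cancel₀ ha ?_⟩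
    rw [← pow_mul, ← pow_succ, mul_comm j 3, hj, mul_comm 2, pow_mul, hq, sq]
end

section
/- For every a ∈ F with a ≠ 0 and a ≠ 1, K(a³(a+1)) = K(a(a+1)³) (Helleseth–Zinoviev Formula I). -/
section HZ
variable {F : Type*} [Field F] [Fintype F] [DecidableEq F]

theorem hz_r_ne (h2 : (2:F) = 0) (a x : F) (ha0 : a ≠ 0) (hx : x ≠ 0)
    (T : F →+ ZMod 2) (hT : ∀ u, T (u^2 + u) = 0)
    (hb : T (x + a^3*(a+1)/x^2) ≠ T a) : x + a ≠ 0 ∧ x^2 + (a^2+a) ≠ 0 := by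
  have hsq : ∀ u, T (u^2) = T u := by
    intro u
    have := hT u
    rw [map_add] at this
    rw [← CharTwo.add_eq_zero]; exact this
  constructor
  · intro h
    apply hb
    have : x = a := by linear_combination h - a * h2
    subst this
    rw [← hsq x]
    congr 1
    field_simp
    linear_combination h2
  · intro h
    apply hb
    have e1 : x + a^3*(a+1)/x^2 = x + a^2 := by
      have : x^2 = a*(a+1) := by linear_combination h - (a^2+a) * h2
      have h3 : a + 1 ≠ 0 := by
        intro h'
        rw [h', mul_zero] at this
        exact hx (pow_eq_zero_iff (two_ne_zero) |>.1 this)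
      rw [this]; field_simp
    have e2 : T x = 0 := by
      rw [← hsq, ← hT a]; congr 1
      linear_combination h - (a^2+a)*h2
    rw [e1, map_add, e2, hsq, zero_add]

theorem hz_f_g (h2 : (2:F) = 0) (a x : F) (ha0 : a ≠ 0) (ha1 : a + 1 ≠ 0) (hx : x ≠ 0)
    (T : F →+ ZMod 2) (hT : ∀ u, T (u^2 + u) = 0)
    (h1 : x + a ≠ 0) (h3 : x^2 + (a^2+a) ≠ 0) :
    T (x*(x^2+(a^2+a))/(x+a)^2 + a*(a+1)^3/(x*(x^2+(a^2+a))/(x+a)^2)^2)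
      = T (x + a^3*(a+1)/x^2) := by
  have e : x*(x^2+(a^2+a))/(x+a)^2 + a*(a+1)^3/(x*(x^2+(a^2+a))/(x+a)^2)^2
    = (x + a^3*(a+1)/x^2) + ((a/(x+a))^2 + a/(x+a)) +
      (((a^2+a)/(x^2+(a^2+a)))^2 + (a^2+a)/(x^2+(a^2+a))) := by
    have e1 : x*(x^2+(a^2+a))/(x+a)^2 = x + ((a/(x+a))^2 + a/(x+a)) := by
      field_simp
      grind
    have e2 : a*(a+1)^3/(x*(x^2+(a^2+a))/(x+a)^2)^2 = a^3*(a+1)/x^2 +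
      (((a^2+a)/(x^2+(a^2+a)))^2 + (a^2+a)/(x^2+(a^2+a))) := by
      have h3' : x^2 + a*(a+1) ≠ 0 := by
        intro h; apply h3; linear_combination h
      clear hT e1
      field_simp
      grind
    rw [e2]; nth_rewrite 1 [e1]; ring
  rw [e, map_add, map_add, hT, hT, add_zero, add_zero]

theorem hz_inj (h2 : (2:F) = 0) (a x y : F) (ha0 : a ≠ 0) (hx : x ≠ 0)
    (T : F →+ ZMod 2) (hT : ∀ u, T (u^2 + u) = 0)
    (h1 : x + a ≠ 0) (h1' : y + a ≠ 0)
    (hb : T (x + a^3*(a+1)/x^2) ≠ T a)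
    (hxy : x*(x^2+(a^2+a))/(x+a)^2 = y*(y^2+(a^2+a))/(y+a)^2) : x = y := by
  by_contra hne
  apply hb
  rw [div_eq_div_iff (pow_ne_zero _ h1) (pow_ne_zero _ h1')] at hxy
  have hq : y^2*(x+a)^2 + a*x*y + a^2*x^2 + a^3*(a+1) = 0 := by
    have : (x + y) ≠ 0 := by
      intro h; apply hne; linear_combination h - y*h2
    apply mul_left_cancel₀ this
    grind
  have e : (y*(x+a)^2/(a*x))^2 + y*(x+a)^2/(a*x) + (x^2 + x) = (x + a^3*(a+1)/x^2) + a := by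
    have hq2 := congrArg (fun z => (x+a)^2 * z) hq
    clear hT hxy hb hq
    field_simp
    grind
  have := congrArg T e
  rw [map_add, hT, hT, map_add, zero_add] at this
  rw [← CharTwo.add_eq_zero]; exact this.symm

theorem hz_surj (h2 : (2:F) = 0) (a X : F) (ha0 : a ≠ 0) (hX : X ≠ 0)
    (T : F →+ ZMod 2) (hT : ∀ u, T (u^2 + u) = 0) (hT1 : T 1 = 1)
    (hH : ∀ u, T u = 0 → ∃ v, v^2 + v = u) (hc : ∀ t : F, ∃ c, c^3 = t)
    (hb : T (X + a*(a+1)^3/X^2) ≠ T a) :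
    ∃ x, x ≠ 0 ∧ x + a ≠ 0 ∧ x*(x^2+(a^2+a))/(x+a)^2 = X := by
  have e : (X^2+(a^2+a))^3/(a*X)^2 = (X + a*(a+1)^3/X^2) + a + 1 + (X^2+X)
     + ((X^2/a)^2 + X^2/a) + (a^2 + a) := by
    field_simp
    grind
  have e0 : T ((X^2+(a^2+a))^3/(a*X)^2) = 0 := by
    rw [e]; simp only [map_add T _ (_^2 + _), hT]
    rw [map_add, map_add, hT1]
    generalize T (X + a*(a+1)^3/X^2) = s at *
    generalize T a = t at *
    revert s t; decide
  obtain ⟨u, hu0, hu⟩ : ∃ u, u ≠ 0 ∧ u^2 + u = (X^2+(a^2+a))^3/(a*X)^2 := by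
    obtain ⟨u, hu⟩ := hH _ e0
    by_cases h : u = 0
    · refine ⟨1, one_ne_zero, ?_⟩
      rw [← hu, h]; linear_combination h2
    · exact ⟨u, h, hu⟩
  obtain ⟨c, hc⟩ := hc (a*X*u)
  have hc0 : c ≠ 0 := by
    rintro rfl
    have : a*X*u ≠ 0 := mul_ne_zero (mul_ne_zero ha0 hX) hu0
    apply this; rw [← hc]; ring
  have hc2 : c^6 + a*X*c^3 + (X^2+(a^2+a))^3 = 0 := by
    have : (X^2+(a^2+a))^3 = (u^2+u)*(a*X)^2 := by
      rw [hu]; field_simp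
    rw [this]
    linear_combination (c^3 + a*X*u + a*X)*hc + (a*X*u)^2*h2 + a*X*u*a*X*h2
  have hP : ∃ x, x^3 + X*x^2+(a^2+a)*x+a^2*X = 0 := by
    refine ⟨c + (X^2+(a^2+a))/c + X, ?_⟩
    field_simp
    grind
  obtain ⟨x, hP⟩ := hP
  have hxa : x + a ≠ 0 := by
    intro h
    have : x = a := by linear_combination h - a * h2
    subst this
    have : x^2 = 0 := by linear_combination hP - (x^3+x^2*X)*h2
    exact ha0 (pow_eq_zero_iff (two_ne_zero) |>.1 this)
  refine ⟨x, ?_, hxa, ?_⟩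
  · rintro rfl
    have : a^2*X ≠ 0 := mul_ne_zero (pow_ne_zero _ ha0) hX
    apply this; linear_combination hP
  · field_simp
    grind

def hzB (T : F →+ ZMod 2) (b : F) (ε : ZMod 2) : Finset F :=
  Finset.univ.filter fun x => x ≠ 0 ∧ T (x + b/x^2) = ε

theorem hz_le (h2 : (2:F) = 0) (a : F) (ha0 : a ≠ 0) (ha1 : a + 1 ≠ 0)
    (T : F →+ ZMod 2) (hT : ∀ u, T (u^2 + u) = 0) :
    (hzB T (a^3*(a+1)) (T a + 1)).card ≤ (hzB T (a*(a+1)^3) (T a + 1)).card := by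
  have hne : ∀ s t : ZMod 2, s = t + 1 → s ≠ t := by decide
  apply Finset.card_le_card_of_injOn (fun x => x*(x^2+(a^2+a))/(x+a)^2)
  · intro x hx
    simp only [hzB, Finset.coe_filter, Finset.mem_univ, true_and, Set.mem_ofPred_eq] at hx ⊢
    obtain ⟨hx, hb⟩ := hx
    obtain ⟨h1, h3⟩ := hz_r_ne h2 a x ha0 hx T hT (hne _ _ hb)
    refine ⟨div_ne_zero (mul_ne_zero hx h3) (pow_ne_zero _ h1), ?_⟩
    rw [hz_f_g h2 a x ha0 ha1 hx T hT h1 h3, hb]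
  · intro x hx y hy hxy
    simp only [hzB, Finset.coe_filter, Finset.mem_univ, true_and, Set.mem_ofPred_eq] at hx hy
    obtain ⟨hx, hb⟩ := hx
    obtain ⟨hy, hb'⟩ := hy
    exact hz_inj h2 a x y ha0 hx T hT (hz_r_ne h2 a x ha0 hx T hT (hne _ _ hb)).1
      (hz_r_ne h2 a y ha0 hy T hT (hne _ _ hb')).1 (hne _ _ hb) hxy

theorem hz_ge_odd (h2 : (2:F) = 0) (a : F) (ha0 : a ≠ 0) (ha1 : a + 1 ≠ 0)
    (T : F →+ ZMod 2) (hT : ∀ u, T (u^2 + u) = 0) (hT1 : T 1 = 1)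
    (hH : ∀ u, T u = 0 → ∃ v, v^2 + v = u) (hc : ∀ t : F, ∃ c, c^3 = t) :
    (hzB T (a*(a+1)^3) (T a + 1)).card ≤ (hzB T (a^3*(a+1)) (T a + 1)).card := by
  have hne : ∀ s t : ZMod 2, s = t + 1 → s ≠ t := by decide
  apply Finset.card_le_card_of_surjOn (fun x => x*(x^2+(a^2+a))/(x+a)^2)
  intro X hX
  simp only [hzB, Finset.coe_filter, Finset.mem_univ, true_and, Set.mem_ofPred_eq] at hX
  obtain ⟨hX, hb⟩ := hX
  obtain ⟨x, hx, h1, rfl⟩ := hz_surj h2 a X ha0 hX T hT hT1 hH hc (hne _ _ hb)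
  refine ⟨x, ?_, rfl⟩
  simp only [hzB, Finset.coe_filter, Finset.mem_univ, true_and, Set.mem_ofPred_eq]
  refine ⟨hx, ?_⟩
  have h3 : x^2+(a^2+a) ≠ 0 := by
    intro h; apply hX; rw [h]; simp
  rw [← hz_f_g h2 a x ha0 ha1 hx T hT h1 h3, hb]

theorem hz_sum (T : F →+ ZMod 2) (b : F) (ε : ZMod 2) :
    ∑ x ∈ Finset.univ.erase (0:F), (-1:ℤ)^(T (x + b/x^2)).val
      = (-1)^ε.val * (2 * (hzB T b ε).card - (Finset.univ.erase (0:F)).card) := by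
  have h : ∀ s ε : ZMod 2, (-1:ℤ)^s.val = (-1)^ε.val * (2 * (if s = ε then 1 else 0) - 1) := by
    decide
  rw [Finset.sum_congr rfl (fun x _ => h (T (x + b/x^2)) ε), ← Finset.mul_sum,
    Finset.sum_sub_distrib, ← Finset.mul_sum, Finset.sum_boole]
  have : hzB T b ε = (Finset.univ.erase (0:F)).filter (fun x => T (x + b/x^2) = ε) := by
    ext x; simp [hzB]
  rw [this]; simp

theorem hz_H (h2 : (2:F) = 0) (T : F →+ ZMod 2) (hT : ∀ u, T (u^2 + u) = 0)
    (hs : Function.Surjective T) : ∀ u, T u = 0 → ∃ v, v^2 + v = u := by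
  let P : F →+ F := 
    { toFun := fun v => v^2 + v
      map_zero' := by simp
      map_add' := fun x y => by linear_combination x*y*h2 }
  have hle : P.range ≤ T.ker := by
    rintro _ ⟨v, rfl⟩
    exact hT v
  have hPk : Nat.card P.ker ≤ 2 := by
    have : (P.ker : Set F) ⊆ ({0, 1} : Finset F) := by
      intro v hv
      have hv : v^2 + v = 0 := hv
      have : v * (v + 1) = 0 := by linear_combination hv
      rcases mul_eq_zero.1 this with h | h
      · simp [h]
      · have : v = 1 := by linear_combination h - h2
        simp [this]
    have := Set.ncard_le_ncard this
    rw [Set.ncard_coe_finset] at this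
    exact this.trans Finset.card_le_two
  have c1 : Nat.card P.ker * Nat.card P.range = Nat.card F := by
    rw [← AddSubgroup.index_ker]; exact AddSubgroup.card_mul_index _
  have c2 : Nat.card T.ker * 2 = Nat.card F := by
    have : T.ker.index = 2 := by
      have ht := AddMonoidHom.range_eq_top.2 hs
      rw [AddSubgroup.index_ker]; simp [ht]
    have h := AddSubgroup.card_mul_index T.ker
    rwa [this] at h
  have heq : P.range = T.ker := by
    apply AddSubgroup.eq_of_le_of_card_ge hle
    nlinarith
  intro u hu
  have : u ∈ P.range := by rw [heq]; exact hu
  exact this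

theorem hz_main (h2 : (2:F) = 0) (m : ℕ) (hcard : Fintype.card F = 2^m)
    (a : F) (ha0 : a ≠ 0) (ha1 : a + 1 ≠ 0)
    (T : F →+ ZMod 2) (hT : ∀ u, T (u^2 + u) = 0) (hT1 : T 1 = m)
    (hs : Function.Surjective T) :
    ∑ x ∈ Finset.univ.erase (0:F), (-1:ℤ)^(T (x + a^3*(a+1)/x^2)).val =
    ∑ x ∈ Finset.univ.erase (0:F), (-1:ℤ)^(T (x + a*(a+1)^3/x^2)).val := by
  suffices h : (hzB T (a^3*(a+1)) (T a + 1)).card = (hzB T (a*(a+1)^3) (T a + 1)).card by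
    rw [hz_sum T _ (T a + 1), hz_sum T _ (T a + 1), h]
  apply le_antisymm (hz_le h2 a ha0 ha1 T hT)
  rcases Nat.even_or_odd m with hm | hm
  · have h0 : T 1 = 0 := by
      rw [hT1]; exact (ZMod.natCast_eq_zero_iff_even).2 hm
    have ea : a + 1 + 1 = a := by linear_combination h2
    have := hz_le h2 (a+1) ha1 (by rwa [ea]) T hT
    rw [ea, map_add, h0, add_zero] at this
    rwa [mul_comm a, mul_comm (a^3)]
  · have h1 : T 1 = 1 := by
      rw [hT1]; exact (ZMod.natCast_eq_one_iff_odd).2 hm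
    apply hz_ge_odd h2 a ha0 ha1 T hT h1 (hz_H h2 T hT hs)
    intro t
    obtain ⟨k, rfl⟩ := hm
    have hd : 3 ∣ 4^(k+1) - 1 := by
      simpa using Nat.sub_dvd_pow_sub_pow 4 1 (k+1)
    obtain ⟨n, hn⟩ := hd
    refine ⟨t^n, ?_⟩
    have hp : 4^(k+1) = 2 * 2^(2*k+1) := by
      rw [show 4 = 2^2 by norm_num, ← pow_mul]; ring
    have hpos : 1 ≤ 2^(2*k+1) := Nat.one_le_two_pow
    by_cases ht : t = 0
    · subst ht
      have : n ≠ 0 := by rintro rfl; omega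
      simp [this]
    have hf := FiniteField.pow_card t
    rw [hcard] at hf
    rw [← pow_mul, mul_comm, ← hn, hp]
    apply mul_right_cancel₀ ht
    rw [← pow_succ, Nat.sub_add_cancel (by omega), mul_comm, pow_mul, hf, pow_two]

end HZ

theorem hz_Kl (m : ℕ) (b : GaloisField 2 m)
    (hT : ∀ u : GaloisField 2 m, Algebra.trace (ZMod 2) (GaloisField 2 m) (u^2)
      = Algebra.trace (ZMod 2) (GaloisField 2 m) u) :
    letI := Fintype.ofFinite (GaloisField 2 m)
    letI := Classical.decEq (GaloisField 2 m)
    Kl m b = ∑ x ∈ Finset.univ.erase (0 : GaloisField 2 m),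
      (-1 : ℤ) ^ ((Algebra.trace (ZMod 2) (GaloisField 2 m) (x + b/x^2)).val) := by
  symm
  unfold Kl
  refine Finset.sum_bijective (fun x => (x^2)⁻¹) ?_ ?_ ?_
  · exact inv_involutive.bijective.comp (bijective_frobenius (GaloisField 2 m) 2)
  · intro i; simp
  · intro x hx
    rw [map_add, ← hT x, ← map_add]
    congr 3
    rw [inv_inv]; ring

theorem helleseth_zinoviev_I (m : ℕ) (hm : 0 < m) (a : GaloisField 2 m)
    (ha0 : a ≠ 0) (ha1 : a ≠ 1) :
    Kl m (a ^ 3 * (a + 1)) = Kl m (a * (a + 1) ^ 3) := by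
  have h2 : (2 : GaloisField 2 m) = 0 := CharTwo.two_eq_zero
  have hsq : ∀ u : GaloisField 2 m, Algebra.trace (ZMod 2) (GaloisField 2 m) (u^2)
      = Algebra.trace (ZMod 2) (GaloisField 2 m) u := by
    intro u
    have := Algebra.trace_eq_of_algEquiv
      (FiniteField.frobeniusAlgEquivOfAlgebraic (ZMod 2) (GaloisField 2 m)) u
    simpa [FiniteField.coe_frobeniusAlgEquivOfAlgebraic] using this
  rw [hz_Kl m _ hsq, hz_Kl m _ hsq]
  letI := Fintype.ofFinite (GaloisField 2 m)
  letI := Classical.decEq (GaloisField 2 m)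
  refine hz_main h2 m ?_ a ha0 ?_
    (Algebra.trace (ZMod 2) (GaloisField 2 m)).toAddMonoidHom ?_ ?_ ?_
  · rw [← Nat.card_eq_fintype_card]; exact GaloisField.card 2 m hm.ne'
  · intro h; apply ha1; linear_combination h - h2
  · intro u
    change Algebra.trace (ZMod 2) (GaloisField 2 m) (u^2 + u) = 0
    rw [map_add, hsq, CharTwo.add_self_eq_zero]
  · change Algebra.trace (ZMod 2) (GaloisField 2 m) 1 = m
    have := Algebra.trace_algebraMap (R := ZMod 2) (S := GaloisField 2 m) 1
    rw [map_one, GaloisField.finrank 2 hm.ne'] at this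
    rw [this]; simp
  · exact Algebra.trace_surjective (ZMod 2) (GaloisField 2 m)
end

section
/- For every a ∈ F with a ≠ 0 and a ≠ 1, K(a⁸(a⁴ + a)) = K((a+1)⁸(a⁴ + a)) (Hollmann–Xiang Formula). -/
theorem hx_z2 (z : ZMod 2) : z = 0 ∨ z = 1 := by revert z; decide

theorem hx_of_eq {F : Type*} [Field F] (T : F →+ ZMod 2) (hT : ∀ z, T (z ^ 2) = T z)
    (x y z : F) (h : x = y + (z ^ 2 + z)) : T x = T y := by
  rw [h, map_add, map_add, hT, CharTwo.add_self_eq_zero, add_zero]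

/-- The trace is preserved by the 3-isogeny. -/
theorem hx_trace {F : Type*} [Field F] [CharP F 2] (T : F →+ ZMod 2)
    (hT : ∀ z, T (z ^ 2) = T z) (b X : F) (hX : X ≠ 0) (h1 : X + b ^ 2 ≠ 0)
    (h2 : X + b ^ 2 + b ≠ 0) :
    T (X * (X + b ^ 2 + b) ^ 2 / (X + b ^ 2) ^ 2 +
      b * (b + 1) ^ 3 * (X * (X + b ^ 2 + b) ^ 2 / (X + b ^ 2) ^ 2)⁻¹) =
    T (X + b ^ 3 * (b + 1) * X⁻¹) := by
  have c2 : (2 : F) = 0 := CharTwo.two_eq_zero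
  apply hx_of_eq T hT _ _ (b ^ 2 / (X + b ^ 2) + (b ^ 2 + b) / (X + b ^ 2 + b))
  have e1 : X * (X + b ^ 2 + b) ^ 2 / (X + b ^ 2) ^ 2 =
      X + ((b ^ 2 / (X + b ^ 2)) ^ 2 + b ^ 2 / (X + b ^ 2)) := by
    field_simp
    grind
  have e2 : b * (b + 1) ^ 3 * (X * (X + b ^ 2 + b) ^ 2 / (X + b ^ 2) ^ 2)⁻¹ =
      b ^ 3 * (b + 1) * X⁻¹ +
      (((b ^ 2 + b) / (X + b ^ 2 + b)) ^ 2 + (b ^ 2 + b) / (X + b ^ 2 + b)) := by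
    field_simp
    grind
  rw [e2, e1]
  linear_combination (-(b ^ 2 / (X + b ^ 2)) * ((b ^ 2 + b) / (X + b ^ 2 + b))) * c2

/-- Two preimages force the trace to be that of the kernel. -/
theorem hx_two {F : Type*} [Field F] [CharP F 2] (T : F →+ ZMod 2)
    (hT : ∀ z, T (z ^ 2) = T z) (b v w : F) (hv : v ≠ 0) (hv1 : 1 + v ≠ 0)
    (h : b ^ 2 = v * w * (1 + v + w)) :
    T (b ^ 2 * (1 + v) / v + b ^ 3 * (b + 1) * (b ^ 2 * (1 + v) / v)⁻¹) = T b := by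
  have c2 : (2 : F) = 0 := CharTwo.two_eq_zero
  by_cases hb : b = 0
  · subst hb; simp
  have e1 : b ^ 2 * (1 + v) / v = v * w + b ^ 2 + (w ^ 2 + w) := by
    field_simp
    grind
  have e2 : b ^ 3 * (b + 1) * (b ^ 2 * (1 + v) / v)⁻¹ = (b ^ 2 + b) * (v / (1 + v)) := by
    field_simp
  have e3 : T ((b ^ 2 + b) * (v / (1 + v))) = T (v * w) := by
    rw [hx_of_eq T hT ((b ^ 2 + b) * (v / (1 + v)))
      (b ^ 2 * (v / (1 + v)) + b ^ 2 * (v / (1 + v)) ^ 2) (b * (v / (1 + v)))]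
    · have : b ^ 2 * (v / (1 + v)) + b ^ 2 * (v / (1 + v)) ^ 2 =
        v * w + ((v * w / (1 + v)) ^ 2 + (v * w / (1 + v))) := by
        rw [h]; field_simp; grind
      exact hx_of_eq T hT _ _ _ this
    · linear_combination (-(b ^ 2 * (v / (1 + v)) ^ 2)) * c2
  rw [map_add, e2, e3, hx_of_eq T hT _ _ _ e1, map_add, hT]
  have := CharTwo.add_self_eq_zero (T (v * w))
  linear_combination this

theorem hx_AS {F : Type*} [Field F] [Finite F] [CharP F 2] (T : F →+ ZMod 2)
    (hT : ∀ z, T (z ^ 2) = T z) (h1 : T 1 = 1) (z : F) (hz : T z = 0) :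
    ∃ y, z = y ^ 2 + y := by
  let e : ZMod 2 →+* F := ZMod.castHom (dvd_refl 2) F
  have hTe : ∀ t, T (e t) = t := by
    intro t
    rcases hx_z2 t with h | h <;> simp [h, h1]
  have key : ∀ y, T (y ^ 2 + y + e (T y)) = T y := by
    intro y
    rw [map_add, map_add, hT, hTe, CharTwo.add_self_eq_zero, zero_add]
  have inj : Function.Injective (fun y : F => y ^ 2 + y + e (T y)) := by
    intro x y hxy
    simp only at hxy
    have ht : T x = T y := by rw [← key x, hxy, key y]
    rw [ht] at hxy
    have c2 : (2 : F) = 0 := CharTwo.two_eq_zero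
    have : (x - y) * (x - y - 1) = 0 := by
      linear_combination hxy + (y ^ 2 - x * y - x + y) * c2
    rcases mul_eq_zero.1 this with h | h
    · exact sub_eq_zero.1 h
    · have := congrArg T h
      simp [ht, h1] at this
  obtain ⟨y, hy⟩ := (Finite.injective_iff_surjective.1 inj) z
  simp only at hy
  have : T y = 0 := by rw [← key y, hy, hz]
  exact ⟨y, by simpa [this] using hy.symm⟩

theorem hx_cube {F : Type*} [Field F] [Finite F] [CharP F 2] (T : F →+ ZMod 2)
    (hT : ∀ z, T (z ^ 2) = T z) (h1 : T 1 = 1) (z : F) : ∃ y, y ^ 3 = z := by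
  have c2 : (2 : F) = 0 := CharTwo.two_eq_zero
  have inj : Function.Injective (fun y : F => y ^ 3) := by
    intro x y hxy
    simp only at hxy
    by_cases hy : y = 0
    · subst hy
      simpa using hxy
    have : (x - y) * (x ^ 2 + x * y + y ^ 2) = 0 := by linear_combination hxy
    rcases mul_eq_zero.1 this with h | h
    · exact sub_eq_zero.1 h
    · exfalso
      have h3 : (1 : F) = 0 + ((x / y) ^ 2 + x / y) := by
        field_simp
        linear_combination h - (x * y + x ^ 2) * c2
      have := hx_of_eq T hT _ _ _ h3
      simp [h1] at this
  exact (Finite.injective_iff_surjective.1 inj) z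

/-- Cubic with a root. -/
theorem hx_root {F : Type*} [Field F] [Finite F] [CharP F 2] (T : F →+ ZMod 2)
    (hT : ∀ z, T (z ^ 2) = T z) (h1 : T 1 = 1) (A U : F) (hU : U ≠ 0)
    (h : T (A ^ 3 / U ^ 2) = 0) : ∃ y, y ^ 3 + A * y + U = 0 := by
  have c2 : (2 : F) = 0 := CharTwo.two_eq_zero
  obtain ⟨s, hs⟩ := hx_AS T hT h1 _ h
  have ht : ∃ t, t ≠ 0 ∧ t ^ 2 + U * t + A ^ 3 = 0 := by
    by_cases hA : A = 0
    · refine ⟨U, hU, ?_⟩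
      subst hA
      linear_combination U ^ 2 * c2
    · have : (U * s) ^ 2 + U * (U * s) + A ^ 3 = 0 := by
        field_simp at hs
        linear_combination hs + (U * s) ^ 2 * c2 + U ^ 2 * s * c2
      refine ⟨U * s, ?_, this⟩
      intro h0
      rw [h0] at this
      simp [hA] at this
  obtain ⟨t, ht0, ht⟩ := ht
  obtain ⟨p, hp⟩ := hx_cube T hT h1 t
  have hp0 : p ≠ 0 := by rintro rfl; simp at hp; exact ht0 hp.symm
  refine ⟨p + A / p, ?_⟩
  rw [← hp] at ht
  field_simp
  grind

theorem hx_surj {F : Type*} [Field F] [Finite F] [CharP F 2] (T : F →+ ZMod 2)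
    (hT : ∀ z, T (z ^ 2) = T z) (h1 : T 1 = 1) (b U : F) (hb : b ≠ 0) (hU : U ≠ 0)
    (h : T (U + b * (b + 1) ^ 3 * U⁻¹) = T b + 1) :
    ∃ X, X ≠ 0 ∧ X + b ^ 2 ≠ 0 ∧ X + b ^ 2 + b ≠ 0 ∧
      X * (X + b ^ 2 + b) ^ 2 / (X + b ^ 2) ^ 2 = U := by
  have c2 : (2 : F) = 0 := CharTwo.two_eq_zero
  have hA : T ((1 + b ^ 2 + U) ^ 3 / U ^ 2) = 0 := by
    have e : (1 + b ^ 2 + U) ^ 3 / U ^ 2 = (U + b * (b + 1) ^ 3 * U⁻¹ + b ^ 2 + 1) +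
       (((b + 1) ^ 3 / U) ^ 2 + (b + 1) ^ 3 / U) := by
      field_simp
      grind
    rw [hx_of_eq T hT _ _ _ e, map_add, map_add, h, hT, h1]
    have := CharTwo.add_self_eq_zero (T b + 1)
    linear_combination this
  obtain ⟨y, hy⟩ := hx_root T hT h1 _ U hU hA
  have hy0 : y ≠ 0 := by rintro rfl; simp [hU] at hy
  have hw : 1 + y ≠ 0 := by
    intro h0
    have : y = 1 := by linear_combination h0 - c2
    subst this
    apply hb
    have : b ^ 2 = 0 := by linear_combination hy - (1 + U) * c2
    simpa using this
  have e0 : b ^ 2 * y / (1 + y) + b ^ 2 = b ^ 2 / (1 + y) := by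
    field_simp
    linear_combination y * c2
  have hd : b ^ 2 * y / (1 + y) + b ^ 2 ≠ 0 := by
    rw [e0]; exact div_ne_zero (pow_ne_zero _ hb) hw
  have hE : b ^ 2 * y / (1 + y) * (b ^ 2 * y / (1 + y) + b ^ 2 + b) ^ 2 /
      (b ^ 2 * y / (1 + y) + b ^ 2) ^ 2 = U := by
    rw [e0]
    field_simp
    grind
  refine ⟨b ^ 2 * y / (1 + y), by simp [hb, hy0, hw], hd, ?_, hE⟩
  intro h0
  rw [h0] at hE
  simp at hE
  exact hU hE.symm

theorem hx_inj {F : Type*} [Field F] [CharP F 2] (T : F →+ ZMod 2)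
    (hT : ∀ z, T (z ^ 2) = T z) (b X Y : F) (hb : b ≠ 0) (hX : X ≠ 0)
    (hX1 : X + b ^ 2 ≠ 0) (hY1 : Y + b ^ 2 ≠ 0)
    (h : X * (X + b ^ 2 + b) ^ 2 / (X + b ^ 2) ^ 2 = Y * (Y + b ^ 2 + b) ^ 2 / (Y + b ^ 2) ^ 2)
    (ht : T (X + b ^ 3 * (b + 1) * X⁻¹) = T b + 1) : X = Y := by
  have c2 : (2 : F) = 0 := CharTwo.two_eq_zero
  by_contra hne
  have e : ∀ X : F, X + b ^ 2 ≠ 0 → X * (X + b ^ 2 + b) ^ 2 / (X + b ^ 2) ^ 2 =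
      X + ((b ^ 2 / (X + b ^ 2)) ^ 2 + b ^ 2 / (X + b ^ 2)) := by
    intro X h1
    field_simp
    grind
  rw [e X hX1, e Y hY1] at h
  obtain ⟨v, hv⟩ : ∃ v, v = b ^ 2 / (X + b ^ 2) := ⟨_, rfl⟩
  obtain ⟨w, hw⟩ : ∃ w, w = b ^ 2 / (Y + b ^ 2) := ⟨_, rfl⟩
  rw [← hv, ← hw] at h
  have hv0 : v ≠ 0 := by rw [hv]; exact div_ne_zero (pow_ne_zero _ hb) hX1
  have hw0 : w ≠ 0 := by rw [hw]; exact div_ne_zero (pow_ne_zero _ hb) hY1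
  have hv' : v * (X + b ^ 2) = b ^ 2 := by rw [hv]; field_simp
  have hw' : w * (Y + b ^ 2) = b ^ 2 := by rw [hw]; field_simp
  have hvw : v - w ≠ 0 := by
    intro h0
    apply hne
    have : v = w := sub_eq_zero.1 h0
    subst this
    have : v * (X - Y) = 0 := by linear_combination hv' - hw'
    rcases mul_eq_zero.1 this with h | h
    · exact absurd h hv0
    · exact sub_eq_zero.1 h
  have hv1 : 1 + v ≠ 0 := by
    intro h0
    have : v = 1 := by linear_combination h0 - c2
    subst this
    apply hX
    linear_combination hv'
  have hX' : X = b ^ 2 * (1 + v) / v := by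
    field_simp
    linear_combination hv' - v * b ^ 2 * c2
  have hk : b ^ 2 = v * w * (1 + v + w) := by
    apply mul_left_cancel₀ hvw
    -- b^2 w - b^2 v = v w (X - Y)
    have e1 : b ^ 2 * (v - w) = - (v * w * (X - Y)) := by
      linear_combination w * hv' - v * hw'
    linear_combination e1 - v * w * h
  have := hx_two T hT b v w hv0 hv1 hk
  rw [← hX', ht] at this
  simp at this

theorem hx_ne {F : Type*} [Field F] [CharP F 2] (T : F →+ ZMod 2)
    (hT : ∀ z, T (z ^ 2) = T z) (b X : F) (hb : b ≠ 0) (hb1 : b + 1 ≠ 0)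
    (ht : T (X + b ^ 3 * (b + 1) * X⁻¹) = T b + 1) :
    X + b ^ 2 ≠ 0 ∧ X + b ^ 2 + b ≠ 0 := by
  have c2 : (2 : F) = 0 := CharTwo.two_eq_zero
  constructor
  · intro h0
    have : X = b ^ 2 := by linear_combination h0 - b ^ 2 * c2
    subst this
    have e : b ^ 2 + b ^ 3 * (b + 1) * (b ^ 2)⁻¹ = b := by
      field_simp
      linear_combination b * c2
    rw [e] at ht
    simp at ht
  · intro h0
    have : X = b * (b + 1) := by linear_combination h0 - (b ^ 2 + b) * c2
    subst this
    have e : b * (b + 1) + b ^ 3 * (b + 1) * (b * (b + 1))⁻¹ = b := by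
      field_simp
      linear_combination b * c2
    rw [e] at ht
    simp at ht

open Classical in
/-- solutions with given trace -/
noncomputable def hxN {F : Type*} [Field F] [Fintype F] (T : F →+ ZMod 2) (c : F) (d : ZMod 2) :
    Finset F := Finset.univ.filter (fun x => x ≠ 0 ∧ T (x + c * x⁻¹) = d)

theorem hx_le {F : Type*} [Field F] [Fintype F] [CharP F 2] (T : F →+ ZMod 2)
    (hT : ∀ z, T (z ^ 2) = T z) (b : F) (hb : b ≠ 0) (hb1 : b + 1 ≠ 0) :
    (hxN T (b ^ 3 * (b + 1)) (T b + 1)).card ≤ (hxN T (b * (b + 1) ^ 3) (T b + 1)).card := by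
  apply Finset.card_le_card_of_injOn
    (fun X => X * (X + b ^ 2 + b) ^ 2 / (X + b ^ 2) ^ 2)
  · intro X hX
    simp only [hxN, Finset.coe_filter, Finset.mem_univ, true_and, Set.mem_ofPred_eq] at hX ⊢
    obtain ⟨h1, h2⟩ := hx_ne T hT b X hb hb1 hX.2
    refine ⟨div_ne_zero (mul_ne_zero hX.1 (pow_ne_zero _ h2)) (pow_ne_zero _ h1), ?_⟩
    rw [hx_trace T hT b X hX.1 h1 h2, hX.2]
  · intro X hX Y hY h
    simp only [hxN, Finset.coe_filter, Finset.mem_univ, true_and, Set.mem_ofPred_eq] at hX hY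
    exact hx_inj T hT b X Y hb hX.1 (hx_ne T hT b X hb hb1 hX.2).1
      (hx_ne T hT b Y hb hb1 hY.2).1 h hX.2

theorem hx_ge {F : Type*} [Field F] [Fintype F] [CharP F 2] (T : F →+ ZMod 2)
    (hT : ∀ z, T (z ^ 2) = T z) (h1 : T 1 = 1) (b : F) (hb : b ≠ 0) :
    (hxN T (b * (b + 1) ^ 3) (T b + 1)).card ≤ (hxN T (b ^ 3 * (b + 1)) (T b + 1)).card := by
  apply Finset.card_le_card_of_surjOn
    (fun X => X * (X + b ^ 2 + b) ^ 2 / (X + b ^ 2) ^ 2)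
  intro U hU
  simp only [hxN, Finset.coe_filter, Finset.mem_univ, true_and, Set.mem_ofPred_eq] at hU
  obtain ⟨X, hX, hX1, hX2, hE⟩ := hx_surj T hT h1 b U hb hU.1 hU.2
  refine ⟨X, ?_, hE⟩
  simp only [hxN, Finset.coe_filter, Finset.mem_univ, true_and, Set.mem_ofPred_eq]
  refine ⟨hX, ?_⟩
  rw [← hx_trace T hT b X hX hX1 hX2, hE, hU.2]

theorem hx_card {F : Type*} [Field F] [Fintype F] [CharP F 2] (T : F →+ ZMod 2)
    (hT : ∀ z, T (z ^ 2) = T z) (b : F) (hb : b ≠ 0) (hb1 : b + 1 ≠ 0) :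
    (hxN T (b ^ 3 * (b + 1)) (T b + 1)).card = (hxN T (b * (b + 1) ^ 3) (T b + 1)).card := by
  have c2 : (2 : F) = 0 := CharTwo.two_eq_zero
  apply le_antisymm (hx_le T hT b hb hb1)
  rcases hx_z2 (T 1) with h1 | h1
  · have hbb : b + 1 + 1 = b := by linear_combination c2
    have := hx_le T hT (b + 1) hb1 (by rwa [hbb])
    rw [hbb, map_add, h1, add_zero, mul_comm, mul_comm (b + 1)] at this
    exact this
  · exact hx_ge T hT h1 b hb

open Classical in
theorem hx_sum {F : Type*} [Field F] [Fintype F] (T : F →+ ZMod 2) (c : F) (d : ZMod 2) :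
    ∑ x ∈ Finset.univ.erase (0 : F), (-1 : ℤ) ^ (T (c * x + x⁻¹)).val =
      (-1) ^ d.val * (2 * (hxN T c d).card - (Finset.univ.erase (0 : F)).card) := by
  have e1 : ∑ x ∈ Finset.univ.erase (0 : F), (-1 : ℤ) ^ (T (c * x + x⁻¹)).val =
      ∑ x ∈ Finset.univ.erase (0 : F), (-1 : ℤ) ^ (T (x + c * x⁻¹)).val := by
    apply Finset.sum_nbij' (fun x => x⁻¹) (fun x => x⁻¹)
    · simp
    · simp
    · simp
    · simp
    · intro x _
      simp [add_comm]
  have e2 : hxN T c d = (Finset.univ.erase (0 : F)).filter (fun x => T (x + c * x⁻¹) = d) := by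
    ext x; simp [hxN]
  have e3 : ∀ x : F, (-1 : ℤ) ^ (T (x + c * x⁻¹)).val =
      (-1) ^ d.val * (2 * (if T (x + c * x⁻¹) = d then 1 else 0) - 1) := by
    intro x
    generalize T (x + c * x⁻¹) = t
    clear e1 e2
    revert t d
    decide
  rw [e1, e2, Finset.card_filter, Finset.sum_congr rfl (fun x _ => e3 x), ← Finset.mul_sum,
    Finset.sum_sub_distrib, ← Finset.mul_sum]
  simp

theorem hx_Kl (m : ℕ) (hm : 0 < m) (b : GaloisField 2 m) :
    Kl m (b ^ 3 * (b + 1)) = Kl m (b * (b + 1) ^ 3) := by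
  by_cases hb : b = 0
  · simp [hb]
  by_cases hb1 : b + 1 = 0
  · simp [hb1]
  letI := Fintype.ofFinite (GaloisField 2 m)
  let T : GaloisField 2 m →+ ZMod 2 :=
    (Algebra.trace (ZMod 2) (GaloisField 2 m)).toAddMonoidHom
  have hT : ∀ z, T (z ^ 2) = T z := by
    intro z
    have := Algebra.trace_eq_of_algEquiv
      (FiniteField.frobeniusAlgEquiv (ZMod 2) (GaloisField 2 m) 2) z
    simp at this
    exact this
  have h1 := hx_sum T (b ^ 3 * (b + 1)) (T b + 1)
  have h2 := hx_sum T (b * (b + 1) ^ 3) (T b + 1)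
  rw [hx_card T hT b hb hb1, ← h2] at h1
  exact h1

theorem hollmann_xiang (m : ℕ) (hm : 0 < m) (a : GaloisField 2 m)
    (ha0 : a ≠ 0) (ha1 : a ≠ 1) :
    Kl m (a ^ 8 * (a ^ 4 + a)) = Kl m ((a + 1) ^ 8 * (a ^ 4 + a)) := by
  have c2 : (2 : GaloisField 2 m) = 0 := CharTwo.two_eq_zero
  have h1 := hx_Kl m hm (a ^ 3)
  have h2 := hx_Kl m hm ((a + 1) ^ 3)
  have e1 : a ^ 8 * (a ^ 4 + a) = (a ^ 3) ^ 3 * (a ^ 3 + 1) := by ring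
  have e0 : (a + 1) * ((a + 1) ^ 3 + 1) = a ^ 4 + a := by
    linear_combination (2 * a ^ 3 + 3 * a ^ 2 + 2 * a + 1) * c2
  have e2 : (a + 1) ^ 8 * (a ^ 4 + a) = ((a + 1) ^ 3) ^ 3 * ((a + 1) ^ 3 + 1) := by
    rw [← e0]; ring
  have e3 : a ^ 3 * (a ^ 3 + 1) ^ 3 = (a + 1) ^ 3 * ((a + 1) ^ 3 + 1) ^ 3 := by
    rw [← mul_pow, ← mul_pow, e0]; ring
  rw [e1, e2, h1, h2, e3]
end

section
/- For every a ∈ F with a ≠ 0 and a ≠ 1, K(a/(a+1)⁴) = K(a³/(a+1)⁴) (Shin–Kumar–Helleseth Formula). -/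
section helpers

variable {F : Type*} [Field F] [Fintype F] [CharP F 2]

/-- third root -/
lemma skh_third {L : Type*} [Field L] [CharP L 2] {u p v r t : L} (hrt : r ≠ t)
    (hr : r ^ 3 + u * r ^ 2 + p * r + v = 0) (ht : t ^ 3 + u * t ^ 2 + p * t + v = 0) :
    p = r * t + r * (u + r + t) + t * (u + r + t) ∧ v = r * t * (u + r + t) := by
  have h2 : (2 : L) = 0 := CharTwo.two_eq_zero
  have h1 : p = r * t + r * (u + r + t) + t * (u + r + t) := by
    have : (r - t) * (p - (r * t + r * (u + r + t) + t * (u + r + t))) = 0 := by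
      grind
    rcases mul_eq_zero.1 this with h | h
    · exact absurd (sub_eq_zero.1 h) hrt
    · exact sub_eq_zero.1 h
  refine ⟨h1, ?_⟩
  linear_combination hr - r * h1 - h2 * (r ^ 3 + r ^ 2 * u + r ^ 2 * t + r * t ^ 2 + r * t * u + r ^ 2 * t)

lemma skh_resolvent {L : Type*} [Field L] [CharP L 2] (u p v r t w : L) (hw : w = u + r + t)
    (hp : p = r * t + r * w + t * w) (hv : v = r * t * w) :
    (r ^ 2 * t + t ^ 2 * w + w ^ 2 * r) ^ 2 + (u * p + v) * (r ^ 2 * t + t ^ 2 * w + w ^ 2 * r)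
      = u ^ 3 * v + p ^ 3 + v ^ 2 := by
  have h2 : (2 : L) = 0 := CharTwo.two_eq_zero
  have hu : u = r + t + w := by rw [hw]; linear_combination (-r - t) * h2
  subst hv hp
  rw [hu]
  clear hw hu
  have key : ∀ x y : L, x = y ↔ x + y = 0 := fun x y => (CharTwo.add_eq_zero).symm
  rw [key]
  clear key
  grind

lemma skh_cubic (u p v : F) (h : ∀ r : F, r ^ 3 + u * r ^ 2 + p * r + v = 0 →
      ∃ t, t ≠ r ∧ t ^ 3 + u * t ^ 2 + p * t + v = 0) :
    ∃ z : F, z ^ 2 + (u * p + v) * z = u ^ 3 * v + p ^ 3 + v ^ 2 := by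
  classical
  by_cases hex : ∃ r : F, r ^ 3 + u * r ^ 2 + p * r + v = 0
  · obtain ⟨r, hr⟩ := hex
    obtain ⟨t, htr, ht⟩ := h r hr
    obtain ⟨h1, h2⟩ := skh_third htr.symm hr ht
    exact ⟨_, skh_resolvent u p v r t (u + r + t) rfl h1 h2⟩
  · push Not at hex
    let L := AlgebraicClosure F
    haveI : CharP L 2 := charP_of_injective_algebraMap (algebraMap F L).injective 2
    let i := algebraMap F L
    let σ : L →ₐ[F] L := FiniteField.frobeniusAlgHom F L
    have hσ : ∀ x, σ x = x ^ Fintype.card F := fun x => rfl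
    have hσi : ∀ x : F, σ (i x) = i x := fun x => σ.commutes x
    have hσinj : Function.Injective σ := σ.toRingHom.injective
    have hfix : ∀ x : L, σ x = x → ∃ y : F, i y = x := by
      intro x hx
      have hroot : (Polynomial.map i (Polynomial.X ^ Fintype.card F - Polynomial.X)).eval x = 0 := by
        simp [← hσ, hx]
      have hprod : ∏ y : F, (Polynomial.X - Polynomial.C y) =
          (Polynomial.X ^ Fintype.card F - Polynomial.X : Polynomial F) := by
        have hroots := FiniteField.roots_X_pow_card_sub_X F
        have := Polynomial.prod_multiset_X_sub_C_of_monic_of_roots_card_eq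
          (p := (Polynomial.X ^ Fintype.card F - Polynomial.X : Polynomial F))
          (Polynomial.monic_X_pow_sub (by
            rw [Polynomial.degree_X]; exact_mod_cast Fintype.one_lt_card)) (by
            rw [hroots, FiniteField.X_pow_card_sub_X_natDegree_eq F Fintype.one_lt_card]
            rfl)
        rw [hroots] at this
        exact this
      rw [← hprod, Polynomial.map_prod, Polynomial.eval_prod,
        Finset.prod_eq_zero_iff] at hroot
      obtain ⟨y, -, hy⟩ := hroot
      refine ⟨y, ?_⟩
      simp at hy
      exact (sub_eq_zero.1 hy).symm
    let P : Polynomial L := Polynomial.X ^ 3 + (Polynomial.C (i u) * Polynomial.X ^ 2 + Polynomial.C (i p) * Polynomial.X + Polynomial.C (i v))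
    have hdeg : P.degree = 3 := by
      simp only [P]; compute_degree!
    obtain ⟨r, hr⟩ := IsAlgClosed.exists_root P (by rw [hdeg]; decide)
    have hr : r ^ 3 + i u * r ^ 2 + i p * r + i v = 0 := by
      have : P.eval r = 0 := hr
      simp only [P, Polynomial.eval_add, Polynomial.eval_mul, Polynomial.eval_pow, Polynomial.eval_X, Polynomial.eval_C] at this
      linear_combination this
    have hno : ∀ x : L, x ^ 3 + i u * x ^ 2 + i p * x + i v = 0 → σ x ≠ x := by
      intro x hx hs
      obtain ⟨y, rfl⟩ := hfix x hs
      apply hex y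
      apply i.injective
      simpa using hx
    have hσroot : ∀ x : L, x ^ 3 + i u * x ^ 2 + i p * x + i v = 0 →
        (σ x) ^ 3 + i u * (σ x) ^ 2 + i p * (σ x) + i v = 0 := by
      intro x hx
      have := congrArg σ hx
      simpa only [map_add, map_mul, map_pow, hσi, map_zero] using this
    have hs := hσroot r hr
    have ht := hσroot _ hs
    have hrs := hno r hr
    obtain ⟨h1, h2⟩ := skh_third hrs.symm hr hs
    set s := σ r with hsdef
    set t := σ s with htdef
    set w := i u + r + s with hw
    have two : (2 : L) = 0 := CharTwo.two_eq_zero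
    have hwroot : w ^ 3 + i u * w ^ 2 + i p * w + i v = 0 := by
      rw [h1, h2]
      have : i u = w + r + s := by rw [hw]; linear_combination (-r - s) * two
      rw [this]
      linear_combination two * (w ^ 3 + w ^ 2 * r + w ^ 2 * s + w * r * s)
    have hfac : (t - r) * (t - s) * (t - w) = 0 := by
      have : i u = w + r + s := by rw [hw]; linear_combination (-r - s) * two
      rw [this, h1, h2] at ht
      linear_combination ht - two * (t ^ 2 * (w + r + s) + r * s * w)
    have hσw : σ w = i u + s + t := by rw [hw, map_add, map_add, hσi]
    have htw : t = w := by
      rcases mul_eq_zero.1 hfac with h | h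
      · rcases mul_eq_zero.1 h with h | h
        · exfalso
          apply hno w hwroot
          rw [hσw, sub_eq_zero.1 h, hw]; ring
        · exact absurd (hσinj (sub_eq_zero.1 h : σ s = σ r)) hrs
      · exact sub_eq_zero.1 h
    have hσw' : σ w = r := by
      rw [hσw, htw, hw]; linear_combination (i u + s) * two
    obtain ⟨z, hz⟩ := hfix (r ^ 2 * s + s ^ 2 * w + w ^ 2 * r) (by
      simp only [map_add, map_mul, map_pow, hσw', ← hsdef, ← htdef, htw]; ring)
    refine ⟨z, i.injective ?_⟩
    have := skh_resolvent (i u) (i p) (i v) r s w hw h1 h2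
    rw [← hz] at this
    simpa using this

lemma skh_main [DecidableEq F] (χ : F → ℤ) (h0 : χ 0 = 1) (hadd : ∀ x y, χ (x + y) = χ x * χ y)
    (hsq : ∀ x, χ (x ^ 2) = χ x) (c : F) (hc0 : c ≠ 0) (hc1 : c + 1 ≠ 0) :
    ∑ x ∈ Finset.univ.erase (0 : F), χ (x + c ^ 3 * (c + 1) / x) =
      ∑ x ∈ Finset.univ.erase (0 : F), χ (x + c * (c + 1) ^ 3 / x) := by
  have two : (2 : F) = 0 := CharTwo.two_eq_zero
  have hself : ∀ x, χ x * χ x = 1 := fun x => by rw [← hadd, CharTwo.add_self_eq_zero, h0]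
  have has : ∀ x y h : F, x + y = h ^ 2 + h → χ x = χ y := by
    intro x y h e
    have : χ x * χ y = 1 := by rw [← hadd, e, hadd, hsq, hself]
    calc χ x = χ x * (χ y * χ y) := by rw [hself, mul_one]
      _ = χ y := by rw [← mul_assoc, this, one_mul]
  set s := c * (c + 1) with hs
  have hs0 : s ≠ 0 := mul_ne_zero hc0 hc1
  have hsc : s + c ^ 2 = c := by rw [hs]; linear_combination c ^ 2 * two
  have hsne : s ≠ c ^ 2 := by
    intro h; apply hc0; rw [← hsc, h]; exact CharTwo.add_self_eq_zero _
  have hadd0 : ∀ x y : F, x + y = 0 ↔ x = y := fun x y => CharTwo.add_eq_zero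
  let φ : F → F := fun x => x * (x + s) ^ 2 / (x + c ^ 2) ^ 2
  let g : F → ℤ := fun u => χ (u + c * (c + 1) ^ 3 / u)
  let D : Finset F := ((Finset.univ.erase 0).erase s).erase (c ^ 2)
  have hD : ∀ x, x ∈ D ↔ x ≠ c ^ 2 ∧ x ≠ s ∧ x ≠ 0 := by intro x; simp [D]
  have hmap : ∀ x ∈ D, φ x ∈ Finset.univ.erase (0 : F) := by
    intro x hx
    obtain ⟨h1, h2, h3⟩ := (hD x).1 hx
    simp only [Finset.mem_erase, Finset.mem_univ, and_true, φ]
    exact div_ne_zero (mul_ne_zero h3 (pow_ne_zero _ (by rwa [Ne, hadd0])))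
      (pow_ne_zero _ (by rwa [Ne, hadd0]))
  have hg : ∀ x ∈ D, χ (x + c ^ 3 * (c + 1) / x) = g (φ x) := by
    intro x hx
    obtain ⟨h1, h2, h3⟩ := (hD x).1 hx
    have h1' : x + c ^ 2 ≠ 0 := by rwa [Ne, hadd0]
    have h2' : x + s ≠ 0 := by rwa [Ne, hadd0]
    have e1 : x + φ x = (c ^ 2 / (x + c ^ 2)) ^ 2 + c ^ 2 / (x + c ^ 2) := by
      simp only [φ]
      field_simp
      clear_value s
      clear * - two hs
      subst hs
      grind
    have e2 : c ^ 3 * (c + 1) / x + c * (c + 1) ^ 3 / φ x = (s / (x + s)) ^ 2 + s / (x + s) := by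
      simp only [φ]
      field_simp
      clear_value s
      clear * - two hs
      subst hs
      grind
    apply has _ _ (c ^ 2 / (x + c ^ 2) + s / (x + s))
    linear_combination e1 + e2 - two * (c ^ 2 / (x + c ^ 2) * (s / (x + s)))
  have hcnt : ∀ u ∈ Finset.univ.erase (0 : F),
      ∑ x ∈ D with φ x = u, (g (φ x) - χ c) = g u - χ c := by
    intro u hu
    have hu0 : u ≠ 0 := by simpa using hu
    have : ∑ x ∈ D with φ x = u, (g (φ x) - χ c) = ∑ x ∈ D with φ x = u, (g u - χ c) := by
      apply Finset.sum_congr rfl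
      intro x hx
      rw [(Finset.mem_filter.1 hx).2]
    rw [this, Finset.sum_const]
    by_cases hgu : g u = χ c
    · simp [hgu]
    suffices hcard : (D.filter (fun x => φ x = u)).card = 1 by rw [hcard, one_smul]
    have hmem : ∀ x, x ∈ D.filter (fun x => φ x = u) ↔
        x ^ 3 + u * x ^ 2 + s ^ 2 * x + u * c ^ 4 = 0 := by
      intro x
      have e : x ^ 3 + u * x ^ 2 + s ^ 2 * x + u * c ^ 4 = x * (x + s) ^ 2 + u * (x + c ^ 2) ^ 2 := by
        linear_combination -two * (x ^ 2 * s + u * x * c ^ 2)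
      rw [Finset.mem_filter, hD, e]
      constructor
      · rintro ⟨⟨h1, h2, h3⟩, h4⟩
        have h1' : x + c ^ 2 ≠ 0 := by rwa [Ne, hadd0]
        rw [hadd0]
        simp only [φ] at h4
        rwa [div_eq_iff (pow_ne_zero _ h1')] at h4
      · intro h
        have h1 : x ≠ c ^ 2 := by
          rintro rfl
          rw [CharTwo.add_self_eq_zero, add_comm _ s, hsc] at h
          simp [hc0] at h
        have h1' : x + c ^ 2 ≠ 0 := by rwa [Ne, hadd0]
        refine ⟨⟨h1, ?_, ?_⟩, ?_⟩
        · rintro rfl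
          rw [CharTwo.add_self_eq_zero, hsc] at h
          simp [hc0, hu0] at h
        · rintro rfl
          simp [hc0, hu0] at h
        · simp only [φ]
          rw [div_eq_iff (pow_ne_zero _ h1')]
          rwa [hadd0] at h
    by_contra hne
    apply hgu
    obtain ⟨z, hz⟩ := skh_cubic u (s ^ 2) (u * c ^ 4) (by
      intro r hr
      by_contra hcon
      push Not at hcon
      apply hne
      rw [Finset.card_eq_one]
      refine ⟨r, ?_⟩
      ext x
      rw [hmem, Finset.mem_singleton]
      constructor
      · intro hx
        by_contra hxr
        exact hcon x hxr hx
      · rintro rfl; exact hr)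
    have hco : u * s ^ 2 + u * c ^ 4 = u * c ^ 2 := by
      have : s = c + c ^ 2 := by rw [hs]; ring
      rw [this]; linear_combination two * (u * c ^ 3 + u * c ^ 4)
    rw [hco] at hz
    have hfin : (u + c * (c + 1) ^ 3 / u) ^ 2 + (c ^ 2) ^ 2 = (z / (u * c ^ 2)) ^ 2 + z / (u * c ^ 2) := by
      have e3 : (z / (u * c ^ 2)) ^ 2 + z / (u * c ^ 2) = (z ^ 2 + u * c ^ 2 * z) / (u * c ^ 2) ^ 2 := by
        field_simp
      rw [e3, hz, hs]
      field_simp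
      linear_combination two * (c * (c + 1) ^ 3 * u ^ 2)
    have := has _ _ _ hfin
    rw [hsq, hsq, hsq] at this
    exact this
  have hfib := Finset.sum_fiberwise_of_maps_to hmap (fun x => g (φ x) - χ c)
  rw [Finset.sum_congr rfl hcnt, Finset.sum_sub_distrib, Finset.sum_sub_distrib] at hfib
  simp only [Finset.sum_const, nsmul_eq_mul] at hfib
  have m1 : s ∈ Finset.univ.erase (0 : F) := by simp [hs0]
  have m2 : c ^ 2 ∈ (Finset.univ.erase (0 : F)).erase s := by simp [hc0, hsne.symm]
  have c2 : ((Finset.univ.erase (0 : F)).card : ℤ) = (D.card : ℤ) + 2 := by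
    have a1 := Finset.card_erase_add_one m1
    have a2 := Finset.card_erase_add_one m2
    simp only [D]; omega
  rw [c2] at hfib
  rw [← Finset.add_sum_erase _ _ m1, ← Finset.add_sum_erase _ _ m2, Finset.sum_congr rfl hg]
  have v1 : s + c ^ 3 * (c + 1) / s = c := by
    have : c ^ 3 * (c + 1) / s = c ^ 2 := by rw [hs]; field_simp
    rw [this, hsc]
  have v2 : c ^ 2 + c ^ 3 * (c + 1) / c ^ 2 = c := by
    have : c ^ 3 * (c + 1) / c ^ 2 = s := by rw [hs]; field_simp
    rw [this, add_comm, hsc]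
  rw [v1, v2]
  simp only [g] at hfib ⊢
  linarith

end helpers

lemma skh_Kl (m : ℕ) (b : GaloisField 2 m) [Fintype (GaloisField 2 m)]
    [DecidableEq (GaloisField 2 m)] :
    Kl m b = ∑ x ∈ Finset.univ.erase (0 : GaloisField 2 m),
      (-1 : ℤ) ^ ((Algebra.trace (ZMod 2) (GaloisField 2 m) (x + b / x)).val) := by
  unfold Kl
  have : ∀ (i1 i2 : Fintype (GaloisField 2 m)) (d1 d2 : DecidableEq (GaloisField 2 m)),
    @Finset.erase _ d1 (@Finset.univ _ i1) 0 = @Finset.erase _ d2 (@Finset.univ _ i2) 0 := by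
    intro i1 i2 d1 d2
    obtain rfl := Subsingleton.elim i1 i2
    obtain rfl := Subsingleton.elim d1 d2
    rfl
  rw [this _ inferInstance _ inferInstance]
  refine Finset.sum_nbij' (fun x => x⁻¹) (fun x => x⁻¹) ?_ ?_ ?_ ?_ ?_
  · intro x hx; simpa using hx
  · intro x hx; simpa using hx
  · intro x _; simp
  · intro x _; simp
  · intro x _
    rw [div_inv_eq_mul, add_comm]

theorem shin_kumar_helleseth (m : ℕ) (hm : 0 < m) (a : GaloisField 2 m)
    (ha0 : a ≠ 0) (ha1 : a ≠ 1) :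
    Kl m (a / (a + 1) ^ 4) = Kl m (a ^ 3 / (a + 1) ^ 4) := by
  classical
  letI := Fintype.ofFinite (GaloisField 2 m)
  have ha : a + 1 ≠ 0 := by rwa [Ne, CharTwo.add_eq_zero]
  have two : (2 : GaloisField 2 m) = 0 := CharTwo.two_eq_zero
  have hc1 : a / (a + 1) + 1 = 1 / (a + 1) := by
    field_simp
    linear_combination a * two
  have key := skh_main
    (fun y => (-1 : ℤ) ^ ((Algebra.trace (ZMod 2) (GaloisField 2 m) y).val))
    (by simp)
    (by
      intro x y
      simp only [map_add]
      generalize Algebra.trace (ZMod 2) (GaloisField 2 m) x = p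
      generalize Algebra.trace (ZMod 2) (GaloisField 2 m) y = q
      revert p q
      decide)
    (by
      intro x
      have := Algebra.trace_eq_of_algEquiv
        (FiniteField.frobeniusAlgEquivOfAlgebraic (ZMod 2) (GaloisField 2 m)) x
      simp [FiniteField.coe_frobeniusAlgEquivOfAlgebraic] at this
      simp only [this])
    (a / (a + 1)) (div_ne_zero ha0 ha) (by rw [hc1]; exact one_div_ne_zero ha)
  rw [hc1] at key
  have e1 : (a / (a + 1)) ^ 3 * (1 / (a + 1)) = a ^ 3 / (a + 1) ^ 4 := by field_simp
  have e2 : (a / (a + 1)) * (1 / (a + 1)) ^ 3 = a / (a + 1) ^ 4 := by field_simp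
  rw [e1, e2] at key
  rw [skh_Kl, skh_Kl]
  exact key.symm
end

section
/- For every c ∈ F with c ≠ 1 (so that (c+1)⁴ ≠ 0), K(c⁶(c²+c+1)/(c+1)⁴) = K(c²(c²+c+1)³/(c+1)⁴). -/
section aux
variable {F : Type*} [Field F] [CharP F 2]

theorem aux_trace_map (T : F →+ ZMod 2) (hT : ∀ x, T (x ^ 2) = T x) (a x : F)
    (hx : x ≠ 0) (hxa : x + a ≠ 0) (hr : x ^ 2 + a ^ 2 + a ≠ 0) :
    T ((x * (x^2+a^2+a)/(x+a)^2) + a*(a+1)^3/ (x * (x^2+a^2+a)/(x+a)^2)^2)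
      = T (x + a^3*(a+1)/x^2) := by
  have h : (x * (x^2+a^2+a)/(x+a)^2) + a*(a+1)^3/ (x * (x^2+a^2+a)/(x+a)^2)^2 =
      x + a^3*(a+1)/x^2 + ((a/(x+a))^2 + a/(x+a))
        + (((a^2+a)/(x^2+a^2+a))^2+ (a^2+a)/(x^2+a^2+a)) := by
    field_simp
    grind
  rw [h, map_add, map_add, map_add T ((a/(x+a))^2), map_add T (((a^2+a)/(x^2+a^2+a))^2), hT, hT]
  simp [CharTwo.add_self_eq_zero]

theorem aux_excl (T : F →+ ZMod 2) (hT : ∀ x, T (x ^ 2) = T x) (a x : F) (ha : a ≠ 0)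
    (hx : x ≠ 0) (h : T (x + a^3*(a+1)/x^2) = T a + 1) :
    x + a ≠ 0 ∧ x ^ 2 + a ^ 2 + a ≠ 0 := by
  constructor
  · intro h0
    have e : x = a := CharTwo.add_eq_zero.mp h0
    subst e
    have : x + x^3*(x+1)/x^2 = x ^ 2 := by
      field_simp
      grind
    rw [this, hT] at h
    simp at h
  · intro h0
    have e : x ^ 2 = a ^ 2 + a := by grind
    have h3 : a ^ 2 + a ≠ 0 := by rw [← e]; positivity
    have h4 : a + 1 ≠ 0 := by
      intro h; apply h3; linear_combination a * h
    have e2 : a^3*(a+1)/x^2 = a ^ 2 := by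
      rw [e]
      field_simp
    rw [e2, map_add, ← hT x, e, map_add, hT] at h
    have : T a + T a = 0 := CharTwo.add_self_eq_zero _
    grind

theorem aux_inj (T : F →+ ZMod 2) (hT : ∀ x, T (x ^ 2) = T x) (a x z : F) (ha : a ≠ 0)
    (hx : x ≠ 0) (hxa : x + a ≠ 0) (hza : z + a ≠ 0)
    (h : T (x + a^3*(a+1)/x^2) = T a + 1)
    (he : x * (x^2+a^2+a)/(x+a)^2 = z * (z^2+a^2+a)/(z+a)^2) : x = z := by
  by_contra hne
  have hd : x - z ≠ 0 := sub_ne_zero.mpr hne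
  rw [div_eq_div_iff (by positivity) (by positivity)] at he
  -- the residual quadratic
  have hq : z ^ 2 * (x + a) ^ 2 + a * x * z + (a ^ 2 + a) * (x + a) ^ 2 + a * x ^ 2 = 0 := by
    apply mul_left_cancel₀ hd
    grind
  have hw : ((z * (x + a) ^ 2) / (a * x)) ^ 2 + (z * (x + a) ^ 2) / (a * x)
      = x ^ 2 + a ^ 3 * (a + 1) / x ^ 2 + a := by
    clear h hT he hne hd hza
    have hq' : (x + a) ^ 2 * (z ^ 2 * (x + a) ^ 2 + a * x * z + (a ^ 2 + a) * (x + a) ^ 2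
      + a * x ^ 2) = 0 := by rw [hq, mul_zero]
    clear hq
    field_simp
    grind
  have h0 : T (((z * (x + a) ^ 2) / (a * x)) ^ 2 + (z * (x + a) ^ 2) / (a * x)) = 0 := by
    rw [map_add, hT]; exact CharTwo.add_self_eq_zero _
  rw [hw, map_add, map_add, hT, ← map_add, h] at h0
  have : T a + T a = 0 := CharTwo.add_self_eq_zero _
  grind

theorem aux_surj (T : F →+ ZMod 2) (hT : ∀ x, T (x ^ 2) = T x) (h1 : T 1 = 1)
    (hH : ∀ z, T z = 0 → ∃ y, y ^ 2 + y = z)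
    (hc : ∀ u : F, ∃ v, v ^ 3 = u) (a X : F) (ha : a ≠ 0) (hX : X ≠ 0)
    (h : T (X + a*(a+1)^3/X^2) = T a + 1) :
    ∃ x, x ≠ 0 ∧ x + a ≠ 0 ∧ x * (x^2+a^2+a)/(x+a)^2 = X := by
  suffices hs : ∃ x, x ^ 3 + X * x ^ 2 + (a ^ 2 + a) * x + X * a ^ 2 = 0 by
    obtain ⟨x, hx⟩ := hs
    have hx0 : x ≠ 0 := by
      rintro rfl
      have : X * a ^ 2 = 0 := by simpa using hx
      simp_all
    have hxa : x + a ≠ 0 := by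
      intro h0
      have e : x = a := CharTwo.add_eq_zero.mp h0
      subst e
      have : x ^ 2 = 0 := by grind
      simp_all
    refine ⟨x, hx0, hxa, ?_⟩
    rw [div_eq_iff (by positivity)]
    grind
  have h0 : T ((X ^ 2 + a ^ 2 + a) ^ 3 / (a * X) ^ 2) = 0 := by
    have e : (X ^ 2 + a ^ 2 + a) ^ 3 / (a * X) ^ 2
        = (X ^ 2 / a) ^ 2 + X ^ 2 / a + X ^ 2 + (a + 1) ^ 2 + a*(a+1)^3/X^2 := by
      field_simp
      grind
    rw [e, map_add, map_add, map_add, map_add, hT, hT, hT, map_add, h1]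
    rw [map_add] at h
    have : T (X ^ 2 / a) + T (X ^ 2 / a) = 0 := CharTwo.add_self_eq_zero _
    grind
  obtain ⟨y, hy⟩ := hH _ h0
  obtain ⟨u, hu0, hu⟩ : ∃ u, u ≠ 0 ∧ u ^ 2 + (a * X) * u + (X ^ 2 + a ^ 2 + a) ^ 3 = 0 := by
    have hy' : (a * X * y) ^ 2 + (a * X) * (a * X * y) = (X ^ 2 + a ^ 2 + a) ^ 3 := by
      rw [eq_div_iff (by positivity)] at hy
      linear_combination hy
    by_cases hy0 : y = 0
    · refine ⟨a * X, by positivity, ?_⟩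
      subst hy0
      grind
    · refine ⟨a * X * y, by positivity, ?_⟩
      grind
  obtain ⟨v, rfl⟩ := hc u
  have hv : v ≠ 0 := by rintro rfl; simp at hu0
  refine ⟨v + (X ^ 2 + a ^ 2 + a) / v + X, ?_⟩
  field_simp
  grind

end aux

theorem aux_hilbert {F : Type*} [Field F] [Finite F] [Algebra (ZMod 2) F] [CharP F 2] (z : F)
    (hz : Algebra.trace (ZMod 2) F z = 0)
    (hT : ∀ x, Algebra.trace (ZMod 2) F (x ^ 2) = Algebra.trace (ZMod 2) F x) :
    ∃ y, y ^ 2 + y = z := by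
  let P : F →ₗ[ZMod 2] F := (AddMonoidHom.mk' (fun y : F => y ^ 2 + y)
    (by intro x y; grind)).toZModLinearMap 2
  have hP : ∀ y, P y = y ^ 2 + y := fun _ => rfl
  have hle : LinearMap.range P ≤ LinearMap.ker (Algebra.trace (ZMod 2) F) := by
    rintro _ ⟨y, rfl⟩
    rw [LinearMap.mem_ker, hP, map_add, hT]
    exact CharTwo.add_self_eq_zero _
  have hk : LinearMap.ker P ≤ Submodule.span (ZMod 2) {1} := by
    intro y hy
    rw [LinearMap.mem_ker, hP] at hy
    have : y * (y + 1) = 0 := by linear_combination hy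
    rcases mul_eq_zero.mp this with h | h
    · rw [h]; exact Submodule.zero_mem _
    · rw [CharTwo.add_eq_zero.mp h]; exact Submodule.mem_span_singleton_self _
  have h1 := LinearMap.finrank_range_add_finrank_ker P
  have h2 := LinearMap.finrank_range_add_finrank_ker (Algebra.trace (ZMod 2) F)
  have h3 : Module.finrank (ZMod 2) (LinearMap.ker P) ≤ 1 :=
    (Submodule.finrank_mono hk).trans (finrank_span_singleton (one_ne_zero)).le
  rw [LinearMap.range_eq_top.mpr (Algebra.trace_surjective (ZMod 2) F), finrank_top,
    Module.finrank_self] at h2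
  have := Submodule.eq_of_le_of_finrank_le hle (by omega)
  have hz' : z ∈ LinearMap.range P := by rw [this]; exact hz
  exact hz'

theorem aux_frob {F : Type*} [Field F] [Finite F] [Algebra (ZMod 2) F] [CharP F 2] (x : F) :
    Algebra.trace (ZMod 2) F (x ^ 2) = Algebra.trace (ZMod 2) F x := by
  have := Algebra.trace_eq_of_algEquiv (FiniteField.frobeniusAlgEquivOfAlgebraic (ZMod 2) F) x
  simpa [ZMod.card] using this

theorem aux_cube {F : Type*} [Field F] [Finite F] (m : ℕ) (hm : Odd m)
    (hF : Nat.card F = 2 ^ m) (u : F) : ∃ v, v ^ 3 = u := by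
  by_cases hu : u = 0
  · exact ⟨0, by simp [hu]⟩
  have hcop : (Nat.card Fˣ).Coprime 3 := by
    rw [Nat.card_units, hF]
    obtain ⟨k, rfl⟩ := hm
    rw [Nat.coprime_comm, Nat.Prime.coprime_iff_not_dvd Nat.prime_three]
    have h4 : 4 ^ k % 3 = 1 := by
      rw [Nat.pow_mod]; simp
    rw [pow_add, pow_mul]
    norm_num
    omega
  obtain ⟨v, hv⟩ := (powCoprime hcop).surjective (Units.mk0 u hu)
  exact ⟨v, by simpa using congrArg Units.val hv⟩

/-- number of nonzero points with given trace -/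
noncomputable def auxN (m : ℕ) (b : GaloisField 2 m) (t : ZMod 2) : ℕ :=
  Nat.card {x : GaloisField 2 m // x ≠ 0 ∧
    Algebra.trace (ZMod 2) (GaloisField 2 m) (x + b / x ^ 2) = t}

theorem aux_le (m : ℕ) (a : GaloisField 2 m) (ha : a ≠ 0) :
    auxN m (a^3*(a+1)) (Algebra.trace (ZMod 2) (GaloisField 2 m) a + 1) ≤
    auxN m (a*(a+1)^3) (Algebra.trace (ZMod 2) (GaloisField 2 m) a + 1) := by
  have hT := aux_frob (F := GaloisField 2 m)
  let T : GaloisField 2 m →+ ZMod 2 := (Algebra.trace (ZMod 2) (GaloisField 2 m)).toAddMonoidHom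
  refine Nat.card_le_card_of_injective (fun x => ⟨x.1 * (x.1^2+a^2+a)/(x.1+a)^2, ?_, ?_⟩) ?_
  · obtain ⟨x, hx, h⟩ := x
    obtain ⟨h1, h2⟩ := aux_excl T hT a x ha hx h
    exact div_ne_zero (mul_ne_zero hx h2) (pow_ne_zero _ h1)
  · obtain ⟨x, hx, h⟩ := x
    obtain ⟨h1, h2⟩ := aux_excl T hT a x ha hx h
    exact (aux_trace_map T hT a x hx h1 h2).trans h
  · rintro ⟨x, hx, h⟩ ⟨z, hz, h'⟩ he
    obtain ⟨h1, h2⟩ := aux_excl T hT a x ha hx h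
    obtain ⟨h3, h4⟩ := aux_excl T hT a z ha hz h'
    exact Subtype.ext (aux_inj T hT a x z ha hx h1 h3 h (congrArg Subtype.val he))

theorem aux_ge (m : ℕ) (hm : Odd m) (a : GaloisField 2 m) (ha : a ≠ 0) (ha1 : a + 1 ≠ 0) :
    auxN m (a*(a+1)^3) (Algebra.trace (ZMod 2) (GaloisField 2 m) a + 1) ≤
    auxN m (a^3*(a+1)) (Algebra.trace (ZMod 2) (GaloisField 2 m) a + 1) := by
  have hT := aux_frob (F := GaloisField 2 m)
  have hm0 : m ≠ 0 := by rintro rfl; simp at hm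
  let T : GaloisField 2 m →+ ZMod 2 := (Algebra.trace (ZMod 2) (GaloisField 2 m)).toAddMonoidHom
  have h1 : T 1 = 1 := by
    have := Algebra.trace_algebraMap (S := GaloisField 2 m) (1 : ZMod 2)
    rw [map_one, GaloisField.finrank 2 hm0] at this
    refine this.trans ?_
    rw [nsmul_one]
    exact (ZMod.natCast_eq_one_iff_odd).mpr hm
  have key := fun X hX h => aux_surj T hT h1 (fun z hz => aux_hilbert z hz hT)
    (aux_cube m hm (GaloisField.card 2 m hm0)) a X ha hX h
  choose f hf0 hfa hf using key
  refine Nat.card_le_card_of_injective (fun X => ⟨f X.1 X.2.1 X.2.2, hf0 _ _ _, ?_⟩) ?_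
  · obtain ⟨X, hX, h⟩ := X
    have e := hf X hX h
    have h2 : f X hX h ^ 2 + a ^ 2 + a ≠ 0 := by
      intro h0
      rw [h0] at e
      simp at e
      exact hX e.symm
    have := aux_trace_map T hT a _ (hf0 X hX h) (hfa X hX h) h2
    rw [e] at this
    exact this.symm.trans h
  · rintro ⟨X, hX, h⟩ ⟨Z, hZ, h'⟩ he
    have he' : f X hX h = f Z hZ h' := congrArg Subtype.val he
    apply Subtype.ext
    show X = Z
    rw [← hf X hX h, ← hf Z hZ h', he']

theorem aux_Kl (m : ℕ) (b : GaloisField 2 m) (t : ZMod 2) :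
    Kl m b = (-1) ^ t.val * (2 * (auxN m b t : ℤ) - (Nat.card (GaloisField 2 m) - 1)) := by
  classical
  letI := Fintype.ofFinite (GaloisField 2 m)
  have e1 : Kl m b = ∑ x ∈ Finset.univ.erase (0 : GaloisField 2 m),
      (-1 : ℤ) ^ ((Algebra.trace (ZMod 2) (GaloisField 2 m) (x + b / x ^ 2)).val) := by
    unfold Kl
    symm
    refine Finset.sum_bij (fun x _ => (x ^ 2)⁻¹) ?_ ?_ ?_ ?_
    · intro x hx
      simpa using hx
    · intro x _ y _ h
      have : x ^ 2 = y ^ 2 := inv_injective h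
      exact CharTwo.sq_injective this
    · intro y hy
      obtain ⟨w, hw⟩ := (Finite.surjective_of_injective
        (CharTwo.sq_injective (R := GaloisField 2 m))) y⁻¹
      refine ⟨w, ?_, ?_⟩
      · simp only [Finset.mem_erase, Finset.mem_univ, and_true] at hy ⊢
        rintro rfl
        simp at hw
        exact hy hw.symm
      · simp only at hw
        rw [hw, inv_inv]
    · intro x _
      rw [map_add, map_add, inv_inv, aux_frob, div_eq_mul_inv, add_comm]
  have e2 : auxN m b t = ((Finset.univ.erase (0 : GaloisField 2 m)).filter (fun x =>
      Algebra.trace (ZMod 2) (GaloisField 2 m) (x + b / x ^ 2) = t)).card := by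
    unfold auxN
    rw [Nat.card_eq_fintype_card, Fintype.card_subtype]
    congr 1
    ext x
    simp
  have e3 : ∀ s : ZMod 2, (-1 : ℤ) ^ s.val = (-1) ^ t.val * (2 * (if s = t then 1 else 0) - 1) := by
    clear e2
    revert t; decide
  rw [e1, Finset.sum_congr rfl (fun x _ => e3 _), ← Finset.mul_sum, Finset.sum_sub_distrib,
    ← Finset.mul_sum, Finset.sum_boole, ← e2, Finset.sum_const, Finset.card_erase_of_mem
    (Finset.mem_univ _), Finset.card_univ, Nat.card_eq_fintype_card, nsmul_one,
    Nat.cast_sub Fintype.card_pos]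
  simp

theorem aux_main (m : ℕ) (hm : 0 < m) (a : GaloisField 2 m) :
    Kl m (a ^ 3 * (a + 1)) = Kl m (a * (a + 1) ^ 3) := by
  by_cases ha : a = 0
  · simp [ha]
  by_cases ha1 : a + 1 = 0
  · simp [ha1]
  rw [aux_Kl m _ (Algebra.trace (ZMod 2) (GaloisField 2 m) a + 1),
    aux_Kl m (a * (a + 1) ^ 3) (Algebra.trace (ZMod 2) (GaloisField 2 m) a + 1)]
  rw [le_antisymm (aux_le m a ha) ?_]
  rcases Nat.even_or_odd m with he | ho
  · have h := aux_le m (a + 1) ha1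
    have h1 : Algebra.trace (ZMod 2) (GaloisField 2 m) 1 = 0 := by
      have := Algebra.trace_algebraMap (S := GaloisField 2 m) (1 : ZMod 2)
      rw [map_one, GaloisField.finrank 2 hm.ne'] at this
      refine this.trans ?_
      rw [nsmul_one]
      exact (ZMod.natCast_eq_zero_iff_even).mpr he
    have h2 : a + 1 + 1 = a := by grind
    rwa [map_add, h1, add_zero, h2, mul_comm _ a, mul_comm (a + 1)] at h
  · exact aux_ge m ho a ha ha1

theorem cor1_1 (m : ℕ) (hm : 0 < m) (c : GaloisField 2 m) (hc : c ≠ 1) :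
    Kl m (c ^ 6 * (c ^ 2 + c + 1) / (c + 1) ^ 4)
      = Kl m (c ^ 2 * (c ^ 2 + c + 1) ^ 3 / (c + 1) ^ 4) := by
  have h : c + 1 ≠ 0 := fun h => hc (CharTwo.add_eq_zero.mp h)
  have key := aux_main m hm (c ^ 2 / (c + 1))
  have e : c ^ 2 / (c + 1) + 1 = (c ^ 2 + c + 1) / (c + 1) := by field_simp; ring
  rw [e] at key
  convert key using 2 <;> field_simp
end

section
/- For every c ∈ F with c⁸ + c⁴ + 1 ≠ 0, K(c⁹(c+1)³/(c⁸+c⁴+1)) = K(c³(c+1)⁹/(c⁸+c⁴+1)). -/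
theorem kl_resolvent {L : Type*} [Field L] [CharP L 2] (p q r s : L) (hq : q ≠ 0)
    (hr : r ^ 3 + p * r + q = 0) (hs : s ^ 3 + p * s + q = 0) (hne : r ≠ s) :
    ((r ^ 3 + r ^ 2 * s + s ^ 3) / q) ^ 2 + (r ^ 3 + r ^ 2 * s + s ^ 3) / q
      = p ^ 3 / q ^ 2 + 1 := by
  have h2 : (2 : L) = 0 := CharTwo.two_eq_zero
  have hp : p = r ^ 2 + r * s + s ^ 2 := by
    have : (r - s) * (r ^ 2 + r * s + s ^ 2 + p) = 0 := by linear_combination hr - hs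
    rcases mul_eq_zero.1 this with h | h
    · exact absurd (sub_eq_zero.1 h) hne
    · linear_combination h - (r ^ 2 + r * s + s ^ 2) * h2
  have hq' : q = r * s * (r + s) := by
    subst hp
    linear_combination hr - (r^3 + r^2 * s + r * s^2) * h2
  field_simp
  subst hp
  rw [hq']
  ring_nf
  simp
  grind

theorem kl_third {L : Type*} [Field L] [CharP L 2] (p q r s t : L)
    (hr : r ^ 3 + p * r + q = 0) (hs : s ^ 3 + p * s + q = 0) (ht : t ^ 3 + p * t + q = 0)
    (h1 : r ≠ s) (h2 : t ≠ r) (h3 : t ≠ s) : t = r + s := by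
  have hh : (2 : L) = 0 := CharTwo.two_eq_zero
  have e1 : (r ^ 2 + r * s + s ^ 2 + p) = 0 :=
    mul_left_cancel₀ (sub_ne_zero.2 h1) (by linear_combination hr - hs)
  have e2 : (r ^ 2 + r * t + t ^ 2 + p) = 0 :=
    mul_left_cancel₀ (sub_ne_zero.2 h2.symm) (by linear_combination hr - ht)
  have e3 : t + r + s = 0 :=
    mul_left_cancel₀ (sub_ne_zero.2 h3) (by linear_combination e2 - e1)
  linear_combination e3 - (r + s) * hh

theorem kl_fix {F L : Type*} [Field F] [Fintype F] [Field L] [Algebra F L] (x : L)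
    (hx : x ^ Fintype.card F = x) : ∃ y : F, algebraMap F L y = x := by
  classical
  let P : Polynomial L := Polynomial.X ^ Fintype.card F - Polynomial.X
  have hc : 1 < Fintype.card F := Fintype.one_lt_card
  have hP : P ≠ 0 := FiniteField.X_pow_card_sub_X_ne_zero L hc
  have hd : P.natDegree = Fintype.card F := FiniteField.X_pow_card_sub_X_natDegree_eq L hc
  have hsub : Finset.univ.image (algebraMap F L) ⊆ P.roots.toFinset := by
    intro z hz
    obtain ⟨y, -, rfl⟩ := Finset.mem_image.1 hz
    rw [Multiset.mem_toFinset, Polynomial.mem_roots hP]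
    simp only [P, Polynomial.IsRoot, Polynomial.eval_sub, Polynomial.eval_pow, Polynomial.eval_X]
    rw [← map_pow, FiniteField.pow_card, sub_self]
  have heq := Finset.eq_of_subset_of_card_le hsub (by
    rw [Finset.card_image_of_injective _ (algebraMap F L).injective, Finset.card_univ]
    exact (Multiset.toFinset_card_le _).trans ((Polynomial.card_roots' P).trans hd.le))
  have hm : x ∈ P.roots.toFinset := by
    rw [Multiset.mem_toFinset, Polynomial.mem_roots hP]
    simp [P, hx]
  rw [← heq] at hm
  obtain ⟨y, -, hy⟩ := Finset.mem_image.1 hm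
  exact ⟨y, hy⟩

theorem kl_aux {F L : Type*} [Field F] [Fintype F] [Field L] [Fintype L] [Algebra F L]
    [CharP L 2] (p q : F) (hq : q ≠ 0) (hno : ∀ z : F, z ^ 3 + p * z + q ≠ 0)
    (hfin : Module.finrank F L = 3) (r : L)
    (hr : r ^ 3 + algebraMap F L p * r + algebraMap F L q = 0) :
    ∃ w : F, w ^ 2 + w = p ^ 3 / q ^ 2 + 1 := by
  have hcard : Fintype.card L = Fintype.card F ^ 3 := by
    rw [← hfin]; exact Module.card_eq_pow_finrank
  let σ : L →ₐ[F] L := FiniteField.frobeniusAlgHom F L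
  have hσ : ∀ x, σ x = x ^ Fintype.card F := fun x => rfl
  have hσ3 : ∀ x, σ (σ (σ x)) = x := by
    intro x
    rw [hσ, hσ, hσ, ← pow_mul, ← pow_mul]
    conv_rhs => rw [← FiniteField.pow_card x, hcard]
    congr 1; ring
  have hroot : ∀ x, x ^ 3 + algebraMap F L p * x + algebraMap F L q = 0 →
      (σ x) ^ 3 + algebraMap F L p * σ x + algebraMap F L q = 0 := by
    intro x hx
    have := congrArg σ hx
    simpa using this
  have hnf : ∀ x, x ^ 3 + algebraMap F L p * x + algebraMap F L q = 0 → σ x ≠ x := by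
    intro x hx hf
    obtain ⟨y, rfl⟩ := kl_fix (F := F) x hf
    apply hno y
    apply (algebraMap F L).injective
    simpa using hx
  have hs := hroot r hr
  have ht := hroot _ hs
  have h1 : r ≠ σ r := (hnf r hr).symm
  have h3 : σ (σ r) ≠ σ r := hnf _ hs
  have h2 : σ (σ r) ≠ r := by
    intro hc
    have := hσ3 r
    rw [hc] at this
    exact h1 this.symm
  have h4 := kl_third _ _ _ _ _ hr hs ht h1 h2 h3
  have hq' : algebraMap F L q ≠ 0 := by simpa using hq
  have h5 := kl_resolvent _ _ _ _ hq' hr hs h1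
  have hh : (2 : L) = 0 := CharTwo.two_eq_zero
  obtain ⟨w, hw⟩ := kl_fix (F := F) ((r ^ 3 + r ^ 2 * σ r + (σ r) ^ 3) / algebraMap F L q) (by
    rw [← hσ]
    simp only [map_div₀, map_add, map_mul, map_pow, AlgHom.commutes, h4]
    congr 1
    linear_combination (σ r ^ 3 + 2 * r * σ r ^2 + r ^ 2 * σ r) * hh)
  refine ⟨w, ?_⟩
  apply (algebraMap F L).injective
  rw [← hw] at h5
  simpa using h5

theorem kl_exists {F : Type*} [Field F] [Fintype F] [CharP F 2] (p q : F) (hq : q ≠ 0)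
    (h : ∀ w : F, w ^ 2 + w ≠ p ^ 3 / q ^ 2 + 1) : ∃ z : F, z ^ 3 + p * z + q = 0 := by
  by_contra hno
  push Not at hno
  let f : Polynomial F := Polynomial.X ^ 3 + Polynomial.C p * Polynomial.X + Polynomial.C q
  have hdeg : f.natDegree = 3 := by simp only [f]; compute_degree!
  have hmon : f.Monic := by simp only [f]; monicity!
  have hirr : Irreducible f := by
    rw [Polynomial.irreducible_iff_roots_eq_zero_of_degree_le_three (by omega) (by omega)]
    rw [Multiset.eq_zero_iff_forall_notMem]
    intro z hz
    have := Polynomial.isRoot_of_mem_roots hz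
    apply hno z
    simpa [f] using this
  have : Fact (Irreducible f) := ⟨hirr⟩
  let L := AdjoinRoot f
  have : CharP L 2 := charP_of_injective_algebraMap (algebraMap F L).injective 2
  let r : L := AdjoinRoot.root f
  have hr : r ^ 3 + algebraMap F L p * r + algebraMap F L q = 0 := by
    have := AdjoinRoot.eval₂_root f
    simp only [f, Polynomial.eval₂_add, Polynomial.eval₂_mul, Polynomial.eval₂_pow,
      Polynomial.eval₂_X, Polynomial.eval₂_C] at this
    exact this
  have hfin : Module.finrank F L = 3 := by
    rw [(AdjoinRoot.powerBasis hirr.ne_zero).finrank, AdjoinRoot.powerBasis_dim, hdeg]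
  have : Module.Finite F L := Module.finite_of_finrank_pos (by omega)
  have : Finite L := Module.finite_of_finite F
  let : Fintype L := Fintype.ofFinite L
  obtain ⟨w, hw⟩ := kl_aux p q hq hno hfin r hr
  exact h w hw

theorem kl_sign (t τ : ZMod 2) : (-1 : ℤ) ^ t.val
    = (-1 : ℤ) ^ (τ + 1).val + (if t = τ then -2 * (-1 : ℤ) ^ (τ + 1).val else 0) := by
  revert t τ; decide

theorem kl_main {F : Type*} [Field F] [Fintype F] [DecidableEq F] [CharP F 2]
    (T : F →+ ZMod 2) (hT : ∀ z, T (z ^ 2) = T z) (u : F) (hu : u ≠ 0) :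
    ∑ x ∈ Finset.univ.erase (0 : F), (-1 : ℤ) ^ (T (x + u ^ 3 * (u + 1) / x ^ 2)).val
      = ∑ x ∈ Finset.univ.erase (0 : F), (-1 : ℤ) ^ (T (x + u * (u + 1) ^ 3 / x ^ 2)).val := by
  have hh : (2 : F) = 0 := CharTwo.two_eq_zero
  have hAS : ∀ w, T (w ^ 2 + w) = 0 := by
    intro w; rw [map_add, hT]; exact CharTwo.add_self_eq_zero _
  have hAS' : ∀ x y w : F, x + y = w ^ 2 + w → T x = T y := by
    intro x y w h
    have := hAS w
    rw [← h, map_add] at this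
    exact CharTwo.add_eq_zero.1 this
  have hne : ∀ x y : F, x + y ≠ 0 ↔ x ≠ y := fun x y => not_congr CharTwo.add_eq_zero
  have hval1 : ∀ x : F, x ≠ 0 → T (x + u ^ 3 * (u + 1) / x ^ 2) = T u + 1 → x + u ≠ 0 := by
    intro x hx h hc
    have hxu : x = u := CharTwo.add_eq_zero.1 hc
    subst hxu
    have : T (x + x ^ 3 * (x + 1) / x ^ 2) = T x := by
      rw [← hT x]
      congr 1
      field_simp
      linear_combination hh
    rw [this] at h
    simp at h
  have hval2 : ∀ x : F, x ≠ 0 → T (x + u ^ 3 * (u + 1) / x ^ 2) = T u + 1 →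
      x ^ 2 + u ^ 2 + u ≠ 0 := by
    intro x hx h hc
    have hxu : x ^ 2 = u * (u + 1) := by linear_combination hc - (u ^ 2 + u) * hh
    have hu1 : u + 1 ≠ 0 := by
      rintro h0
      rw [h0, mul_zero] at hxu
      exact hx (pow_eq_zero_iff (by norm_num) |>.1 hxu)
    have e : u ^ 3 * (u + 1) / x ^ 2 = u ^ 2 := by
      rw [hxu]; field_simp
    rw [e, map_add, hT, ← hT x, hxu, show u * (u + 1) = u ^ 2 + u by ring, hAS] at h
    simp at h
  have htr : ∀ x : F, x ≠ 0 → x + u ≠ 0 → x ^ 2 + u ^ 2 + u ≠ 0 →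
      T (x * (x ^ 2 + u ^ 2 + u) / (x + u) ^ 2 +
        u * (u + 1) ^ 3 / (x * (x ^ 2 + u ^ 2 + u) / (x + u) ^ 2) ^ 2)
        = T (x + u ^ 3 * (u + 1) / x ^ 2) := by
    intro x hx h1 h2
    apply hAS' _ _ (u / (x + u) + (u ^ 2 + u) / (x ^ 2 + u ^ 2 + u))
    have e1 : x * (x ^ 2 + u ^ 2 + u) / (x + u) ^ 2 + x = (u / (x + u)) ^ 2 + u / (x + u) := by
      field_simp
      ring_nf
      grind
    have e2 : u * (u + 1) ^ 3 / (x * (x ^ 2 + u ^ 2 + u) / (x + u) ^ 2) ^ 2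
        + u ^ 3 * (u + 1) / x ^ 2 = ((u ^ 2 + u) / (x ^ 2 + u ^ 2 + u)) ^ 2
          + (u ^ 2 + u) / (x ^ 2 + u ^ 2 + u) := by
      field_simp
      ring_nf
      grind
    linear_combination e1 + e2 - (u / (x + u)) * ((u ^ 2 + u) / (x ^ 2 + u ^ 2 + u)) * hh
  have hres : ∀ X : F, X ≠ 0 → T (X + u * (u + 1) ^ 3 / X ^ 2) = T u + 1 →
      ∀ w : F, w ^ 2 + w ≠ ((u + X) ^ 2 + u) ^ 3 / (u * X) ^ 2 + 1 := by
    intro X hX h w hw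
    have e : T (X + u * (u + 1) ^ 3 / X ^ 2) = T u := by
      rw [map_add, ← hT X, ← hT u, ← map_add]
      apply hAS' _ _ (w + X ^ 2 / u)
      have e1 : ((u + X) ^ 2 + u) ^ 3 / (u * X) ^ 2 + 1 =
          u * (u + 1) ^ 3 / X ^ 2 + X ^ 4 / u ^ 2 + X ^ 2 * (u + 1) / u + u ^ 2 := by
        field_simp
        ring_nf
        grind
      have e2 : X ^ 2 * (u + 1) / u = X ^ 2 + X ^ 2 / u := by field_simp
      rw [e1, e2] at hw
      have e3 : (w + X ^ 2 / u) ^ 2 = w ^ 2 + X ^ 4 / u ^ 2 := by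
        rw [CharTwo.add_sq]; ring
      rw [e3]
      linear_combination -hw - (X ^ 4 / u ^ 2 + X ^ 2 / u) * hh
    rw [e] at h
    simp at h
  -- the cubic satisfied by a preimage
  have hcub : ∀ x X : F, x + u ≠ 0 → (x * (x ^ 2 + u ^ 2 + u) / (x + u) ^ 2 = X ↔
      (x + X) ^ 3 + ((u + X) ^ 2 + u) * (x + X) + u * X = 0) := by
    intro x X h1
    rw [div_eq_iff (pow_ne_zero 2 h1)]
    constructor
    · intro h
      linear_combination h + (2*X*x^2 + 2*X^2*x + X^3 + X^2*u + X*u^2 + 2*X*u*x + X*u) * hh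
    · intro h
      linear_combination h - (2*X*x^2 + 2*X^2*x + X^3 + X^2*u + X*u^2 + 2*X*u*x + X*u) * hh
  have hcard : ((Finset.univ.erase (0 : F)).filter
        (fun x => T (x + u ^ 3 * (u + 1) / x ^ 2) = T u + 1)).card
      = ((Finset.univ.erase (0 : F)).filter
        (fun x => T (x + u * (u + 1) ^ 3 / x ^ 2) = T u + 1)).card := by
    apply Finset.card_bij (fun x _ => x * (x ^ 2 + u ^ 2 + u) / (x + u) ^ 2)
    · intro x hx
      simp only [Finset.mem_filter, Finset.mem_erase, Finset.mem_univ, and_true] at hx ⊢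
      obtain ⟨h0, h⟩ := hx
      have h1 := hval1 x h0 h
      have h2 := hval2 x h0 h
      exact ⟨by positivity, (htr x h0 h1 h2).trans h⟩
    · intro x hx y hy hxy
      simp only [Finset.mem_filter, Finset.mem_erase, Finset.mem_univ, and_true] at hx hy
      obtain ⟨h0, h⟩ := hx
      have h1 := hval1 x h0 h
      have h2 := hval2 x h0 h
      have h1' := hval1 y hy.1 hy.2
      by_contra hne
      have hX0 : x * (x ^ 2 + u ^ 2 + u) / (x + u) ^ 2 ≠ 0 := by positivity
      have hX := (htr x h0 h1 h2).trans h
      generalize hXX : x * (x ^ 2 + u ^ 2 + u) / (x + u) ^ 2 = X at *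
      have c1 := (hcub x X h1).1 hXX
      have c2 := (hcub y X h1').1 hxy.symm
      exact hres X hX0 hX _ (kl_resolvent _ _ _ _ (mul_ne_zero hu hX0) c1 c2
        (fun hc => hne (add_right_cancel hc)))
    · intro X hX
      simp only [Finset.mem_filter, Finset.mem_erase, Finset.mem_univ, and_true] at hX
      obtain ⟨h0, h⟩ := hX
      obtain ⟨z, hz⟩ := kl_exists _ _ (mul_ne_zero hu h0) (hres X h0 h)
      obtain ⟨x, rfl⟩ : ∃ x, z = x + X := ⟨z - X, by ring⟩
      have h1 : x + u ≠ 0 := by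
        intro hc
        have hxu : x = u := CharTwo.add_eq_zero.1 hc
        subst hxu
        apply hu
        have : x ^ 2 = 0 := by
          linear_combination hz - (x^3+3*x^2*X+3*x*X^2+X^3+x*X) * hh
        exact pow_eq_zero_iff (by norm_num) |>.1 this
      have hXX := (hcub x X h1).2 hz
      have hx0 : x ≠ 0 := by
        rintro rfl
        apply h0; rw [← hXX]; simp
      have h2 : x ^ 2 + u ^ 2 + u ≠ 0 := by
        intro hc
        apply h0; rw [← hXX, hc]; simp
      refine ⟨x, ?_, hXX⟩
      simp only [Finset.mem_filter, Finset.mem_erase, Finset.mem_univ, and_true]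
      refine ⟨hx0, ?_⟩
      rw [← htr x hx0 h1 h2, hXX, h]
  rw [Finset.sum_congr rfl (fun x _ => kl_sign (T (x + u ^ 3 * (u + 1) / x ^ 2)) (T u + 1)),
    Finset.sum_congr rfl (fun x _ => kl_sign (T (x + u * (u + 1) ^ 3 / x ^ 2)) (T u + 1))]
  rw [Finset.sum_add_distrib, Finset.sum_add_distrib, ← Finset.sum_filter, ← Finset.sum_filter,
    Finset.sum_const, Finset.sum_const, Finset.sum_const, hcard]

theorem kl_trace_sq (m : ℕ) (z : GaloisField 2 m) :
    Algebra.trace (ZMod 2) (GaloisField 2 m) (z ^ 2)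
      = Algebra.trace (ZMod 2) (GaloisField 2 m) z := by
  have := Algebra.trace_eq_of_algEquiv
    (FiniteField.frobeniusAlgEquivOfAlgebraic (ZMod 2) (GaloisField 2 m)) z
  rw [← this]
  simp

theorem kl_transform {F : Type*} [Field F] [Fintype F] [DecidableEq F]
    (T : F →+ ZMod 2) (hT : ∀ z, T (z ^ 2) = T z) (a : F) (ha : a ≠ 0) :
    ∑ x ∈ Finset.univ.erase (0 : F), (-1 : ℤ) ^ (T (a * x + x⁻¹)).val
      = ∑ x ∈ Finset.univ.erase (0 : F), (-1 : ℤ) ^ (T (x + a ^ 2 / x ^ 2)).val := by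
  apply Finset.sum_bij (fun x _ => a * x)
  · intro x hx
    simpa [ha] using hx
  · intro x _ y _ h
    exact mul_left_cancel₀ ha h
  · intro y hy
    exact ⟨y / a, by simpa [ha] using hy, by field_simp⟩
  · intro x hx
    have hx0 : x ≠ 0 := by simpa using hx
    rw [map_add, map_add, ← hT x⁻¹]
    congr 4
    field_simp

theorem kl_three (m : ℕ) (u : GaloisField 2 m) :
    Kl m (u ^ 3 * (u + 1)) = Kl m (u * (u + 1) ^ 3) := by
  by_cases hu : u = 0
  · subst hu; simp
  by_cases hu1 : u + 1 = 0
  · rw [hu1]; simp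
  unfold Kl
  let _ := Fintype.ofFinite (GaloisField 2 m)
  let _ := Classical.decEq (GaloisField 2 m)
  have h1 := kl_transform (Algebra.trace (ZMod 2) (GaloisField 2 m)).toAddMonoidHom
    (kl_trace_sq m) (u ^ 3 * (u + 1)) (mul_ne_zero (pow_ne_zero _ hu) hu1)
  have h2 := kl_transform (Algebra.trace (ZMod 2) (GaloisField 2 m)).toAddMonoidHom
    (kl_trace_sq m) (u * (u + 1) ^ 3) (mul_ne_zero hu (pow_ne_zero _ hu1))
  have h3 := kl_main (Algebra.trace (ZMod 2) (GaloisField 2 m)).toAddMonoidHom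
    (kl_trace_sq m) (u ^ 2) (pow_ne_zero _ hu)
  have hs : u ^ 2 + 1 = (u + 1) ^ 2 := by rw [CharTwo.add_sq]; simp
  rw [show (u ^ 2) ^ 3 * (u ^ 2 + 1) = (u ^ 3 * (u + 1)) ^ 2 by rw [hs]; ring,
    show u ^ 2 * (u ^ 2 + 1) ^ 3 = (u * (u + 1) ^ 3) ^ 2 by rw [hs]; ring] at h3
  exact h1.trans (h3.trans h2.symm)

theorem cor1_2 (m : ℕ) (hm : 0 < m) (c : GaloisField 2 m)
    (hc : c ^ 8 + c ^ 4 + 1 ≠ 0) :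
    Kl m (c ^ 9 * (c + 1) ^ 3 / (c ^ 8 + c ^ 4 + 1))
      = Kl m (c ^ 3 * (c + 1) ^ 9 / (c ^ 8 + c ^ 4 + 1)) := by
  have hh : (2 : GaloisField 2 m) = 0 := CharTwo.two_eq_zero
  have hd : c ^ 8 + c ^ 4 + 1 = (c ^ 2 + c + 1) ^ 4 := by
    rw [show (c ^ 2 + c + 1) ^ 4 = ((c ^ 2 + c + 1) ^ 2) ^ 2 by ring]
    simp only [CharTwo.add_sq]
    ring
  have hd0 : c ^ 2 + c + 1 ≠ 0 := by
    intro h; apply hc; rw [hd, h]; simp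
  have h1 : c ^ 3 / (c ^ 2 + c + 1) + 1 = (c + 1) ^ 3 / (c ^ 2 + c + 1) := by
    rw [div_add_one hd0]
    congr 1
    linear_combination (-c ^ 2 - c) * hh
  have := kl_three m (c ^ 3 / (c ^ 2 + c + 1))
  rw [h1] at this
  rw [hd]
  convert this using 2
  · field_simp
  · field_simp
end

section
/- For every c ∈ F with c ≠ 0 and c³ ≠ 1, K((c+1)⁸(c⁴+c)) = K(c³(c³+1)³). -/
namespace KlAux

section identities
variable {F : Type*} [Field F] [CharP F 2]

theorem inv_id0 (a x u v : F) (hu' : u = x + a) (hv' : v = x^2 + (a^2 + a))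
    (hx : x ≠ 0) (hu : u ≠ 0) (hv : v ≠ 0) :
    (x * v / u^2) + a*(a+1)^3 / (x * v / u^2)^2 =
      x + a^3*(a+1)/x^2 + ((a/u + (a^2+a)/v)^2 + (a/u + (a^2+a)/v)) := by
  have h2 : (2:F) = 0 := CharTwo.two_eq_zero
  field_simp
  subst hu' hv'
  grind

theorem cube_id (a x : F) (hx : x ≠ 0) :
    (x+a)^3/x^2 = x + a^3*(a+1)/x^2 + a + ((a^2/x)^2 + a^2/x) := by
  have h2 : (2:F) = 0 := CharTwo.two_eq_zero
  field_simp
  grind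

theorem inj_id (a x z : F) (hx : x + a ≠ 0) (hz : z + a ≠ 0) (hne : x ≠ z)
    (h : x * (x^2+(a^2+a)) / (x+a)^2 = z * (z^2+(a^2+a)) / (z+a)^2) :
    (x+a)^2*(z+a)^2 + a * (x+a)*(z+a) + a^2*((x+a)+(z+a)) = 0 := by
  have h2 : (2:F) = 0 := CharTwo.two_eq_zero
  rw [div_eq_div_iff (pow_ne_zero 2 hx) (pow_ne_zero 2 hz)] at h
  apply mul_left_cancel₀ (sub_ne_zero.2 hne)
  rw [mul_zero]
  grind

theorem inj_id2 (a x z : F) (ha : a ≠ 0) (hx : x ≠ 0)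
    (h : (x+a)^2*(z+a)^2 + a * (x+a)*(z+a) + a^2*((x+a)+(z+a)) = 0) :
    (x+a)^3/x^2 = ((z+a)*(x+a)^2/(a*x))^2 + ((z+a)*(x+a)^2/(a*x)) := by
  have h2 : (2:F) = 0 := CharTwo.two_eq_zero
  field_simp
  grind

theorem surj_id (a X s : F) (ha : a ≠ 0) (hs : s ≠ 0)
    (h : s^6 + X * s^3 + (X + (a+1))^3 = 0) :
    ∃ x, x + a ≠ 0 ∧ x * (x^2+(a^2+a)) / (x+a)^2 = X := by
  have h2 : (2:F) = 0 := CharTwo.two_eq_zero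
  obtain ⟨w, hw⟩ : ∃ w, w = s + (X + (a+1))/s + 1 := ⟨_, rfl⟩
  have hw2 : w^3 + w^2 + (a+X)*w + a = 0 := by
    subst hw
    field_simp
    grind
  have hw0 : w ≠ 0 := by
    rintro rfl
    apply ha
    simpa using hw2
  have e : a / w + a + a = a / w := by grind
  refine ⟨a / w + a, ?_, ?_⟩
  · rw [e]; exact div_ne_zero ha hw0
  · rw [e]
    field_simp
    grind

end identities

section trace
variable {F : Type*} [Field F] [Finite F] [Algebra (ZMod 2) F]

local notation "T" => Algebra.trace (ZMod 2) F

theorem tr_sq (x : F) : T (x^2) = T x := by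
  have : CharP F 2 := charP_of_injective_algebraMap (algebraMap (ZMod 2) F).injective 2
  have h := Algebra.trace_eq_of_algEquiv (FiniteField.frobeniusAlgEquiv (ZMod 2) F 2) x
  simpa [frobenius_def] using h

theorem zmod2 (z : ZMod 2) : z + z = 0 := CharTwo.add_self_eq_zero z

theorem tr_as (w : F) : T (w^2 + w) = 0 := by
  rw [map_add, tr_sq, zmod2]

theorem as_of_tr (y : F) (h : T y = 0) : ∃ w : F, w^2 + w = y := by
  have : CharP F 2 := charP_of_injective_algebraMap (algebraMap (ZMod 2) F).injective 2
  let L : F →ₗ[ZMod 2] F :=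
    (FiniteField.frobeniusAlgEquiv (ZMod 2) F 2).toLinearMap + LinearMap.id
  have hL : ∀ w, L w = w^2 + w := fun w => by simp [L, frobenius_def]
  have hle : LinearMap.range L ≤ LinearMap.ker T := by
    rintro _ ⟨w, rfl⟩
    rw [LinearMap.mem_ker, hL, tr_as]
  have hker : LinearMap.ker L ≤ Submodule.span (ZMod 2) {(1:F)} := by
    intro w hw
    rw [LinearMap.mem_ker, hL] at hw
    have : w * (w + 1) = 0 := by rw [← hw]; ring
    rcases mul_eq_zero.1 this with h | h
    · rw [h]; exact zero_mem _
    · have : w = 1 := CharTwo.add_eq_zero.1 h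
      rw [this]; exact Submodule.mem_span_singleton_self _
  have h1 : Module.finrank (ZMod 2) (LinearMap.ker L) ≤ 1 :=
    (Submodule.finrank_mono hker).trans (finrank_span_singleton (by simp)).le
  have h2 := LinearMap.finrank_range_add_finrank_ker L
  have h3 := LinearMap.finrank_range_add_finrank_ker T
  have h4 : Module.finrank (ZMod 2) (LinearMap.range T) = 1 := by
    rw [LinearMap.range_eq_top.2 (Algebra.trace_surjective (ZMod 2) F)]
    simp
  have h5 := Submodule.eq_of_le_of_finrank_le hle (by omega)
  have : y ∈ LinearMap.range L := by rw [h5]; exact h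
  obtain ⟨w, hw⟩ := this
  exact ⟨w, by rw [← hL, hw]⟩

/-- the set of x with prescribed trace. -/
def TS (A : F) (e : ZMod 2) : Set F :=
  {x | x ≠ 0 ∧ Algebra.trace (ZMod 2) F (x + A / x^2) = e}

/-- the isogeny on x coordinates. -/
def phi (a x : F) : F := x * (x^2+(a^2+a)) / (x+a)^2

theorem ne_aux (a x : F) (ha : a ≠ 0)
    (hx : x ∈ TS (a^3*(a+1)) (T a + 1)) : x + a ≠ 0 ∧ x^2 + (a^2+a) ≠ 0 := by
  have : CharP F 2 := charP_of_injective_algebraMap (algebraMap (ZMod 2) F).injective 2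
  obtain ⟨hx0, hx⟩ := hx
  have key : T (x + a^3*(a+1)/x^2) ≠ T a := by
    rw [hx]; simp
  constructor
  · intro h
    have : x = a := CharTwo.add_eq_zero.1 h
    subst this
    apply key
    have : x + x^3*(x+1)/x^2 = x^2 + (x + x) := by field_simp; ring
    rw [this, CharTwo.add_self_eq_zero, add_zero, tr_sq]
  · intro h
    have h' : x^2 = a^2 + a := CharTwo.add_eq_zero.1 h
    apply key
    have hd : a^2 + a ≠ 0 := by rw [← h']; exact pow_ne_zero 2 hx0
    have : x + a^3*(a+1)/x^2 = x + a^2 := by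
      rw [h']
      congr 1
      rw [div_eq_iff hd]; ring
    rw [this, map_add, ← tr_sq x, h', map_add, add_comm, ← add_assoc, zmod2, zero_add]

theorem phi_tr (a x : F) (hx : x ≠ 0) (h1 : x + a ≠ 0) (h2 : x^2 + (a^2+a) ≠ 0) :
    T (phi a x + a*(a+1)^3 / (phi a x)^2) = T (x + a^3*(a+1)/x^2) := by
  have : CharP F 2 := charP_of_injective_algebraMap (algebraMap (ZMod 2) F).injective 2
  unfold phi
  rw [inv_id0 a x _ _ rfl rfl hx h1 h2, map_add, tr_as, add_zero]

theorem phi_maps (a : F) (ha : a ≠ 0) :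
    Set.MapsTo (phi a) (TS (a^3*(a+1)) (T a + 1)) (TS (a*(a+1)^3) (T a + 1)) := by
  intro x hx
  obtain ⟨h1, h2⟩ := ne_aux a x ha hx
  refine ⟨div_ne_zero (mul_ne_zero hx.1 h2) (pow_ne_zero 2 h1), ?_⟩
  rw [phi_tr a x hx.1 h1 h2, hx.2]

theorem phi_inj (a : F) (ha : a ≠ 0) :
    Set.InjOn (phi a) (TS (a^3*(a+1)) (T a + 1)) := by
  have : CharP F 2 := charP_of_injective_algebraMap (algebraMap (ZMod 2) F).injective 2
  intro x hx z hz h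
  by_contra hne
  obtain ⟨h1, h2⟩ := ne_aux a x ha hx
  obtain ⟨h3, h4⟩ := ne_aux a z ha hz
  have e := inj_id2 a x z ha hx.1 (inj_id a x z h1 h3 hne h)
  have e2 := congrArg T e
  rw [tr_as, cube_id a x hx.1, map_add, tr_as, add_zero, map_add, hx.2, add_right_comm,
    zmod2] at e2
  simp at e2

theorem card_le (a : F) (ha : a ≠ 0) :
    (TS (a^3*(a+1)) (T a + 1)).ncard ≤ (TS (a*(a+1)^3) (T a + 1)).ncard :=
  Set.ncard_le_ncard_of_injOn (phi a) (phi_maps a ha) (phi_inj a ha) (Set.toFinite _)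

theorem cube_root (h : T (1:F) = 1) (t : F) : ∃ s : F, s^3 = t := by
  have := Fintype.ofFinite F
  have h1 : T (1:F) = (Module.finrank (ZMod 2) F : ZMod 2) := by
    have := Algebra.trace_algebraMap (S := F) (1 : ZMod 2)
    simpa using this
  rw [h] at h1
  have hodd : Odd (Module.finrank (ZMod 2) F) := by
    rw [← ZMod.natCast_eq_one_iff_odd]; exact h1.symm
  have hc : Fintype.card F = 2 ^ Module.finrank (ZMod 2) F := by
    have := Module.card_eq_pow_finrank (K := ZMod 2) (V := F)
    simpa using this
  obtain ⟨k, hk⟩ := hodd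
  have hmod : ∃ j, Fintype.card F = 3 * j + 2 := by
    rw [hc, hk, pow_succ, pow_mul]
    have : (2^2)^k % 3 = 1 := by
      rw [Nat.pow_mod]; simp
    exact ⟨((2^2)^k * 2) / 3, by omega⟩
  obtain ⟨j, hj⟩ := hmod
  by_cases ht : t = 0
  · exact ⟨0, by simp [ht]⟩
  refine ⟨t^(2*j+1), ?_⟩
  have hp := FiniteField.pow_card t
  apply mul_right_cancel₀ ht
  have : (t^(2*j+1))^3 * t = (t^(Fintype.card F))^2 := by
    rw [hj]; ring
  rw [this, hp, sq]

theorem phi_surj (a : F) (ha : a ≠ 0) (h1 : T (1:F) = 1) :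
    Set.SurjOn (phi a) (TS (a^3*(a+1)) (T a + 1)) (TS (a*(a+1)^3) (T a + 1)) := by
  have : CharP F 2 := charP_of_injective_algebraMap (algebraMap (ZMod 2) F).injective 2
  intro X hX
  have hc := cube_id (a+1) X hX.1
  have hB : (a+1)^3*(a+1+1) = a*(a+1)^3 := by
    rw [add_assoc, CharTwo.add_self_eq_zero, add_zero, mul_comm]
  have ht : T ((X + (a+1))^3/X^2) = 0 := by
    rw [hc, map_add, tr_as, add_zero, map_add, hB, hX.2, map_add, h1, zmod2]
  obtain ⟨w, hw⟩ := as_of_tr _ ht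
  have hX0 := hX.1
  have hw2 : ∃ w : F, w ≠ 0 ∧ w^2 + w = (X + (a+1))^3/X^2 := by
    by_cases h0 : w = 0
    · refine ⟨1, one_ne_zero, ?_⟩
      rw [← hw, h0, one_pow, CharTwo.add_self_eq_zero]; simp
    · exact ⟨w, h0, hw⟩
  obtain ⟨w, hw0, hw⟩ := hw2
  obtain ⟨s, hs⟩ := cube_root h1 (w * X)
  have hs0 : s ≠ 0 := by
    rintro rfl
    exact mul_ne_zero hw0 hX0 (by rw [← hs]; simp)
  obtain ⟨x, hxa, hx⟩ := surj_id a X s ha hs0 (by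
    rw [eq_div_iff (pow_ne_zero 2 hX0)] at hw
    rw [← hw, show s^6 = (s^3)^2 by ring, hs]
    have h2 : (2:F) = 0 := CharTwo.two_eq_zero
    grind)
  have hx0 : x ≠ 0 := by
    rintro rfl
    apply hX0; rw [← hx]; simp
  have hv : x^2 + (a^2+a) ≠ 0 := by
    intro h
    apply hX0; rw [← hx, h]; simp
  refine ⟨x, ⟨hx0, ?_⟩, hx⟩
  have hx' : phi a x = X := hx
  rw [← phi_tr a x hx0 hxa hv, hx', hX.2]

theorem zcases (z : ZMod 2) : z = 0 ∨ z = 1 := by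
  revert z; decide

theorem card_eq (a : F) (ha : a ≠ 0) (ha1 : a + 1 ≠ 0) :
    (TS (a^3*(a+1)) (T a + 1)).ncard = (TS (a*(a+1)^3) (T a + 1)).ncard := by
  have : CharP F 2 := charP_of_injective_algebraMap (algebraMap (ZMod 2) F).injective 2
  rcases zcases (T (1:F)) with h | h
  · apply le_antisymm (card_le a ha)
    have := card_le (a+1) ha1
    have e : a + 1 + 1 = a := by rw [add_assoc, CharTwo.add_self_eq_zero, add_zero]
    rw [e, map_add, h, add_zero, mul_comm ((a+1)^3), mul_comm (a+1)] at this
    exact this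
  · exact (Set.BijOn.mk (phi_maps a ha) (phi_inj a ha) (phi_surj a ha h)).ncard_eq

theorem TS_sum [Fintype F] [DecidableEq F] (A : F) (e : ZMod 2) :
    ∑ x ∈ Finset.univ.erase (0 : F), (-1 : ℤ) ^ (T (A * x + x⁻¹)).val =
      (-1) ^ e.val * (2 * (TS A e).ncard - ((Fintype.card F : ℤ) - 1)) := by
  classical
  have : CharP F 2 := charP_of_injective_algebraMap (algebraMap (ZMod 2) F).injective 2
  have hbij : Function.Bijective (fun x : F => (x^2)⁻¹) := by
    apply Finite.injective_iff_bijective.1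
    intro x y h
    have h' : x^2 = y^2 := inv_injective h
    exact CharTwo.sq_injective h'
  have h1 : ∑ x ∈ Finset.univ.erase (0 : F), (-1 : ℤ) ^ (T (A * x + x⁻¹)).val =
      ∑ x ∈ Finset.univ.erase (0 : F), (-1 : ℤ) ^ (T (x + A / x^2)).val := by
    symm
    apply Finset.sum_bij (fun x _ => (x^2)⁻¹)
    · intro x hx; simpa using hx
    · intro x _ y _ h; exact hbij.1 h
    · intro y hy
      obtain ⟨x, rfl⟩ := hbij.2 y
      exact ⟨x, by simpa using hy, rfl⟩
    · intro x _
      rw [inv_inv, map_add, map_add, tr_sq, add_comm, div_eq_mul_inv]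
  have h2 : (TS A e).ncard =
      ((Finset.univ.erase (0 : F)).filter (fun x => T (x + A / x^2) = e)).card := by
    rw [← Set.ncard_coe_finset]
    congr 1
    ext x
    simp [TS]
  have h3 : ∀ x : F, (-1 : ℤ) ^ (T (x + A / x^2)).val =
      (-1)^e.val * (2 * (if T (x + A / x^2) = e then 1 else 0) - 1) := by
    intro x
    generalize T (x + A / x^2) = z
    clear h2 h1
    revert z e
    decide
  rw [h1, Finset.sum_congr rfl (fun x _ => h3 x), ← Finset.mul_sum, Finset.sum_sub_distrib,
    ← Finset.mul_sum, Finset.sum_boole, h2]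
  congr 2
  rw [Finset.sum_const, Finset.card_erase_of_mem (Finset.mem_univ _), Finset.card_univ,
    nsmul_eq_mul, mul_one, Nat.cast_sub Fintype.card_pos, Nat.cast_one]

end trace

theorem Kl_eq (m : ℕ) (a : GaloisField 2 m) (ha : a ≠ 0) (ha1 : a + 1 ≠ 0) :
    Kl m (a^3*(a+1)) = Kl m (a*(a+1)^3) := by
  unfold Kl
  letI := Fintype.ofFinite (GaloisField 2 m)
  letI := Classical.decEq (GaloisField 2 m)
  have h1 := TS_sum (a^3*(a+1)) (Algebra.trace (ZMod 2) (GaloisField 2 m) a + 1)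
  have h2 := TS_sum (a*(a+1)^3) (Algebra.trace (ZMod 2) (GaloisField 2 m) a + 1)
  rw [card_eq a ha ha1] at h1
  exact h1.trans h2.symm

end KlAux

theorem cor1_3 (m : ℕ) (hm : 0 < m) (c : GaloisField 2 m)
    (hc0 : c ≠ 0) (hc3 : c ^ 3 ≠ 1) :
    Kl m ((c + 1) ^ 8 * (c ^ 4 + c)) = Kl m (c ^ 3 * (c ^ 3 + 1) ^ 3) := by
  have h2 : (2 : GaloisField 2 m) = 0 := CharTwo.two_eq_zero
  have h3 : c^3 + 1 ≠ 0 := fun h => hc3 (CharTwo.add_eq_zero.1 h)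
  have hf : c^3 + 1 = (c+1) * (c^2+c+1) := by grind
  have ha1 : (c+1)^3 + 1 = c * (c^2+c+1) := by grind
  have hm := h3
  rw [hf] at hm
  have h := KlAux.Kl_eq m ((c+1)^3) (pow_ne_zero 3 (left_ne_zero_of_mul hm))
    (by rw [ha1]; exact mul_ne_zero hc0 (right_ne_zero_of_mul hm))
  rw [ha1] at h
  have e1 : (c + 1) ^ 8 * (c ^ 4 + c) = ((c+1)^3)^3 * (c * (c^2+c+1)) := by
    rw [show c^4 + c = c * (c^3+1) by ring, hf]; ring
  have e2 : c ^ 3 * (c ^ 3 + 1) ^ 3 = (c+1)^3 * (c * (c^2+c+1))^3 := by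
    rw [hf]; ring
  rw [e1, e2, h]
end

section
/- For every c ∈ F with c⁵ ≠ 1 and c ≠ 0, K((c¹¹+c³)(c⁵+1)) = K(c(c⁵+1)³). -/
section helpers
variable {F : Type*} [Field F] [CharP F 2]

theorem kl_cub_exists [Finite F] (τ : F →+ ZMod 2) (hτ : ∀ x, τ (x ^ 2) = τ x)
    (B : F) (hB : B ≠ 0) (h : τ (1 + B⁻¹) = 1) : ∃ y, y ^ 3 + y = B := by
  have h2 : (2 : F) = 0 := CharTwo.two_eq_zero
  have hz : ∀ y : F, τ (y ^ 2 + y) = 0 := fun y => by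
    rw [map_add, hτ]; exact CharTwo.add_self_eq_zero _
  have hmaps : ∀ y : F, (y ≠ 0 ∧ τ (1 + y⁻¹) = 1) →
      (y ^ 3 + y ≠ 0 ∧ τ (1 + (y ^ 3 + y)⁻¹) = 1) := by
    rintro y ⟨hy, ht⟩
    have hy1 : y + 1 ≠ 0 := by
      intro h1
      have : y = 1 := by linear_combination h1 - h2
      subst this
      have : (1 : F) + 1⁻¹ = 0 := by rw [inv_one]; linear_combination h2
      rw [this, map_zero] at ht
      exact zero_ne_one ht
    have e : y ^ 3 + y = y * (y + 1) ^ 2 := by linear_combination (-y ^ 2) * h2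
    rw [e]
    refine ⟨mul_ne_zero hy (pow_ne_zero _ hy1), ?_⟩
    have e2 : 1 + (y * (y + 1) ^ 2)⁻¹ = (1 + y⁻¹) + (((y + 1)⁻¹) ^ 2 + (y + 1)⁻¹) := by
      field_simp
      grind
    rw [e2, map_add, hz, ht, add_zero]
  let S := {y : F // y ≠ 0 ∧ τ (1 + y⁻¹) = 1}
  let f : S → S := fun y => ⟨y.1 ^ 3 + y.1, hmaps y.1 y.2⟩
  have finj : Function.Injective f := by
    rintro ⟨y, hy, hty⟩ ⟨z, hz0, htz⟩ hfe
    have e : y ^ 3 + y = z ^ 3 + z := congrArg Subtype.val hfe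
    by_contra hne
    have hne : y - z ≠ 0 := fun h => hne (Subtype.ext (sub_eq_zero.mp h))
    have e1 : y ^ 2 + y * z + z ^ 2 + 1 = 0 := by
      apply mul_left_cancel₀ hne
      linear_combination e
    have e3 : 1 + (y⁻¹) ^ 2 = (z / y) ^ 2 + z / y := by
      field_simp
      linear_combination e1 - (z ^ 2 + z * y) * h2
    have : τ (1 + y⁻¹) = τ (1 + (y⁻¹) ^ 2) := by rw [map_add, map_add, hτ]
    rw [this, e3, hz] at hty
    exact zero_ne_one hty
  obtain ⟨⟨y, _⟩, hy⟩ := (Finite.injective_iff_surjective.mp finj) ⟨B, hB, h⟩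
  exact ⟨y, congrArg Subtype.val hy⟩

theorem kl_cub_exists' [Finite F] (τ : F →+ ZMod 2) (hτ : ∀ x, τ (x ^ 2) = τ x)
    (A B : F) (hB : B ≠ 0) (h : τ (A ^ 3 / B ^ 2 + 1) = 1) : ∃ y, y ^ 3 + A * y = B := by
  have h2 : (2 : F) = 0 := CharTwo.two_eq_zero
  have hz : ∀ y : F, τ (y ^ 2 + y) = 0 := fun y => by
    rw [map_add, hτ]; exact CharTwo.add_self_eq_zero _
  by_cases hA : A = 0
  · subst hA
    have h1 : τ 1 = 1 := by simpa using h
    have cinj : Function.Injective (fun y : F => y ^ 3) := by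
      intro y z e
      have e : y ^ 3 = z ^ 3 := e
      by_contra hne
      have hne' : y - z ≠ 0 := sub_ne_zero.mpr hne
      have e1 : y ^ 2 + y * z + z ^ 2 = 0 := by
        apply mul_left_cancel₀ hne'
        linear_combination e
      have hy : y ≠ 0 := by
        rintro rfl
        have : z = 0 := by simpa using e1
        exact hne this.symm
      have e3 : 1 = (z / y) ^ 2 + z / y := by
        field_simp
        linear_combination e1 - (z ^ 2 + z * y) * h2
      rw [e3, hz] at h1
      exact zero_ne_one h1
    obtain ⟨y, hy⟩ := (Finite.injective_iff_surjective.mp cinj) B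
    exact ⟨y, by simpa using hy⟩
  · have sinj : Function.Injective (fun y : F => y ^ 2) := CharTwo.sq_injective
    obtain ⟨α, hα⟩ := (Finite.injective_iff_surjective.mp sinj) A
    have hα : α ^ 2 = A := hα
    subst hα
    have hα0 : α ≠ 0 := fun h => hA (by simp [h])
    have : τ (1 + (B / α ^ 3)⁻¹) = 1 := by
      rw [← h, map_add, map_add, ← hτ (B / α ^ 3)⁻¹, add_comm]
      congr 2
      field_simp
    obtain ⟨y, hy⟩ := kl_cub_exists τ hτ (B / α ^ 3) (div_ne_zero hB (pow_ne_zero _ hα0)) this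
    refine ⟨α * y, ?_⟩
    field_simp at hy
    linear_combination hy

theorem kl_cub_unique (τ : F →+ ZMod 2) (hτ : ∀ x, τ (x ^ 2) = τ x)
    (A B : F) (hB : B ≠ 0) (h : τ (A ^ 3 / B ^ 2 + 1) = 1) (y z : F)
    (hy : y ^ 3 + A * y = B) (hzz : z ^ 3 + A * z = B) : y = z := by
  have h2 : (2 : F) = 0 := CharTwo.two_eq_zero
  have hz : ∀ y : F, τ (y ^ 2 + y) = 0 := fun y => by
    rw [map_add, hτ]; exact CharTwo.add_self_eq_zero _
  by_contra hne
  have hne' : y - z ≠ 0 := sub_ne_zero.mpr hne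
  have e1 : y ^ 2 + y * z + z ^ 2 + A = 0 := by
    apply mul_left_cancel₀ hne'
    linear_combination hy - hzz
  have eA : A = y ^ 2 + y * z + z ^ 2 := by linear_combination e1 - (y ^ 2 + y * z + z ^ 2) * h2
  have eB : B = y * z * (y + z) := by
    rw [← hy, eA]; linear_combination (y ^ 3) * h2
  have hy0 : y ≠ 0 := by rintro rfl; simp at eB; exact hB eB
  have hz0 : z ≠ 0 := by rintro rfl; simp at eB; exact hB eB
  have hyz : y + z ≠ 0 := by intro h; rw [h] at eB; simp at eB; exact hB eB
  have e3 : A ^ 3 / B ^ 2 + 1 =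
      ((y ^ 3 + z ^ 3 + y * z ^ 2) / B) ^ 2 + (y ^ 3 + z ^ 3 + y * z ^ 2) / B := by
    rw [eB, eA]
    field_simp
    grind
  rw [e3, hz] at h
  exact zero_ne_one h

/-- the isogeny is a bijection between the trace classes -/
theorem kl_card [Finite F] (τ : F →+ ZMod 2) (hτ : ∀ x, τ (x ^ 2) = τ x) (t : F) (ht : t ≠ 0) :
    Nat.card {x : F // x ≠ 0 ∧ τ (x + t ^ 3 * (t + 1) / x) = τ t + 1} =
    Nat.card {x : F // x ≠ 0 ∧ τ (x + t * (t + 1) ^ 3 / x) = τ t + 1} := by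
  have h2 : (2 : F) = 0 := CharTwo.two_eq_zero
  have hz : ∀ y : F, τ (y ^ 2 + y) = 0 := fun y => by
    rw [map_add, hτ]; exact CharTwo.add_self_eq_zero _
  have hne1 : ∀ a : ZMod 2, a ≠ a + 1 := by decide
  -- excluded points
  have ex1 : ∀ x : F, x ≠ 0 → τ (x + t ^ 3 * (t + 1) / x) = τ t + 1 → x + t ^ 2 ≠ 0 := by
    intro x hx h e
    have : x = t ^ 2 := by linear_combination e - t ^ 2 * h2
    subst this
    have e2 : t ^ 2 + t ^ 3 * (t + 1) / t ^ 2 = t := by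
      field_simp
      linear_combination t * h2
    rw [e2] at h
    exact hne1 _ h
  have ex2 : ∀ x : F, x ≠ 0 → τ (x + t ^ 3 * (t + 1) / x) = τ t + 1 →
      x + (t ^ 2 + t) ≠ 0 := by
    intro x hx h e
    have : x = t ^ 2 + t := by linear_combination e - (t ^ 2 + t) * h2
    subst this
    have ht1 : t + 1 ≠ 0 := by
      intro h; apply hx; linear_combination t * h
    have e2 : t ^ 2 + t + t ^ 3 * (t + 1) / (t ^ 2 + t) = t := by
      have : t ^ 2 + t = t * (t + 1) := by ring
      rw [this]
      field_simp
      linear_combination t * h2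
    rw [e2] at h
    exact hne1 _ h
  let f : F → F := fun x => x * (x + (t ^ 2 + t)) ^ 2 / (x + t ^ 2) ^ 2
  have htr : ∀ x : F, x ≠ 0 → x + t ^ 2 ≠ 0 → x + (t ^ 2 + t) ≠ 0 →
      τ (f x + t * (t + 1) ^ 3 / f x) = τ (x + t ^ 3 * (t + 1) / x) := by
    intro x hx hx1 hx2
    have e1 : f x = x + ((t ^ 2 / (x + t ^ 2)) ^ 2 + t ^ 2 / (x + t ^ 2)) := by
      simp only [f]
      field_simp
      grind
    have e2 : t * (t + 1) ^ 3 / f x = t ^ 3 * (t + 1) / x +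
        (((t ^ 2 + t) / (x + (t ^ 2 + t))) ^ 2 + (t ^ 2 + t) / (x + (t ^ 2 + t))) := by
      simp only [f]
      generalize hr : x + (t ^ 2 + t) = r at *
      have hxr : x = r + (t ^ 2 + t) := by linear_combination hr - (t ^ 2 + t) * h2
      field_simp
      subst hxr
      grind
    rw [e2, map_add, map_add τ (t ^ 3 * (t + 1) / x), hz, e1, map_add τ x, hz, map_add]
    simp
  have hdisc : ∀ X : F, X ≠ 0 → τ (X + t * (t + 1) ^ 3 / X) = τ t + 1 →
      τ ((X + t ^ 2 + 1) ^ 3 / X ^ 2 + 1) = 1 := by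
    intro X hX h
    have e : (X + t ^ 2 + 1) ^ 3 / X ^ 2 + 1 = (X + t * (t + 1) ^ 3 / X) +
        ((((t + 1) ^ 3 / X) ^ 2 + (t + 1) ^ 3 / X) + t ^ 2) := by
      field_simp
      grind
    rw [e, map_add, map_add τ _ (t ^ 2), hz, h, hτ, zero_add, add_right_comm,
      CharTwo.add_self_eq_zero, zero_add]
  -- the cubic satisfied by `t^2/(x+t^2)+1`
  have hcub : ∀ x : F, x + t ^ 2 ≠ 0 →
      (t ^ 2 / (x + t ^ 2) + 1) ^ 3 + (f x + t ^ 2 + 1) * (t ^ 2 / (x + t ^ 2) + 1) = f x := by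
    intro x hx
    simp only [f]
    field_simp
    grind
  have hf0 : ∀ x : F, x ≠ 0 → x + t ^ 2 ≠ 0 → x + (t ^ 2 + t) ≠ 0 → f x ≠ 0 :=
    fun x h1 h2 h3 => div_ne_zero (mul_ne_zero h1 (pow_ne_zero _ h3)) (pow_ne_zero _ h2)
  let S := {x : F // x ≠ 0 ∧ τ (x + t ^ 3 * (t + 1) / x) = τ t + 1}
  let S' := {x : F // x ≠ 0 ∧ τ (x + t * (t + 1) ^ 3 / x) = τ t + 1}
  have hm : ∀ x : S, f x.1 ≠ 0 ∧ τ (f x.1 + t * (t + 1) ^ 3 / f x.1) = τ t + 1 := by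
    rintro ⟨x, hx, h⟩
    have h1 := ex1 x hx h
    have h3 := ex2 x hx h
    exact ⟨hf0 x hx h1 h3, by rw [htr x hx h1 h3, h]⟩
  let g : S → S' := fun x => ⟨f x.1, hm x⟩
  apply Nat.card_eq_of_bijective g
  constructor
  · rintro x y hxy
    have hxy : f x.1 = f y.1 := congrArg Subtype.val hxy
    have hx1 := ex1 x.1 x.2.1 x.2.2
    have hy1 := ex1 y.1 y.2.1 y.2.2
    have hx := hcub x.1 hx1
    have hy := hcub y.1 hy1
    rw [← hxy] at hy
    have := kl_cub_unique τ hτ _ _ (hm x).1 (hdisc _ (hm x).1 (hm x).2) _ _ hx hy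
    apply Subtype.ext
    have := add_right_cancel this
    rw [div_eq_div_iff hx1 hy1] at this
    have := mul_left_cancel₀ (pow_ne_zero 2 ht) this
    exact (add_right_cancel this).symm
  · rintro ⟨X, hX, h⟩
    obtain ⟨y, hy⟩ := kl_cub_exists' τ hτ _ _ hX (hdisc X hX h)
    have hw : y + 1 ≠ 0 := by
      intro e
      have : y = 1 := by linear_combination e - h2
      subst this
      apply pow_ne_zero 2 ht
      linear_combination hy - h2
    generalize hwd : y + 1 = w at *
    have hyw : y = w + 1 := by linear_combination hwd - h2
    subst hyw
    have hx1 : (t ^ 2 / w + t ^ 2) + t ^ 2 ≠ 0 := by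
      have : (t ^ 2 / w + t ^ 2) + t ^ 2 = t ^ 2 / w := by linear_combination t ^ 2 * h2
      rw [this]
      exact div_ne_zero (pow_ne_zero 2 ht) hw
    have hfx : f (t ^ 2 / w + t ^ 2) = X := by
      simp only [f]
      rw [div_eq_iff (pow_ne_zero 2 hx1)]
      field_simp
      grind
    have hx0 : t ^ 2 / w + t ^ 2 ≠ 0 := by
      intro e; apply hX; rw [← hfx, e]; simp [f]
    have hx2 : (t ^ 2 / w + t ^ 2) + (t ^ 2 + t) ≠ 0 := by
      intro e; apply hX; rw [← hfx]; simp only [f]; rw [e]; simp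
    refine ⟨⟨t ^ 2 / w + t ^ 2, hx0, ?_⟩, Subtype.ext hfx⟩
    rw [← htr _ hx0 hx1 hx2, hfx, h]

theorem kl_sum [Fintype F] [DecidableEq F] (τ : F →+ ZMod 2) (δ : ZMod 2) (a : F) :
    ∑ x ∈ Finset.univ.erase (0 : F), (-1 : ℤ) ^ (τ (a * x + x⁻¹)).val =
    (-1) ^ δ.val * (2 * (Nat.card {x : F // x ≠ 0 ∧ τ (x + a / x) = δ} : ℤ)
      - ((Finset.univ.erase (0 : F)).card : ℤ)) := by
  have h1 : ∑ x ∈ Finset.univ.erase (0 : F), (-1 : ℤ) ^ (τ (a * x + x⁻¹)).val =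
      ∑ x ∈ Finset.univ.erase (0 : F), (-1 : ℤ) ^ (τ (x + a / x)).val := by
    refine Finset.sum_bij' (fun x _ => x⁻¹) (fun x _ => x⁻¹) ?_ ?_ ?_ ?_ ?_
    · intro x hx; simpa using hx
    · intro x hx; simpa using hx
    · intro x _; simp
    · intro x _; simp
    · intro x _; simp [add_comm]
  have hd : ∀ u d : ZMod 2, (-1 : ℤ) ^ u.val =
      (-1) ^ d.val * (2 * (if u = d then 1 else 0) - 1) := by decide
  rw [h1, Finset.sum_congr rfl (fun x _ => hd _ δ), ← Finset.mul_sum, Finset.sum_sub_distrib,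
    ← Finset.mul_sum]
  congr 3
  · rw [Finset.sum_boole, Nat.card_eq_fintype_card, Fintype.card_subtype]
    congr 2
    ext x; simp
  · simp
end helpers

theorem cor1_4 (m : ℕ) (hm : 0 < m) (c : GaloisField 2 m)
    (hc5 : c ^ 5 ≠ 1) (hc0 : c ≠ 0) :
    Kl m ((c ^ 11 + c ^ 3) * (c ^ 5 + 1)) = Kl m (c * (c ^ 5 + 1) ^ 3) := by
  have h2 : (2 : GaloisField 2 m) = 0 := CharTwo.two_eq_zero
  have hc1 : c + 1 ≠ 0 := by
    intro h
    have : c = 1 := by linear_combination h - h2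
    exact hc5 (by rw [this, one_pow])
  set t := c * (c + 1) ^ 3 with htd
  have ht : t ≠ 0 := mul_ne_zero hc0 (pow_ne_zero _ hc1)
  have ea : (c ^ 11 + c ^ 3) * (c ^ 5 + 1) = t ^ 3 * (t + 1) := by
    rw [htd]; grind
  have eb : c * (c ^ 5 + 1) ^ 3 = t * (t + 1) ^ 3 := by
    rw [htd]; grind
  rw [ea, eb]
  let τ : GaloisField 2 m →+ ZMod 2 := (Algebra.trace (ZMod 2) (GaloisField 2 m)).toAddMonoidHom
  have hτ : ∀ x, τ (x ^ 2) = τ x := by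
    intro x
    have := Algebra.trace_eq_of_algEquiv
      (FiniteField.frobeniusAlgEquivOfAlgebraic (ZMod 2) (GaloisField 2 m)) x
    simp [ZMod.card] at this
    exact this
  have key := kl_card τ hτ t ht
  letI := Fintype.ofFinite (GaloisField 2 m)
  letI := Classical.decEq (GaloisField 2 m)
  have s1 := kl_sum τ (τ t + 1) (t ^ 3 * (t + 1))
  have s2 := kl_sum τ (τ t + 1) (t * (t + 1) ^ 3)
  rw [key] at s1
  exact s1.trans s2.symm
end

section
/- Let b ∈ F and n, k integers such that b^{4n}+1 ≠ 0 (with b ≠ 0 if n or k is negative). Then K((b^{n+2}+b^k+1)(b^{n+2}+bⁿ+b^k)³/(b^{4n}+1)) = K((b^{n+2}+b^k+1)³(b^{n+2}+bⁿ+b^k)/(b^{4n}+1)). -/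
section KloostermanAux

variable {F : Type*} [Field F] [Fintype F] [DecidableEq F]

theorem aux_inj_s13 (h2 : (2 : F) = 0) (χ : F → ℤ) (hadd : ∀ x y, χ (x + y) = χ x * χ y)
    (hz : ∀ z, χ (z ^ 2 + z) = 1) (x p r : F) (hp : p ≠ 0) (hc : χ (1 + x / p ^ 2) = -1)
    (he : p ^ 3 + x * p = r ^ 3 + x * r) : p = r := by
  by_contra hne
  have h1 : (p - r) * (p ^ 2 + p * r + r ^ 2 + x) = 0 := by linear_combination he
  have h3 : p ^ 2 + p * r + r ^ 2 + x = 0 := by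
    rcases mul_eq_zero.1 h1 with h | h
    · exact absurd (sub_eq_zero.1 h) hne
    · exact h
  have h4 : 1 + x / p ^ 2 = (r / p) ^ 2 + r / p := by
    field_simp
    linear_combination h3 - (p * r + r ^ 2) * h2
  rw [h4, hz] at hc
  norm_num at hc

theorem aux_eq (h2 : (2 : F) = 0) (χ : F → ℤ) (hadd : ∀ x y, χ (x + y) = χ x * χ y)
    (hz : ∀ z, χ (z ^ 2 + z) = 1) (x p : F) (hp : p ≠ 0) (hq : p ^ 2 + x ≠ 0) :
    χ (1 + x ^ 3 / (p ^ 3 + x * p) ^ 2) = χ (1 + x / p ^ 2) := by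
  have h4 : 1 + x ^ 3 / (p ^ 3 + x * p) ^ 2
      = (1 + x / p ^ 2) + ((p ^ 2 / (p ^ 2 + x)) ^ 2 + p ^ 2 / (p ^ 2 + x)) := by
    have : p ^ 3 + x * p = p * (p ^ 2 + x) := by ring
    rw [this]
    field_simp
    linear_combination (-(p ^ 6 + p ^ 4 * x + p ^ 2 * x ^ 2)) * h2
  rw [h4, hadd, hz, mul_one]

theorem aux_nz (χ : F → ℤ) (h2 : (2 : F) = 0) (h0 : χ 0 = 1) (x p : F) (hp : p ≠ 0)
    (hc : χ (1 + x / p ^ 2) = -1) : p ^ 2 + x ≠ 0 := by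
  intro h
  have : 1 + x / p ^ 2 = 0 := by field_simp; linear_combination h
  rw [this, h0] at hc
  norm_num at hc

theorem aux_sqinj (h2 : (2 : F) = 0) (a b : F) (h : a ^ 2 = b ^ 2) : a = b := by
  have : (a - b) ^ 2 = 0 := by linear_combination h + (b ^ 2 - a * b) * h2
  exact sub_eq_zero.1 (pow_eq_zero_iff (two_ne_zero) |>.1 this)

theorem aux_sqrt (h2 : (2 : F) = 0) (a : F) : ∃ s, s ^ 2 = a :=
  (Finite.injective_iff_surjective.1 (fun a b h => aux_sqinj h2 a b h)) a

theorem aux_card (h2 : (2 : F) = 0) (χ : F → ℤ) (x : F) (hx : x ≠ 0) :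
    (Finset.univ.filter fun p : F => p ≠ 0 ∧ χ (1 + x ^ 3 / p ^ 2) = -1).card =
      (Finset.univ.filter fun p : F => p ≠ 0 ∧ χ (1 + x / p ^ 2) = -1).card := by
  obtain ⟨s, hs⟩ := aux_sqrt h2 x
  subst hs
  have hs : s ≠ 0 := by rintro rfl; simp at hx
  symm
  apply Finset.card_bij (fun p _ => s ^ 2 * p)
  · intro p hp
    simp only [Finset.mem_filter, Finset.mem_univ, true_and] at hp ⊢
    obtain ⟨hp, hc⟩ := hp
    refine ⟨by positivity, ?_⟩
    rw [← hc]; congr 1; field_simp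
  · intro a _ b _ h
    exact mul_left_cancel₀ hx h
  · intro p hp
    simp only [Finset.mem_filter, Finset.mem_univ, true_and] at hp ⊢
    obtain ⟨hp, hc⟩ := hp
    refine ⟨p / s ^ 2, ⟨by positivity, ?_⟩, by field_simp⟩
    rw [← hc]; congr 1; field_simp

theorem aux_surj_s13 (h2 : (2 : F) = 0) (χ : F → ℤ) (hadd : ∀ x y, χ (x + y) = χ x * χ y)
    (hz : ∀ z, χ (z ^ 2 + z) = 1) (h0 : χ 0 = 1) (x τ : F) (hτ : τ ≠ 0)
    (hc : χ (1 + x ^ 3 / τ ^ 2) = -1) :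
    ∃ p, p ≠ 0 ∧ χ (1 + x / p ^ 2) = -1 ∧ p ^ 3 + x * p = τ := by
  have hcard : (Finset.univ.filter fun p : F => p ≠ 0 ∧ χ (1 + x ^ 3 / p ^ 2) = -1).card ≤
      (Finset.univ.filter fun p : F => p ≠ 0 ∧ χ (1 + x / p ^ 2) = -1).card := by
    by_cases hx : x = 0
    · subst hx; simp
    · exact (aux_card h2 χ x hx).le
  have := Finset.surj_on_of_inj_on_of_card_le
    (s := Finset.univ.filter fun p : F => p ≠ 0 ∧ χ (1 + x / p ^ 2) = -1)
    (t := Finset.univ.filter fun p : F => p ≠ 0 ∧ χ (1 + x ^ 3 / p ^ 2) = -1)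
    (fun p _ => p ^ 3 + x * p) ?_ ?_ hcard τ (by simp [hτ, hc])
  · obtain ⟨p, hp, h⟩ := this
    simp only [Finset.mem_filter, Finset.mem_univ, true_and] at hp
    exact ⟨p, hp.1, hp.2, h.symm⟩
  · intro p hp
    simp only [Finset.mem_filter, Finset.mem_univ, true_and] at hp ⊢
    have hn := aux_nz χ h2 h0 x p hp.1 hp.2
    refine ⟨?_, ?_⟩
    · have : p ^ 3 + x * p = p * (p ^ 2 + x) := by ring
      rw [this]; exact mul_ne_zero hp.1 hn
    · rw [aux_eq h2 χ hadd hz x p hp.1 hn]; exact hp.2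
  · intro p r hp hr h
    simp only [Finset.mem_filter, Finset.mem_univ, true_and] at hp
    exact aux_inj_s13 h2 χ hadd hz x p r hp.1 hp.2 h

/-- Core count. -/
theorem aux_count (h2 : (2 : F) = 0) (χ : F → ℤ) (hadd : ∀ x y, χ (x + y) = χ x * χ y)
    (hz : ∀ z, χ (z ^ 2 + z) = 1) (h0 : χ 0 = 1) (t : F) (ht : t ≠ 1) :
    (((Finset.univ.erase (0 : F)).erase 1).filter
        fun p => χ (1 + (p ^ 3 + t) / (p + 1) / p ^ 2) = -1).card =
      ((Finset.univ.erase t).filter fun x => χ (1 + x ^ 3 / (x + t) ^ 2) = -1).card := by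
  have key : ∀ p : F, p ≠ 1 → p + 1 ≠ 0 := by
    intro p hp h; apply hp; linear_combination h - h2
  have keyx : ∀ p : F, p ≠ 1 →
      p ^ 3 + (p ^ 3 + t) / (p + 1) * p = (p ^ 3 + t) / (p + 1) + t := by
    intro p hp
    have := key p hp
    field_simp
    linear_combination (p ^ 4 - t) * h2 + 0
  apply Finset.card_bij (fun p _ => (p ^ 3 + t) / (p + 1))
  · intro p hp
    simp only [Finset.mem_filter, Finset.mem_univ, Finset.mem_erase, and_true] at hp ⊢
    obtain ⟨⟨hp1, hp0⟩, hc⟩ := hp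
    have hn := aux_nz χ h2 h0 _ p hp0 hc
    have hk := keyx p hp1
    refine ⟨?_, ?_⟩
    · intro h
      have : p * (p ^ 2 + (p ^ 3 + t) / (p + 1)) = 0 := by
        linear_combination hk + h + t * h2
      exact mul_ne_zero hp0 hn this
    · rw [← hk, aux_eq h2 χ hadd hz _ p hp0 hn]; exact hc
  · intro p hp r hr h
    simp only [Finset.mem_filter, Finset.mem_univ, Finset.mem_erase, and_true] at hp hr
    obtain ⟨⟨hp1, hp0⟩, hc⟩ := hp
    obtain ⟨⟨hr1, hr0⟩, hc'⟩ := hr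
    refine aux_inj_s13 h2 χ hadd hz _ p r hp0 hc ?_
    rw [keyx p hp1, h, keyx r hr1]
  · intro x hx
    simp only [Finset.mem_filter, Finset.mem_univ, Finset.mem_erase, and_true] at hx
    obtain ⟨hxt, hc⟩ := hx
    have hne : x + t ≠ 0 := by
      intro h; apply hxt; linear_combination h - t * h2
    obtain ⟨p, hp0, hpc, hp⟩ := aux_surj_s13 h2 χ hadd hz h0 x (x + t) hne hc
    have hp1 : p ≠ 1 := by
      rintro rfl; apply ht; linear_combination -hp
    have hx : (p ^ 3 + t) / (p + 1) = x := by
      have := key p hp1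
      field_simp
      linear_combination hp + (t - p * x) * h2
    refine ⟨p, ?_, hx⟩
    simp only [Finset.mem_filter, Finset.mem_univ, Finset.mem_erase, and_true]
    rw [hx]
    exact ⟨⟨hp1, hp0⟩, hpc⟩

theorem aux_sum_card (f : F → ℤ) (hf : ∀ x, f x = 1 ∨ f x = -1) (S : Finset F) :
    ∑ x ∈ S, f x = S.card - 2 * (S.filter fun x => f x = -1).card := by
  have : ∀ x ∈ S, f x = 1 - 2 * (if f x = -1 then 1 else 0) := by
    intro x _
    rcases hf x with h | h <;> rw [h] <;> norm_num
  rw [Finset.sum_congr rfl this, Finset.sum_sub_distrib, ← Finset.mul_sum]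
  simp

theorem aux_scale (χ : F → ℤ) (α β : F) (hβ : β ≠ 0) :
    ∑ x ∈ Finset.univ.erase (0 : F), χ (α * x + β / x) =
      ∑ x ∈ Finset.univ.erase (0 : F), χ (α * β * x + x⁻¹) := by
  symm
  apply Finset.sum_bij (fun x _ => β * x)
  · intro x hx
    simp only [Finset.mem_univ, Finset.mem_erase, and_true] at hx ⊢
    exact mul_ne_zero hβ hx
  · intro a _ b _ h
    exact mul_left_cancel₀ hβ h
  · intro x hx
    simp only [Finset.mem_univ, Finset.mem_erase, and_true] at hx
    refine ⟨x / β, ?_, by field_simp⟩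
    simp only [Finset.mem_univ, Finset.mem_erase, and_true]
    exact div_ne_zero hx hβ
  · intro x hx
    simp only [Finset.mem_univ, Finset.mem_erase, and_true] at hx
    congr 1
    field_simp

theorem aux_main_s13 (h2 : (2 : F) = 0) (χ : F → ℤ) (hadd : ∀ x y, χ (x + y) = χ x * χ y)
    (hv : ∀ x, χ x = 1 ∨ χ x = -1)
    (hz : ∀ z, χ (z ^ 2 + z) = 1) (h0 : χ 0 = 1) (s : F) :
    ∑ x ∈ Finset.univ.erase (0 : F), χ (s * (s + 1) ^ 3 * x + x⁻¹) =
      ∑ x ∈ Finset.univ.erase (0 : F), χ (s ^ 3 * (s + 1) * x + x⁻¹) := by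
  by_cases hs0 : s = 0
  · subst hs0; simp
  by_cases hs1 : s = 1
  · subst hs1
    have : (1 + 1 : F) = 0 := by linear_combination h2
    simp [this]
  have hs1' : s + 1 ≠ 0 := by intro h; apply hs1; linear_combination h - h2
  have ht : s ^ 2 ≠ 1 := by
    intro h; apply hs1; exact aux_sqinj h2 _ _ (by simpa using h)
  have hcount := aux_count h2 χ hadd hz h0 (s ^ 2) ht
  have e1 := aux_sum_card (fun p => χ (1 + (p ^ 3 + s ^ 2) / (p + 1) / p ^ 2))
    (fun _ => hv _) ((Finset.univ.erase (0 : F)).erase 1)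
  have e2 := aux_sum_card (fun x => χ (1 + x ^ 3 / (x + s ^ 2) ^ 2))
    (fun _ => hv _) (Finset.univ.erase (s ^ 2))
  have c1 : (((Finset.univ.erase (0 : F)).erase 1).card : ℤ) + 1
      = ((Finset.univ.erase (s ^ 2)).card : ℤ) := by
    rw [Finset.card_erase_of_mem (Finset.mem_univ _), ← Finset.card_erase_of_mem (Finset.mem_univ (0 : F))]
    exact_mod_cast Finset.card_erase_add_one (by simp)
  have hshift : ∀ u z, χ (u + (z ^ 2 + z)) = χ u := by
    intro u z; rw [hadd, hz, mul_one]
  have f1 : ∑ p ∈ (Finset.univ.erase (0 : F)).erase 1,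
        χ (1 + (p ^ 3 + s ^ 2) / (p + 1) / p ^ 2) + 1
      = χ (s + 1) * ∑ x ∈ Finset.univ.erase (0 : F), χ (s * (s + 1) * x + (s + 1) ^ 2 / x) := by
    rw [Finset.mul_sum, ← Finset.sum_erase_add _ _ (show (1 : F) ∈ Finset.univ.erase (0 : F) by simp)]
    congr 1
    · apply Finset.sum_bij (fun p _ => (p + 1) / p)
      · intro p hp
        simp only [Finset.mem_univ, Finset.mem_erase, and_true] at hp ⊢
        refine ⟨?_, ?_⟩
        · intro h
          rw [div_eq_iff hp.2] at h
          simp at h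
        · refine div_ne_zero ?_ hp.2
          intro h; apply hp.1; linear_combination h - h2
      · intro p hp r hr h
        simp only [Finset.mem_univ, Finset.mem_erase, and_true] at hp hr
        rw [div_eq_div_iff hp.2 hr.2] at h
        linear_combination -h
      · intro w hw
        simp only [Finset.mem_univ, Finset.mem_erase, and_true] at hw
        have hw1 : w + 1 ≠ 0 := by intro h; apply hw.1; linear_combination h - h2
        refine ⟨1 / (w + 1), ?_, ?_⟩
        · simp only [Finset.mem_univ, Finset.mem_erase, and_true]
          refine ⟨?_, by simpa using hw1⟩
          intro h
          rw [div_eq_iff hw1] at h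
          apply hw.2; linear_combination -h
        · field_simp
          linear_combination h2
      · intro p hp
        simp only [Finset.mem_univ, Finset.mem_erase, and_true] at hp
        have hp1 : p + 1 ≠ 0 := by intro h; apply hp.1; linear_combination h - h2
        have hp0 := hp.2
        rw [← hadd, ← hshift _ (s / p)]
        congr 1
        field_simp
        ring_nf
        grind
    · have : s * (s + 1) * 1 + (s + 1) ^ 2 / 1 = s + 1 := by
        linear_combination (s ^ 2 + s) * h2
      rw [this, ← hadd, ← two_mul, h2, zero_mul, h0]
  have f2 : ∑ x ∈ Finset.univ.erase (s ^ 2), χ (1 + x ^ 3 / (x + s ^ 2) ^ 2)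
      = χ (s + 1) * ∑ x ∈ Finset.univ.erase (0 : F), χ (1 * x + s ^ 3 * (s + 1) / x) := by
    rw [Finset.mul_sum]
    apply Finset.sum_bij (fun x _ => x + s ^ 2)
    · intro x hx
      simp only [Finset.mem_univ, Finset.mem_erase, and_true] at hx ⊢
      intro h; apply hx; linear_combination h - s ^ 2 * h2
    · intro a _ b _ h
      exact add_right_cancel h
    · intro x hx
      simp only [Finset.mem_univ, Finset.mem_erase, and_true] at hx
      refine ⟨x + s ^ 2, ?_, by linear_combination s ^ 2 * h2⟩
      simpa using hx
    · intro x hx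
      simp only [Finset.mem_univ, Finset.mem_erase, and_true] at hx
      have hx' : x + s ^ 2 ≠ 0 := by
        intro h; apply hx; linear_combination h - s ^ 2 * h2
      rw [← hadd, ← hshift _ (s ^ 3 / (x + s ^ 2)), ← hshift _ s]
      congr 1
      field_simp
      ring_nf
      grind
  rw [aux_scale χ _ _ (pow_ne_zero 2 hs1')] at f1
  rw [aux_scale χ _ _ (mul_ne_zero (pow_ne_zero 3 hs0) hs1')] at f2
  rw [show s * (s + 1) * (s + 1) ^ 2 = s * (s + 1) ^ 3 by ring] at f1
  rw [one_mul] at f2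
  have hne : χ (s + 1) ≠ 0 := by rcases hv (s + 1) with h | h <;> rw [h] <;> norm_num
  apply mul_left_cancel₀ hne
  rw [← f1, ← f2, e1, e2, hcount, ← c1]
  ring

end KloostermanAux

theorem Kl_main (m : ℕ) (s : GaloisField 2 m) :
    Kl m (s * (s + 1) ^ 3) = Kl m (s ^ 3 * (s + 1)) := by
  letI := Fintype.ofFinite (GaloisField 2 m)
  letI := Classical.decEq (GaloisField 2 m)
  have h2 : (2 : GaloisField 2 m) = 0 := CharTwo.two_eq_zero
  have hpm : ∀ a b : ZMod 2, (-1 : ℤ) ^ (a + b).val = (-1) ^ a.val * (-1) ^ b.val := by decide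
  have hone : ∀ a : ZMod 2, (-1 : ℤ) ^ (a + a).val = 1 := by decide
  have hsq : ∀ z : GaloisField 2 m, Algebra.trace (ZMod 2) (GaloisField 2 m) (z ^ 2)
      = Algebra.trace (ZMod 2) (GaloisField 2 m) z := by
    intro z
    have := Algebra.trace_eq_of_algEquiv (FiniteField.frobeniusAlgEquiv (ZMod 2) (GaloisField 2 m) 2) z
    simpa using this
  exact aux_main_s13 h2 (fun z => (-1 : ℤ) ^ (Algebra.trace (ZMod 2) (GaloisField 2 m) z).val)
    (fun x y => by simp only [map_add, hpm])
    (fun x => neg_one_pow_eq_or ℤ _)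
    (fun z => by simp only [map_add, hsq, hone])
    (by simp) s

theorem kloosterman_bnk (m : ℕ) (hm : 0 < m) (b : GaloisField 2 m) (n k : ℤ)
    (hb : n < 0 ∨ k < 0 → b ≠ 0) (h : b ^ (4 * n) + 1 ≠ 0) :
    Kl m ((b ^ (n + 2) + b ^ k + 1) * (b ^ (n + 2) + b ^ n + b ^ k) ^ 3 / (b ^ (4 * n) + 1))
      = Kl m ((b ^ (n + 2) + b ^ k + 1) ^ 3 * (b ^ (n + 2) + b ^ n + b ^ k) / (b ^ (4 * n) + 1)) := by
  have h2 : (2 : GaloisField 2 m) = 0 := CharTwo.two_eq_zero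
  have h4 : b ^ (4 * n) = (b ^ n) ^ 4 := by
    rw [mul_comm, zpow_mul]; norm_cast
  rw [h4] at h ⊢
  generalize b ^ (n + 2) = u at *
  generalize b ^ k = v at *
  generalize b ^ n = t at *
  have hd : t ^ 4 + 1 = (t + 1) ^ 4 := by
    linear_combination (-(2 * t ^ 3 + 3 * t ^ 2 + 2 * t)) * h2
  rw [hd] at h ⊢
  have ht : t + 1 ≠ 0 := fun h' => h (by rw [h']; simp)
  have hs : (u + v + 1) / (t + 1) + 1 = (u + t + v) / (t + 1) := by
    field_simp
    linear_combination h2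
  have := Kl_main m ((u + v + 1) / (t + 1))
  rw [hs] at this
  convert this using 2
  · field_simp
  · field_simp
end

section
/- For every b ∈ F with b ≠ 1, K(b³(b³+b+1)³/(1+b)⁴) = K(b⁹(b³+b+1)/(1+b)⁴). -/
section KlAux
open Classical

variable {F : Type} [Field F] [Fintype F] [CharP F 2] [Algebra (ZMod 2) F]

local notation "T" => Algebra.trace (ZMod 2) F

lemma T_sq (x : F) : T (x ^ 2) = T x := by
  have h := Algebra.trace_eq_of_algEquiv (FiniteField.frobeniusAlgEquivOfAlgebraic (ZMod 2) F) x
  rw [FiniteField.coe_frobeniusAlgEquivOfAlgebraic] at h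
  simpa [ZMod.card] using h

lemma T_AS (u : F) : T (u ^ 2 + u) = 0 := by
  rw [map_add, T_sq]
  exact CharTwo.add_self_eq_zero _

lemma exists_AS (c : F) (hc : T c = 0) : ∃ z : F, z ^ 2 + z = c := by
  let P : F →+ F :=
    { toFun := fun z => z ^ 2 + z
      map_zero' := by simp
      map_add' := fun x y => by grind }
  let S : F →+ ZMod 2 := (T).toAddMonoidHom
  have hle : P.range ≤ S.ker := by
    rintro _ ⟨u, rfl⟩
    exact T_AS u
  have hS : Function.Surjective S := Algebra.trace_surjective (ZMod 2) F
  have h1 : Nat.card S.ker * 2 = Nat.card F := by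
    have := AddSubgroup.card_mul_index S.ker
    rw [AddSubgroup.index_ker, AddMonoidHom.range_eq_top.2 hS] at this
    simpa using this
  have h2 : Nat.card P.ker * Nat.card P.range = Nat.card F := by
    have := AddSubgroup.card_mul_index P.ker
    rwa [AddSubgroup.index_ker] at this
  have h3 : Nat.card P.ker ≤ 2 := by
    have hs : (P.ker : Set F) ⊆ (({0, 1} : Finset F) : Set F) := by
      intro z hz
      have hz' : z ^ 2 + z = 0 := hz
      have : z * (z + 1) = 0 := by linear_combination hz'
      rcases mul_eq_zero.1 this with h | h
      · simp [h]
      · have : z = 1 := by grind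
        simp [this]
    have h4 := Set.ncard_le_ncard hs (Finset.finite_toSet _)
    rw [Set.ncard_coe_finset] at h4
    exact (Nat.card_coe_set_eq _).trans_le (h4.trans Finset.card_le_two)
  have h5 : Nat.card S.ker ≤ Nat.card P.range := by nlinarith [Nat.card_pos (α := P.range)]
  have h6 : P.range = S.ker := AddSubgroup.eq_of_le_of_card_ge hle h5
  have h7 : c ∈ P.range := by rw [h6]; exact hc
  exact h7

noncomputable def cset (u v : F) (e : ZMod 2) : Finset F :=
  (Finset.univ.erase 0).filter (fun x => T (u * x + v / x) = e)

lemma mem_cset {u v : F} {e : ZMod 2} {x : F} :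
    x ∈ cset u v e ↔ x ≠ 0 ∧ T (u * x + v / x) = e := by
  simp [cset]

lemma cset_scale (u v : F) (hv : v ≠ 0) (e : ZMod 2) :
    (cset u v e).card = (cset (u * v) 1 e).card := by
  apply Finset.card_bij' (fun y _ => y / v) (fun x _ => x * v)
  · intro y hy
    rw [mem_cset] at hy ⊢
    obtain ⟨h0, h⟩ := hy
    refine ⟨div_ne_zero h0 hv, ?_⟩
    rw [← h]; congr 1; field_simp
  · intro y hy
    rw [mem_cset] at hy ⊢
    obtain ⟨h0, h⟩ := hy
    refine ⟨mul_ne_zero h0 hv, ?_⟩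
    rw [← h]; congr 1; field_simp
  · intro y hy; field_simp
  · intro y hy; field_simp

noncomputable def phi (a y : F) : F := y * (y + a + 1) ^ 2 / (y + a) ^ 2

lemma g_phi (a y : F) (ha : a ≠ 0) (h1 : a + 1 ≠ 0) (hy : y ≠ 0) (hr : y + a ≠ 0)
    (hs : y + a + 1 ≠ 0) :
    T (a * phi a y + (a + 1) ^ 3 / phi a y) = T (a * y + a ^ 2 * (a + 1) / y) := by
  have e1 : a * phi a y = a * y + ((a / (y + a)) ^ 2 + a / (y + a)) := by
    unfold phi; field_simp; grind
  have e2 : (a + 1) ^ 3 / phi a y = a ^ 2 * (a + 1) / y +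
      (((a + 1) / (y + a + 1)) ^ 2 + (a + 1) / (y + a + 1)) := by
    unfold phi; field_simp; grind
  rw [e1, e2]
  rw [map_add, map_add _ (a * y) (_ + _), map_add _ (a ^ 2 * (a + 1) / y) (_ + _), T_AS, T_AS,
    add_zero, add_zero, map_add]

lemma A_ne (a y : F) (h1 : a + 1 ≠ 0) (ha : a ≠ 0)
    (h : y ∈ cset a (a ^ 2 * (a + 1)) (T a + 1)) :
    y ≠ 0 ∧ y + a ≠ 0 ∧ y + a + 1 ≠ 0 := by
  rw [mem_cset] at h
  obtain ⟨h0, h⟩ := h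
  have key : ∀ w : F, w ^ 2 + w + (a * y + a ^ 2 * (a + 1) / y) = a → False := by
    intro w hw
    have := congrArg (T) hw
    rw [map_add, T_AS, zero_add, h] at this
    simp at this
  refine ⟨h0, fun hh => ?_, fun hh => ?_⟩
  · have : y = a := by grind
    apply key 0
    rw [this]; field_simp; grind
  · have : y = a + 1 := by grind
    apply key 0
    rw [this]; field_simp; grind

lemma phi_maps (a y : F) (ha : a ≠ 0) (h1 : a + 1 ≠ 0)
    (h : y ∈ cset a (a ^ 2 * (a + 1)) (T a + 1)) :
    phi a y ∈ cset a ((a + 1) ^ 3) (T a + 1) := by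
  obtain ⟨h0, hr, hs⟩ := A_ne a y h1 ha h
  rw [mem_cset] at h ⊢
  refine ⟨?_, by rw [g_phi a y ha h1 h0 hr hs, h.2]⟩
  unfold phi; positivity

lemma phi_inj (a y z : F) (ha : a ≠ 0) (h1 : a + 1 ≠ 0)
    (h : y ∈ cset a (a ^ 2 * (a + 1)) (T a + 1))
    (h' : z ∈ cset a (a ^ 2 * (a + 1)) (T a + 1)) (e : phi a y = phi a z) : y = z := by
  obtain ⟨h0, hr, hs⟩ := A_ne a y h1 ha h
  obtain ⟨h0', hr', hs'⟩ := A_ne a z h1 ha h'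
  rw [mem_cset] at h
  by_contra hne
  unfold phi at e
  rw [div_eq_div_iff (by positivity) (by positivity)] at e
  have hyz : y + z ≠ 0 := by
    intro hh; apply hne; grind
  -- quadratic satisfied by z
  have q : (y + a) ^ 2 * z ^ 2 + y * z + (y + a + 1) ^ 2 * a ^ 2 = 0 := by
    apply mul_left_cancel₀ hyz
    grind
  have : (z * (y + a) ^ 2 / y) ^ 2 + z * (y + a) ^ 2 / y
      = (a * y + a ^ 2 * (a + 1) / y + a) ^ 2 := by
    have h2 : (2 : F) = 0 := CharTwo.two_eq_zero
    have sq : y ^ 2 + a * (a + 1) + y = (y + a) * (y + a + 1) := by grind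
    field_simp
    rw [sq]
    linear_combination (y + a) ^ 2 * q - (y + a) ^ 2 * (y + a + 1) ^ 2 * a ^ 2 * h2
  have h3 := T_AS (z * (y + a) ^ 2 / y)
  rw [this, T_sq, map_add, h.2] at h3
  have : T a + 1 + T a = (1 : ZMod 2) := by
    have := CharTwo.add_self_eq_zero (T a)
    linear_combination this
  rw [this] at h3
  simp at h3

lemma card_le (a : F) (ha : a ≠ 0) (h1 : a + 1 ≠ 0) :
    (cset a (a ^ 2 * (a + 1)) (T a + 1)).card ≤ (cset a ((a + 1) ^ 3) (T a + 1)).card :=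
  Finset.card_le_card_of_injOn (phi a) (fun y hy => phi_maps a y ha h1 hy)
    (fun y hy z hz e => phi_inj a y z ha h1 hy hz e)

lemma exists_cube (hF : (Fintype.card F - 1).Coprime 3) (z : F) (hz : z ≠ 0) :
    ∃ u : F, u ≠ 0 ∧ u ^ 3 = z := by
  have hc : (Nat.card Fˣ).Coprime 3 := by
    rw [Nat.card_eq_fintype_card, Fintype.card_units]; exact hF
  obtain ⟨u, hu⟩ := (powCoprime hc).surjective (Units.mk0 z hz)
  refine ⟨u, u.ne_zero, ?_⟩
  have := congrArg Units.val hu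
  simpa [powCoprime_apply] using this

lemma phi_surj (hF : (Fintype.card F - 1).Coprime 3) (hT : T 1 = 1) (a Y : F)
    (ha : a ≠ 0) (h1 : a + 1 ≠ 0) (h : Y ∈ cset a ((a + 1) ^ 3) (T a + 1)) :
    ∃ y ∈ cset a (a ^ 2 * (a + 1)) (T a + 1), phi a y = Y := by
  have hm := h
  rw [mem_cset] at h
  obtain ⟨h0, h⟩ := h
  have t0 : T (((Y + a + 1) ^ 3 / Y) ^ 2) = 0 := by
    have : (Y + a + 1) ^ 3 / Y = (Y ^ 2 + Y) + ((a ^ 2 + a)) + (a * Y + (a + 1) ^ 3 / Y)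
        + (a + 1) := by
      field_simp; grind
    rw [T_sq, this, map_add, map_add, map_add, T_AS, T_AS, h, map_add, hT]
    simp only [zero_add]
    exact CharTwo.add_self_eq_zero _
  obtain ⟨z, hz0, hz⟩ : ∃ z : F, z ≠ 0 ∧ z ^ 2 + z = ((Y + a + 1) ^ 3 / Y) ^ 2 := by
    obtain ⟨z, hz⟩ := exists_AS _ t0
    by_cases hz0 : z = 0
    · exact ⟨1, one_ne_zero, by rw [← hz, hz0]; grind⟩
    · exact ⟨z, hz0, hz⟩
  obtain ⟨u, hu0, hu⟩ := exists_cube hF (Y * z) (mul_ne_zero h0 hz0)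
  obtain ⟨p, hp⟩ : ∃ p, p = (Y + a + 1) ^ 2 := ⟨_, rfl⟩
  have hz' : (Y * z) ^ 2 + Y * (Y * z) = p ^ 3 := by
    rw [hp]
    field_simp at hz
    linear_combination hz
  rw [← hu] at hz'
  obtain ⟨t, ht⟩ : ∃ t, t = u + p / u := ⟨_, rfl⟩
  have htu : t * u = u ^ 2 + p := by rw [ht]; field_simp
  have hroot : t ^ 3 + p * t + Y = 0 := by
    apply mul_left_cancel₀ (pow_ne_zero 3 hu0)
    have h2 : (2 : F) = 0 := CharTwo.two_eq_zero
    rw [ht]; field_simp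
    linear_combination hz' + (p ^ 3 + 2 * (u ^ 4 * p + u ^ 2 * p ^ 2)) * h2
  obtain ⟨y, hy⟩ : ∃ y, y = t + Y := ⟨_, rfl⟩
  have heq : y * (y + a + 1) ^ 2 = Y * (y + a) ^ 2 := by
    have ht' : t = y + Y := by grind
    rw [ht', hp] at hroot
    grind
  have hr : y + a ≠ 0 := by
    intro hh
    have : y = a := by grind
    rw [hh, this] at heq
    grind
  have hy0 : y ≠ 0 := by
    intro hh
    rw [hh] at heq
    grind
  have hs : y + a + 1 ≠ 0 := by
    intro hh
    rw [hh] at heq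
    have := mul_ne_zero h0 (pow_ne_zero 2 hr)
    apply this
    rw [← heq]; simp
  have hphi : phi a y = Y := by
    unfold phi; rw [heq]; field_simp
  refine ⟨y, ?_, hphi⟩
  rw [mem_cset]
  refine ⟨hy0, ?_⟩
  rw [← g_phi a y ha h1 hy0 hr hs, hphi, h]

lemma card_eq_odd (hF : (Fintype.card F - 1).Coprime 3) (hT : T 1 = 1) (a : F)
    (ha : a ≠ 0) (h1 : a + 1 ≠ 0) :
    (cset a (a ^ 2 * (a + 1)) (T a + 1)).card = (cset a ((a + 1) ^ 3) (T a + 1)).card := by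
  apply le_antisymm (card_le a ha h1)
  apply Finset.card_le_card_of_surjOn (phi a)
  intro Y hY
  obtain ⟨y, hy, e⟩ := phi_surj hF hT a Y ha h1 hY
  exact ⟨y, hy, e⟩

lemma card_eq_even (hT : T 1 = 0) (a : F) (ha : a ≠ 0) (h1 : a + 1 ≠ 0) :
    (cset (a ^ 3 * (a + 1)) 1 (T a + 1)).card = (cset (a * (a + 1) ^ 3) 1 (T a + 1)).card := by
  have key : ∀ a : F, a ≠ 0 → a + 1 ≠ 0 → (cset (a ^ 3 * (a + 1)) 1 (T a + 1)).card
      ≤ (cset (a * (a + 1) ^ 3) 1 (T a + 1)).card := by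
    intro a ha h1
    have := card_le a ha h1
    rw [cset_scale a _ (mul_ne_zero (pow_ne_zero 2 ha) h1),
      cset_scale a _ (pow_ne_zero 3 h1)] at this
    have e : a * (a ^ 2 * (a + 1)) = a ^ 3 * (a + 1) := by ring
    rwa [e] at this
  apply le_antisymm (key a ha h1)
  have h2 : a + 1 + 1 = a := by grind
  have := key (a + 1) h1 (by rwa [h2])
  rw [h2, map_add, hT, add_zero] at this
  rw [mul_comm a, mul_comm (a ^ 3)]
  exact this

lemma sum_cset (c : F) (e : ZMod 2) :
    ∑ x ∈ Finset.univ.erase (0 : F), (-1 : ℤ) ^ (T (c * x + x⁻¹)).val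
      = (-1) ^ e.val * ((Finset.univ.erase (0 : F)).card - 2 * (cset c 1 (e + 1)).card) := by
  have h : ∀ x : F, (-1 : ℤ) ^ (T (c * x + x⁻¹)).val
      = (-1) ^ e.val * (1 - 2 * if T (c * x + 1 / x) = e + 1 then 1 else 0) := by
    intro x
    rw [one_div]
    generalize T (c * x + x⁻¹) = t
    revert t e
    decide
  rw [Finset.sum_congr rfl (fun x _ => h x), ← Finset.mul_sum, Finset.sum_sub_distrib,
    ← Finset.mul_sum, cset, Finset.sum_boole]
  simp

end KlAux

lemma Kl_HZ (m : ℕ) (hm : 0 < m) (a : GaloisField 2 m) :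
    Kl m (a * (a + 1) ^ 3) = Kl m (a ^ 3 * (a + 1)) := by
  classical
  letI := Fintype.ofFinite (GaloisField 2 m)
  by_cases ha : a = 0
  · simp [ha]
  by_cases h1 : a + 1 = 0
  · simp [h1]
  have hT1 : Algebra.trace (ZMod 2) (GaloisField 2 m) 1 = (m : ZMod 2) := by
    have := Algebra.trace_algebraMap (R := ZMod 2) (S := GaloisField 2 m) 1
    rw [GaloisField.finrank 2 hm.ne'] at this
    simpa using this
  have key : (cset (a ^ 3 * (a + 1)) 1 (Algebra.trace (ZMod 2) (GaloisField 2 m) a + 1)).card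
      = (cset (a * (a + 1) ^ 3) 1 (Algebra.trace (ZMod 2) (GaloisField 2 m) a + 1)).card := by
    rcases Nat.even_or_odd m with hm2 | hm2
    · apply card_eq_even _ a ha h1
      rw [hT1]
      exact (ZMod.natCast_eq_zero_iff_even).2 hm2
    · have hT : Algebra.trace (ZMod 2) (GaloisField 2 m) 1 = 1 := by
        rw [hT1]; exact (ZMod.natCast_eq_one_iff_odd).2 hm2
      have hF : (Fintype.card (GaloisField 2 m) - 1).Coprime 3 := by
        rw [← Nat.card_eq_fintype_card, GaloisField.card 2 m hm.ne']
        obtain ⟨k, rfl⟩ := hm2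
        rw [Nat.coprime_comm, Nat.Prime.coprime_iff_not_dvd Nat.prime_three]
        have : 2 ^ (2 * k + 1) % 3 = 2 := by
          rw [pow_succ, pow_mul, Nat.mul_mod, Nat.pow_mod]
          simp
        generalize 2 ^ (2 * k + 1) = n at this
        omega
      have := card_eq_odd hF hT a ha h1
      rw [cset_scale a _ (mul_ne_zero (pow_ne_zero 2 ha) h1),
      cset_scale a _ (pow_ne_zero 3 h1)] at this
      have e : a * (a ^ 2 * (a + 1)) = a ^ 3 * (a + 1) := by ring
      rwa [e] at this
  have e1 := sum_cset (a ^ 3 * (a + 1)) (Algebra.trace (ZMod 2) (GaloisField 2 m) a)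
  have e2 := sum_cset (a * (a + 1) ^ 3) (Algebra.trace (ZMod 2) (GaloisField 2 m) a)
  rw [key, ← e2] at e1
  unfold Kl
  convert e1.symm

theorem cor2 (m : ℕ) (hm : 0 < m) (b : GaloisField 2 m) (hb : b ≠ 1) :
    Kl m (b ^ 3 * (b ^ 3 + b + 1) ^ 3 / (1 + b) ^ 4)
      = Kl m (b ^ 9 * (b ^ 3 + b + 1) / (1 + b) ^ 4) := by
  have h1 : 1 + b ≠ 0 := by
    intro h; apply hb; grind
  have h := Kl_HZ m hm (b ^ 3 / (1 + b))
  have e1 : b ^ 3 / (1 + b) * (b ^ 3 / (1 + b) + 1) ^ 3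
      = b ^ 3 * (b ^ 3 + b + 1) ^ 3 / (1 + b) ^ 4 := by
    field_simp; ring
  have e2 : (b ^ 3 / (1 + b)) ^ 3 * (b ^ 3 / (1 + b) + 1)
      = b ^ 9 * (b ^ 3 + b + 1) / (1 + b) ^ 4 := by
    field_simp; ring
  rwa [e1, e2] at h
end
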